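/- For every ε > 0 there is a constant K = K(ε) > 0 such that for all R > 0, the number of E-reduced quadratic irrationals ω with ω* < 0 and ϱ_E(ω) ≤ R satisfies |#{ω ∈ ℛ_E : ω* < 0, ϱ_E(ω) ≤ R} − (e^R·log 2)/π²| ≤ K·e^{(3/4+ε)R}. -/

import Mathlib

noncomputable section

/-- `ω'` is the conjugate of the quadratic irrational `ω`: both are roots of the
minimal integer polynomial `A X^2 + B X + C` of `ω` (with `A > 0`, `gcd(A,B,C) = 1`),
and `ω' ≠ ω`. -/
def IsConjPair (ω ω' : ℝ) : Prop :=
  Irrational ω ∧ ∃ A B C : ℤ, 0 < A ∧ Int.gcd (Int.gcd A B : ℤ) C = 1 ∧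
    (A : ℝ) * ω ^ 2 + B * ω + C = 0 ∧ (A : ℝ) * ω' ^ 2 + B * ω' + C = 0 ∧ ω' ≠ ω

/-- The quadratic irrational `ω` has discriminant `Δ = B^2 - 4AC`, where
`A X^2 + B X + C` is its minimal integer polynomial (`A > 0`, `gcd(A,B,C) = 1`). -/
def HasDisc (ω : ℝ) (Δ : ℤ) : Prop :=
  Irrational ω ∧ ∃ A B C : ℤ, 0 < A ∧ Int.gcd (Int.gcd A B : ℤ) C = 1 ∧
    (A : ℝ) * ω ^ 2 + B * ω + C = 0 ∧ Δ = B ^ 2 - 4 * A * C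

/-- The matrix `M(a,e) = (a, e; 1, 0)`. -/
def Mmat (a e : ℤ) : Matrix (Fin 2) (Fin 2) ℤ := !![a, e; 1, 0]

/-- The spectral radius of a 2x2 integer matrix with trace `t`, namely
`(t + sqrt (t^2 - 4)) / 2`. -/
def specRad (σ : Matrix (Fin 2) (Fin 2) ℤ) : ℝ :=
  ((σ.trace : ℝ) + Real.sqrt ((σ.trace : ℝ) ^ 2 - 4)) / 2

/-- First ECF digit: `a₁(u) = 2⎣(u+1)/2⎦`. -/
def aE (u : ℝ) : ℤ := 2 * ⌊(u + 1) / 2⌋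

/-- Sign digit: `e₁(u) = sgn (u - a₁(u)) ∈ {±1}`. -/
def eE (u : ℝ) : ℤ := if (aE u : ℝ) < u then 1 else -1

/-- The ECF Gauss shift `T_E(u) = e₁(u) / (u - a₁(u))`. -/
def TE (u : ℝ) : ℝ := (eE u : ℝ) / (u - aE u)

/-- The least period of `ω` under `T_E` (junk value `0` if `ω` is not periodic). -/
def perE (ω : ℝ) : ℕ := sInf {n : ℕ | 0 < n ∧ TE^[n] ω = ω}

/-- `Ω_E(ω) = M(a₁,e₁) ⋯ M(aₙ,eₙ)`, where `n = per(ω)` and `(aᵢ, eᵢ)` are the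
ECF digits of `ω`. -/
def OmegaE (ω : ℝ) : Matrix (Fin 2) (Fin 2) ℤ :=
  ((List.range (perE ω)).map (fun i => Mmat (aE (TE^[i] ω)) (eE (TE^[i] ω)))).prod

/-- `Ω̃_E(ω)`: equal to `Ω_E(ω)` if `det Ω_E(ω) = 1`, and to `Ω_E(ω)²` otherwise. -/
def OmegaTildeE (ω : ℝ) : Matrix (Fin 2) (Fin 2) ℤ :=
  if (OmegaE ω).det = 1 then OmegaE ω else OmegaE ω ^ 2

/-- The length `ϱ_E(ω) = 2 log 𝔯(Ω̃_E(ω))`. -/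
def rhoE (ω : ℝ) : ℝ := 2 * Real.log (specRad (OmegaTildeE ω))


section

open Polynomial in
theorem step_nonvanish {K : Type*} [Field K] {p μ : ℕ} [Fact p.Prime] [CharP K p] (hp : p ≠ 2)
    (D : K[X]) (hD : Squarefree D) (hDd : 0 < D.natDegree) (hD0 : D.coeff 0 ≠ 0)
    (r s : K[X]) (hr : 2 * r.natDegree + D.natDegree < p ^ μ)
    (hs : 2 * s.natDegree + D.natDegree < p ^ μ)
    (h : X ^ (p ^ μ) ∣ s + r * D ^ ((p ^ μ - 1) / 2)) : s = 0 ∧ r = 0 := by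
  have hodd : Odd (p ^ μ) := ((Fact.out : p.Prime).odd_of_ne_two hp).pow
  set L := p ^ μ with hL
  have h1 : X ^ L ∣ D * s ^ 2 - D ^ L * r ^ 2 := by
    have : D * s ^ 2 - D ^ L * r ^ 2 = (s + r * D ^ ((L - 1) / 2)) * (D * (s - r * D ^ ((L - 1) / 2))) := by
      have e : D ^ L = D * (D ^ ((L - 1) / 2)) ^ 2 := by
        rw [← pow_mul, ← pow_succ']
        congr 1
        obtain ⟨k, hk⟩ := hodd
        omega
      rw [e]; ring
    rw [this]
    exact h.mul_right _
  have h2 : X ^ L ∣ D ^ L - C (D.coeff 0 ^ L) := by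
    have : X ∣ D - C (D.coeff 0) := by
      rw [X_dvd_iff]; simp
    have := pow_dvd_pow_of_dvd this L
    rwa [hL, sub_pow_char_pow, ← C_pow] at this
  have h3 : X ^ L ∣ D * s ^ 2 - C (D.coeff 0 ^ L) * r ^ 2 := by
    have : D * s ^ 2 - C (D.coeff 0 ^ L) * r ^ 2 = (D * s ^ 2 - D ^ L * r ^ 2) + (D ^ L - C (D.coeff 0 ^ L)) * r ^ 2 := by ring
    rw [this]
    exact dvd_add h1 (h2.mul_right _)
  have h4 : D * s ^ 2 - C (D.coeff 0 ^ L) * r ^ 2 = 0 := by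
    apply eq_zero_of_dvd_of_natDegree_lt h3
    rw [natDegree_X_pow]
    refine lt_of_le_of_lt (natDegree_sub_le _ _) (max_lt ?_ ?_)
    · refine lt_of_le_of_lt natDegree_mul_le ?_
      rw [natDegree_pow]; omega
    · refine lt_of_le_of_lt (natDegree_C_mul_le _ _) ?_
      rw [natDegree_pow]; omega
  rw [sub_eq_zero] at h4
  set c := D.coeff 0 ^ L with hc
  have hc0 : c ≠ 0 := pow_ne_zero _ hD0
  clear_value c
  clear hr hs h h1 h3
  have key : ∀ n : ℕ, ∀ r s : K[X], r.natDegree ≤ n → D * s ^ 2 = C c * r ^ 2 → r = 0 := by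
    intro n
    induction n using Nat.strong_induction_on with
    | _ n ih =>
      intro r s hn h
      by_contra hr0
      have hDr : D ∣ r := by
        rw [← hD.dvd_pow_iff_dvd two_ne_zero]
        have : D ∣ C c * r ^ 2 := ⟨s ^ 2, h.symm⟩
        exact (IsUnit.dvd_mul_left (isUnit_C.2 hc0.isUnit)).1 this
      obtain ⟨r', rfl⟩ := hDr
      have hDne : D ≠ 0 := by rintro rfl; simp at hDd
      have h5 : s ^ 2 = D * (C c * r' ^ 2) := by
        apply mul_left_cancel₀ hDne
        rw [h]; ring
      have hDs : D ∣ s := by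
        rw [← hD.dvd_pow_iff_dvd two_ne_zero]
        exact ⟨_, h5⟩
      obtain ⟨s', rfl⟩ := hDs
      have h6 : D * s' ^ 2 = C c * r' ^ 2 := by
        apply mul_left_cancel₀ hDne
        rw [← h5]; ring
      have hr'0 : r' ≠ 0 := by rintro rfl; simp at hr0
      have := ih r'.natDegree (by rw [natDegree_mul hDne hr'0] at hn; omega) r' s' le_rfl h6
      exact hr'0 this
  have hr0 := key _ r s le_rfl h4
  refine ⟨?_, hr0⟩
  have hDne : D ≠ 0 := by rintro rfl; simp at hDd
  rw [hr0] at h4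
  simpa [hDne] using h4

open Polynomial in
theorem step_nonvanish_sum {K : Type*} [Field K] {p μ : ℕ} [Fact p.Prime] [CharP K p] (hp : p ≠ 2)
    (D : K[X]) (hD : Squarefree D) (hDd : 0 < D.natDegree) (hD0 : D.coeff 0 ≠ 0) (V : ℕ) :
    ∀ (r s : ℕ → K[X]), (∀ j, 2 * (r j).natDegree + D.natDegree < p ^ μ) →
    (∀ j, 2 * (s j).natDegree + D.natDegree < p ^ μ) →
    (∑ j ∈ Finset.range V, X ^ (j * p ^ μ) * (s j + r j * D ^ ((p ^ μ - 1) / 2)) = 0) →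
    ∀ j < V, s j = 0 ∧ r j = 0 := by
  induction V with
  | zero => intro r s _ _ _ j hj; omega
  | succ V ih =>
    intro r s hr hs h
    rw [Finset.sum_range_succ'] at h
    have e : ∑ j ∈ Finset.range V, (X : K[X]) ^ ((j + 1) * p ^ μ) * (s (j + 1) + r (j + 1) * D ^ ((p ^ μ - 1) / 2))
       = X ^ (p ^ μ) * ∑ j ∈ Finset.range V, X ^ (j * p ^ μ) * (s (j + 1) + r (j + 1) * D ^ ((p ^ μ - 1) / 2)) := by
      rw [Finset.mul_sum]
      refine Finset.sum_congr rfl fun j _ => ?_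
      rw [add_mul, pow_add, one_mul]; ring
    rw [e] at h
    simp only [zero_mul, pow_zero, one_mul] at h
    have h0 : s 0 = 0 ∧ r 0 = 0 := by
      apply step_nonvanish hp D hD hDd hD0 _ _ (hr 0) (hs 0)
      rw [add_comm] at h
      rw [eq_neg_of_add_eq_zero_left h]
      exact (Dvd.intro _ rfl).neg_right
    rw [h0.1, h0.2] at h
    simp only [zero_mul, add_zero, mul_eq_zero, pow_eq_zero_iff', X_ne_zero, false_and, false_or] at h
    have := ih (fun j => r (j + 1)) (fun j => s (j + 1)) (fun j => hr _) (fun j => hs _) h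
    intro j hj
    cases j with
    | zero => exact h0
    | succ j => exact this j (by omega)

open Polynomial in
theorem step_dim {K : Type*} [Field K] (D : K[X]) (U V L l p : ℕ) (hl : L = 2 * l + 1)
    (hDp : D.natDegree ≤ 2 * p)
    (h2 : V + U * L + p * L < 2 * V * U) (ε : K) :
    ∃ c : Fin 2 × Fin V × Fin U → K, c ≠ 0 ∧ ∑ j : Fin V, ∑ i : Fin U,
        (C (c (0, j, i)) * (X ^ (j : ℕ) * X ^ ((i : ℕ) * L) * D ^ l) +
          C (c (1, j, i)) * (C ε * X ^ (j : ℕ) * X ^ ((i : ℕ) * L))) = 0 := by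
  obtain ⟨E, hE⟩ : ∃ E, E = V + U * L + p * L := ⟨_, rfl⟩
  obtain ⟨Q, hQ⟩ : ∃ Q : (Fin 2 × Fin V × Fin U → K) →ₗ[K] K[X], ∀ c, Q c = ∑ j : Fin V, ∑ i : Fin U,
        (C (c (0, j, i)) * (X ^ (j : ℕ) * X ^ ((i : ℕ) * L) * D ^ l) +
          C (c (1, j, i)) * (C ε * X ^ (j : ℕ) * X ^ ((i : ℕ) * L))) := by
    refine ⟨⟨⟨fun c => ∑ j : Fin V, ∑ i : Fin U,
        (C (c (0, j, i)) * (X ^ (j : ℕ) * X ^ ((i : ℕ) * L) * D ^ l) +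
          C (c (1, j, i)) * (C ε * X ^ (j : ℕ) * X ^ ((i : ℕ) * L))), ?_⟩, ?_⟩, fun c => rfl⟩
    · intro c c'
      rw [← Finset.sum_add_distrib]
      refine Finset.sum_congr rfl fun j _ => ?_
      rw [← Finset.sum_add_distrib]
      refine Finset.sum_congr rfl fun i _ => ?_
      simp only [Pi.add_apply, C_add]; ring
    · intro a c
      simp only [Finset.smul_sum, RingHom.id_apply]
      refine Finset.sum_congr rfl fun j _ => ?_
      refine Finset.sum_congr rfl fun i _ => ?_
      simp only [Pi.smul_apply, smul_eq_mul, C_mul, smul_eq_C_mul]; ring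
  let Φ : (Fin 2 × Fin V × Fin U → K) →ₗ[K] (Fin E → K) :=
    LinearMap.pi fun n => (lcoeff K n) ∘ₗ Q
  have hker : LinearMap.ker Φ ≠ ⊥ := by
    apply LinearMap.ker_ne_bot_of_finrank_lt
    simp only [Module.finrank_fintype_fun_eq_card, Fintype.card_fin, Fintype.card_prod]
    rw [← mul_assoc, hE]; exact h2
  obtain ⟨c, hc, hc0⟩ := Submodule.exists_mem_ne_zero_of_ne_bot hker
  refine ⟨c, hc0, ?_⟩
  have hQdeg : (Q c).natDegree < E := by
    have hEpos : 0 < E := by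
      rcases Nat.eq_zero_or_pos V with h | h
      · subst h; simp at h2
      · omega
    rw [hQ]
    refine lt_of_le_of_lt (natDegree_sum_le_of_forall_le (n := E - 1) _ _ fun j _ => ?_) (by omega)
    refine natDegree_sum_le_of_forall_le _ _ fun i _ => ?_
    have hj := j.2
    have hi := i.2
    have hiL : (i : ℕ) * L + L ≤ U * L := by
      have : ((i : ℕ) + 1) * L ≤ U * L := Nat.mul_le_mul_right _ hi
      linarith
    have hDl : (D ^ l).natDegree ≤ p * L := by
      refine le_trans natDegree_pow_le ?_
      calc l * D.natDegree ≤ l * (2 * p) := Nat.mul_le_mul_left _ hDp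
        _ = p * (2 * l) := by ring
        _ ≤ p * L := Nat.mul_le_mul_left _ (by omega)
    refine le_trans (natDegree_add_le _ _) (max_le ?_ ?_)
    · refine le_trans (natDegree_C_mul_le _ _) ?_
      refine le_trans natDegree_mul_le ?_
      refine le_trans (add_le_add natDegree_mul_le le_rfl) ?_
      simp only [natDegree_X_pow]
      omega
    · refine le_trans (natDegree_C_mul_le _ _) ?_
      rw [mul_assoc]
      refine le_trans (natDegree_C_mul_le _ _) ?_
      refine le_trans natDegree_mul_le ?_
      simp only [natDegree_X_pow]
      omega
  rw [← hQ]
  ext n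
  rw [coeff_zero]
  by_cases hn : n < E
  · have := congrFun (LinearMap.mem_ker.1 hc) ⟨n, hn⟩
    simpa [Φ] using this
  · exact coeff_eq_zero_of_natDegree_lt (by omega)

open Polynomial in
theorem step_main {K : Type*} [Field K] [Fintype K] [DecidableEq K] {p μ : ℕ} [Fact p.Prime] [CharP K p]
    (hp : p ≠ 2) (hcard : Fintype.card K = (p ^ μ) ^ 2)
    (D : K[X]) (hD : Squarefree D) (hDd : 0 < D.natDegree) (hDp : D.natDegree ≤ 2 * p)
    (hD0 : D.coeff 0 ≠ 0) (U V : ℕ) (h1 : 2 * U + 2 * p < p ^ μ)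
    (h2 : V + U * p ^ μ + p * p ^ μ < 2 * V * U) (ε : K) :
    (Finset.univ.filter fun y : K => (D.eval y) ^ (((p ^ μ) ^ 2 - 1) / 2) = ε ∧ D.eval y ≠ 0).card
      ≤ (V + p) * p ^ μ := by
  have hodd : Odd (p ^ μ) := ((Fact.out : p.Prime).odd_of_ne_two hp).pow
  set L := p ^ μ with hL
  obtain ⟨l, hl⟩ := hodd
  have hl2 : (L - 1) / 2 = l := by omega
  obtain ⟨c, hc0, hQ0⟩ := step_dim D U V L l p hl hDp h2 ε
  -- L-th roots
  have hsurj : Function.Surjective (fun x : K => x ^ L) := by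
    have : Function.Injective (iterateFrobenius K p μ) := iterateFrobenius_inj K p μ
    have := Finite.surjective_of_injective this
    intro x
    obtain ⟨y, hy⟩ := this x
    exact ⟨y, by simpa [iterateFrobenius_def] using hy⟩
  choose ρ hρ using hsurj
  replace hρ : ∀ b, ρ b ^ L = b := hρ
  let s : ℕ → K[X] := fun j => if hj : j < V then ∑ i : Fin U, C (ρ (c (0, ⟨j, hj⟩, i))) * X ^ (i : ℕ) else 0
  let r : ℕ → K[X] := fun j => if hj : j < V then ∑ i : Fin U, C (ρ (c (1, ⟨j, hj⟩, i))) * X ^ (i : ℕ) else 0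
  have hdeg : ∀ f : Fin U → K, 2 * (∑ i : Fin U, C (f i) * X ^ (i : ℕ)).natDegree + D.natDegree < L := by
    intro f
    have : (∑ i : Fin U, C (f i) * X ^ (i : ℕ)).natDegree ≤ U := by
      refine natDegree_sum_le_of_forall_le _ _ fun i _ => ?_
      exact (natDegree_C_mul_X_pow_le _ _).trans i.2.le
    omega
  have hsd : ∀ j, 2 * (s j).natDegree + D.natDegree < L := by
    intro j
    by_cases hj : j < V
    · simp only [s, hj, dif_pos]; exact hdeg _
    · simp only [s, hj, dif_neg, not_false_eq_true, natDegree_zero]; omega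
  have hrd : ∀ j, 2 * (r j).natDegree + D.natDegree < L := by
    intro j
    by_cases hj : j < V
    · simp only [r, hj, dif_pos]; exact hdeg _
    · simp only [r, hj, dif_neg, not_false_eq_true, natDegree_zero]; omega
  let G : K[X] := ∑ j ∈ Finset.range V, X ^ (j * L) * (s j + r j * D ^ ((L - 1) / 2))
  have hG : G ≠ 0 := by
    intro hG
    have := step_nonvanish_sum hp D hD hDd hD0 V r s hrd hsd hG
    apply hc0
    have hcoef : ∀ f : Fin U → K, (∑ i : Fin U, C (f i) * (X : K[X]) ^ (i : ℕ)) = 0 → ∀ i, f i = 0 := by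
      intro f hf i
      have := congrArg (fun P => coeff P (i : ℕ)) hf
      simp only [finsetSum_coeff, coeff_C_mul, coeff_X_pow, coeff_zero] at this
      rw [Finset.sum_eq_single i] at this
      · simpa using this
      · intro b _ hb
        rw [if_neg]
        · simp
        · intro h; exact hb (Fin.ext h.symm)
      · simp
    have hLpos : L ≠ 0 := by omega
    funext ⟨t, j, i⟩
    have hj := this j j.2
    simp only [s, r, j.2, dif_pos] at hj
    have hs := hcoef _ hj.1 i
    have hr := hcoef _ hj.2 i
    fin_cases t
    · have := hρ (c (0, j, i))
      simp only [Fin.eta] at hs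
      simp only [hs, zero_pow hLpos] at this
      exact this.symm
    · have := hρ (c (1, j, i))
      simp only [Fin.eta] at hr
      simp only [hr, zero_pow hLpos] at this
      exact this.symm
  have hGdeg : G.natDegree ≤ (V + p) * L := by
    refine natDegree_sum_le_of_forall_le _ _ fun j hj => ?_
    have hj := Finset.mem_range.1 hj
    have hjL : j * L + L ≤ V * L := by
      have : (j + 1) * L ≤ V * L := Nat.mul_le_mul_right _ hj
      linarith
    have hDl : (D ^ l).natDegree ≤ p * (2 * l) := by
      refine le_trans natDegree_pow_le ?_
      calc l * D.natDegree ≤ l * (2 * p) := Nat.mul_le_mul_left _ hDp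
        _ = p * (2 * l) := by ring
    have hpl : p * (2 * l) + p = p * L := by rw [hl]; ring
    refine le_trans natDegree_mul_le ?_
    rw [natDegree_X_pow, hl2]
    have h3 : (s j + r j * D ^ l).natDegree ≤ L + p * L := by
      refine le_trans (natDegree_add_le _ _) (max_le ?_ ?_)
      · have := hsd j; omega
      · refine le_trans natDegree_mul_le ?_
        have := hrd j
        omega
    rw [add_mul]; omega
  refine le_trans ?_ hGdeg
  refine le_trans ?_ (card_roots' G)
  refine le_trans ?_ (Multiset.toFinset_card_le _)
  apply Finset.card_le_card
  intro y hy
  rw [Finset.mem_filter] at hy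
  obtain ⟨-, hy1, hy2⟩ := hy
  rw [Multiset.mem_toFinset, mem_roots hG, IsRoot]
  have hLpos : L ≠ 0 := by omega
  rw [← pow_eq_zero_iff hLpos]
  have hyq : y ^ (L * L) = y := by
    rw [← sq, ← hcard]; exact FiniteField.pow_card y
  set δ := D.eval y with hδ
  have hrpow : ∀ j (hj : j < V), ((r j).eval y) ^ L = ∑ i : Fin U, c (1, ⟨j, hj⟩, i) * y ^ ((i : ℕ) * L) := by
    intro j hj
    simp only [r, hj, dif_pos, eval_finsetSum, eval_mul, eval_C, eval_pow, eval_X]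
    rw [hL, sum_pow_char_pow]
    refine Finset.sum_congr rfl fun i _ => ?_
    rw [mul_pow, ← hL, hρ, ← pow_mul]
  have hspow : ∀ j (hj : j < V), ((s j).eval y) ^ L = ∑ i : Fin U, c (0, ⟨j, hj⟩, i) * y ^ ((i : ℕ) * L) := by
    intro j hj
    simp only [s, hj, dif_pos, eval_finsetSum, eval_mul, eval_C, eval_pow, eval_X]
    rw [hL, sum_pow_char_pow]
    refine Finset.sum_congr rfl fun i _ => ?_
    rw [mul_pow, ← hL, hρ, ← pow_mul]
  have hGe : G.eval y ^ L = ∑ j : Fin V, y ^ (j : ℕ) * (((s j).eval y) ^ L + ((r j).eval y) ^ L * δ ^ (l * L)) := by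
    simp only [G, eval_finsetSum, eval_mul, eval_add, eval_pow, eval_X, hl2]
    rw [hL, sum_pow_char_pow, Finset.sum_range]
    refine Finset.sum_congr rfl fun j _ => ?_
    rw [mul_pow, add_pow_char_pow, mul_pow, ← hL, ← pow_mul, ← pow_mul, mul_assoc, mul_comm (j : ℕ), pow_mul, hyq]
  have hδε : δ ^ l * δ ^ (l * L) = ε := by
    rw [← hy1, ← pow_add]
    congr 1
    rw [hl]
    have : (2 * l + 1) ^ 2 - 1 = 2 * (l + l * (2 * l + 1)) := by
      have : (2 * l + 1) ^ 2 = 2 * (l + l * (2 * l + 1)) + 1 := by ring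
      omega
    rw [this]; omega
  have hδl : δ ^ l ≠ 0 := pow_ne_zero _ hy2
  have : δ ^ l * (G.eval y ^ L) = ∑ j : Fin V, y ^ (j : ℕ) * (((s j).eval y) ^ L * δ ^ l + ε * ((r j).eval y) ^ L) := by
    rw [hGe, Finset.mul_sum]
    refine Finset.sum_congr rfl fun j _ => ?_
    rw [← hδε]; ring
  have hQe := congrArg (fun P => P.eval y) hQ0
  have h0 : ∑ j : Fin V, y ^ (j : ℕ) * (((s j).eval y) ^ L * δ ^ l + ε * ((r j).eval y) ^ L) = 0 := by
    rw [← eval_zero (x := y), ← hQe]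
    simp only [eval_finsetSum]
    refine Finset.sum_congr rfl fun j _ => ?_
    rw [hspow j j.2, hrpow j j.2, Finset.sum_mul, Finset.mul_sum, ← Finset.sum_add_distrib, Finset.mul_sum]
    refine Finset.sum_congr rfl fun i _ => ?_
    simp only [eval_add, eval_mul, eval_C, eval_pow, eval_X, Fin.eta]
    ring
  rw [h0] at this
  exact (mul_eq_zero.1 this).resolve_left hδl

theorem card_sum_chi {K : Type*} [Field K] [Fintype K] [DecidableEq K] (f : K → K) :
    (∑ y : K, (quadraticChar K (f y))) =
      ((Finset.univ.filter fun y : K => quadraticChar K (f y) = 1).card : ℤ) -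
      ((Finset.univ.filter fun y : K => quadraticChar K (f y) = -1).card : ℤ) := by
  rw [Finset.card_filter, Finset.card_filter]
  push_cast
  rw [← Finset.sum_sub_distrib]
  refine Finset.sum_congr rfl fun y _ => ?_
  by_cases h : f y = 0
  · simp [h]
  · rcases quadraticChar_dichotomy h with h | h <;> rw [h] <;> norm_num

theorem stepanov_arith (L p U V : ℕ) (hp : 3 ≤ p) (hL : 9 * p ≤ L) (h1 : L ≤ 4 * U + 3)
    (h2 : L + 9 * p ≤ 2 * V + 1) (h3 : 2 * V ≤ L + 9 * p) : V + U * L + p * L < 2 * V * U := by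
  zify at *
  have a1 : 0 ≤ (2 * (V : ℤ) + 1 - L - 9 * p) * U := mul_nonneg (by linarith) (by positivity)
  have a2 : 0 ≤ (9 * (p : ℤ) - 1) * (4 * U + 3 - L) := mul_nonneg (by linarith) (by linarith)
  have a3 : 0 ≤ ((p : ℤ) - 3) * (L - 27) := mul_nonneg (by linarith) (by linarith)
  nlinarith

open Polynomial in
theorem stepanov_bound {K : Type*} [Field K] [Fintype K] [DecidableEq K] {p μ : ℕ} [Fact p.Prime] [CharP K p]
    (hp : p ≠ 2) (hμ : 3 ≤ μ) (hcard : Fintype.card K = (p ^ μ) ^ 2) (e : K) (he : e ≠ 0) :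
    |∑ y : K, quadraticChar K ((y ^ p - y) ^ 2 - e)| ≤ 13 * p * p ^ μ := by
  have hpp : p.Prime := Fact.out
  have hp3 : 3 ≤ p := by
    have := hpp.two_le
    omega
  have hodd : Odd (p ^ μ) := (hpp.odd_of_ne_two hp).pow
  have hLp : 9 * p ≤ p ^ μ := by
    calc 9 * p ≤ p ^ 2 * p := Nat.mul_le_mul_right _ (by nlinarith)
      _ = p ^ 3 := by ring
      _ ≤ p ^ μ := Nat.pow_le_pow_right (by omega) hμ
  have hchar : ringChar K ≠ 2 := by
    rw [ringChar.eq K p]; exact hp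
  obtain ⟨D, hDdef⟩ : ∃ D : K[X], D = (X ^ p - X) ^ 2 - C e := ⟨_, rfl⟩
  have hAS : (X ^ p - X : K[X]).natDegree = p := by
    apply natDegree_sub_eq_left_of_natDegree_lt _ |>.trans
    · simp
    · simp; omega
  have hDdeg : D.natDegree = 2 * p := by
    rw [hDdef, natDegree_sub_C, natDegree_pow, hAS]
  have hDvalue : ∀ y, D.eval y = (y ^ p - y) ^ 2 - e := by
    intro y; simp [hDdef]
  have hD0 : D.coeff 0 ≠ 0 := by
    rw [coeff_zero_eq_eval_zero, hDvalue, zero_pow (by omega)]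
    simpa using he
  have hDer : derivative D = - (2 * (X ^ p - X)) := by
    rw [hDdef]
    have h2 : (2 : K[X]) = C 2 := rfl
    simp only [derivative_sub, derivative_C, derivative_pow, derivative_X, Nat.cast_ofNat, h2,
      CharP.cast_eq_zero K p, C_0]
    ring
  have h2K : (2 : K) ≠ 0 := Ring.two_ne_zero hchar
  have hDsq : Squarefree D := by
    apply Separable.squarefree
    rw [Separable, hDer]
    refine ⟨C (-e⁻¹), C (-(2 * e)⁻¹) * (X ^ p - X), ?_⟩
    have h2 : (2 : K[X]) = C 2 := rfl
    rw [hDdef, h2]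
    have : C (-e⁻¹) * ((X ^ p - X) ^ 2 - C e) + C (-(2 * e)⁻¹) * (X ^ p - X) * -(C 2 * (X ^ p - X)) =
      (C (-e⁻¹) + C ((2 * e)⁻¹ * 2)) * (X ^ p - X) ^ 2 + C (e⁻¹ * e) := by
      simp only [C_mul, C_neg]; ring
    rw [this, inv_mul_cancel₀ he, ← C_add]
    have : -e⁻¹ + (2 * e)⁻¹ * 2 = 0 := by field_simp; ring
    rw [this]; simp
  obtain ⟨U, hU⟩ : ∃ U, U = p ^ μ / 4 := ⟨_, rfl⟩
  obtain ⟨V, hV⟩ : ∃ V, V = (p ^ μ + 9 * p) / 2 := ⟨_, rfl⟩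
  obtain ⟨L, hL⟩ : ∃ L, L = p ^ μ := ⟨_, rfl⟩
  have hmain := fun ε => step_main hp hcard D hDsq (by omega) (by omega) hD0 U V (by omega)
    (stepanov_arith (p ^ μ) p U V hp3 hLp (by omega) (by omega) (by omega)) ε
  simp only [hDvalue] at hmain
  have hq2 : Fintype.card K / 2 = ((p ^ μ) ^ 2 - 1) / 2 := by
    rw [hcard]
    obtain ⟨k, hk⟩ := hodd.pow (n := 2)
    omega
  have hcnt : ∀ ε : ℤ, ε ≠ 0 → (Finset.univ.filter fun y : K => quadraticChar K ((y ^ p - y) ^ 2 - e) = ε).card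
      ≤ (V + p) * p ^ μ := by
    intro ε hε
    refine le_trans (Finset.card_le_card ?_) (hmain (ε : K))
    intro y hy
    rw [Finset.mem_filter] at hy ⊢
    have hne : (y ^ p - y) ^ 2 - e ≠ 0 := by
      intro h; rw [h] at hy; simp at hy; exact hε hy.symm
    refine ⟨hy.1, ?_, hne⟩
    rw [← hq2, ← quadraticChar_eq_pow_of_char_ne_two' hchar, hy.2]
  have h1 := hcnt 1 one_ne_zero
  have h2 := hcnt (-1) (by norm_num)
  have h0 : (Finset.univ.filter fun y : K => quadraticChar K ((y ^ p - y) ^ 2 - e) = 0).card ≤ 2 * p := by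
    rw [← hDdeg]
    refine le_trans ?_ (card_roots' D)
    refine le_trans (Finset.card_le_card ?_) (Multiset.toFinset_card_le _)
    intro y hy
    rw [Finset.mem_filter, quadraticChar_eq_zero_iff] at hy
    rw [Multiset.mem_toFinset, mem_roots (by rintro rfl; simp at hDdeg; omega), IsRoot, hDvalue]
    exact hy.2
  have htot : (Finset.univ.filter fun y : K => quadraticChar K ((y ^ p - y) ^ 2 - e) = 1).card +
      (Finset.univ.filter fun y : K => quadraticChar K ((y ^ p - y) ^ 2 - e) = -1).card +
      (Finset.univ.filter fun y : K => quadraticChar K ((y ^ p - y) ^ 2 - e) = 0).card = (p ^ μ) ^ 2 := by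
    rw [← hcard, ← Finset.card_univ, Finset.card_filter, Finset.card_filter, Finset.card_filter,
      ← Finset.sum_add_distrib, ← Finset.sum_add_distrib, Finset.card_eq_sum_ones]
    refine Finset.sum_congr rfl fun y _ => ?_
    by_cases h : (y ^ p - y) ^ 2 - e = 0
    · simp [h]
    · rcases quadraticChar_dichotomy h with h | h <;> rw [h] <;> norm_num
  rw [card_sum_chi]
  generalize (Finset.univ.filter fun y : K => quadraticChar K ((y ^ p - y) ^ 2 - e) = 1).card = N1 at *
  generalize (Finset.univ.filter fun y : K => quadraticChar K ((y ^ p - y) ^ 2 - e) = -1).card = N2 at *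
  generalize (Finset.univ.filter fun y : K => quadraticChar K ((y ^ p - y) ^ 2 - e) = 0).card = N0 at *
  have hV2 : 2 * V ≤ p ^ μ + 9 * p := by omega
  clear hmain hcnt hq2 hU hV hcard hLp hμ
  have hL1 : 1 ≤ p ^ μ := Nat.one_le_pow _ _ (by omega)
  have hpr : (p : ℤ) ^ μ = L := by rw [hL]; push_cast; rfl
  rw [← hL] at h1 h2 htot hV2 hL1
  rw [hpr]
  have h3 : 2 * ((V + p) * L) ≤ L ^ 2 + 11 * p * L := by nlinarith
  have h4 : p ≤ p * L := by nlinarith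
  rw [abs_le]
  have h1' : 2 * N1 ≤ L ^ 2 + 11 * p * L := by omega
  have h2' : 2 * N2 ≤ L ^ 2 + 11 * p * L := by omega
  zify at h0 h1' h2' h4 htot
  constructor <;> nlinarith

end

section

open Polynomial in
noncomputable def MonF (F : Type*) [Field F] [Fintype F] (n : ℕ) : Finset F[X] :=
  Set.Finite.toFinset (s := {f : F[X] | f.Monic ∧ f.natDegree = n}) (by
    have : Finite (degreeLT F n) := Finite.of_equiv _ (degreeLTEquiv F n).toEquiv.symm
    have h2 : Finite {f : F[X] // f.Monic ∧ f.natDegree = n} :=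
      Finite.of_equiv _ (monicEquivDegreeLT (R := F) n).symm
    exact Set.finite_coe_iff.1 h2)

open Polynomial in
theorem mem_MonF {F : Type*} [Field F] [Fintype F] {n : ℕ} {f : F[X]} :
    f ∈ MonF F n ↔ f.Monic ∧ f.natDegree = n := by
  rw [MonF, Set.Finite.mem_toFinset, Set.mem_setOf_eq]

open Polynomial in
noncomputable def mkM {F : Type*} [Field F] (n : ℕ) (c : Fin n → F) : F[X] :=
  X ^ n + ∑ i : Fin n, C (c i) * X ^ (i : ℕ)

open Polynomial in
theorem mkM_deg {F : Type*} [Field F] (n : ℕ) (c : Fin n → F) :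
    (∑ i : Fin n, C (c i) * X ^ (i : ℕ)).degree < (n : WithBot ℕ) := by
  refine lt_of_le_of_lt (degree_sum_le _ _) ?_
  refine (Finset.sup_lt_iff (WithBot.bot_lt_coe n)).2 ?_
  intro i _
  refine lt_of_le_of_lt (degree_C_mul_X_pow_le _ _) ?_
  exact WithBot.coe_lt_coe.2 i.2

open Polynomial in
theorem mkM_monic {F : Type*} [Field F] (n : ℕ) (c : Fin n → F) : (mkM n c).Monic :=
  monic_X_pow_add (mkM_deg n c)

open Polynomial in
theorem mkM_natDegree {F : Type*} [Field F] (n : ℕ) (c : Fin n → F) : (mkM n c).natDegree = n := by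
  apply natDegree_eq_of_degree_eq_some
  unfold mkM
  rw [degree_add_eq_left_of_degree_lt, degree_X_pow]
  rw [degree_X_pow]
  exact mkM_deg n c

open Polynomial in
theorem mkM_coeff {F : Type*} [Field F] (n : ℕ) (c : Fin n → F) (i : Fin n) : (mkM n c).coeff i = c i := by
  unfold mkM
  simp only [coeff_add, coeff_X_pow, finsetSum_coeff, coeff_C_mul]
  rw [if_neg (by have := i.2; omega), Finset.sum_eq_single i]
  · simp
  · intro b _ hb
    rw [if_neg]
    · simp
    · intro h; exact hb (Fin.ext h.symm)
  · simp

open Polynomial in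
/-- sum over monic polynomials via coefficient vectors -/
theorem sum_MonF {F : Type*} [Field F] [Fintype F] (n : ℕ) (g : F[X] → ℂ) :
    ∑ f ∈ MonF F n, g f = ∑ c : Fin n → F, g (mkM n c) := by
  symm
  refine Finset.sum_nbij (fun c : Fin n → F => mkM n c) ?_ ?_ ?_ ?_
  · intro c _
    rw [mem_MonF]
    exact ⟨mkM_monic n c, mkM_natDegree n c⟩
  · intro c _ c' _ h
    funext i
    have h : mkM n c = mkM n c' := h
    rw [← mkM_coeff n c i, h, mkM_coeff]
  · intro f hf
    rw [Finset.mem_coe, mem_MonF] at hf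
    refine ⟨fun i => f.coeff i, by simp, ?_⟩
    conv_rhs => rw [hf.1.as_sum, hf.2]
    rw [Finset.sum_range]
    rfl
  · intro c _; rfl

open Polynomial in
/-- the completely multiplicative weight -/
noncomputable def lamF {F : Type*} [Field F] [DecidableEq F] (ψ : AddChar F ℂ) (a b : F) (f : F[X]) : ℂ :=
  if f.coeff 0 = 0 then 0 else ψ (-(a * f.nextCoeff) - b * (f.coeff 1 / f.coeff 0))

open Polynomial in
theorem lamF_mul {F : Type*} [Field F] [DecidableEq F] (ψ : AddChar F ℂ) (a b : F) {f g : F[X]}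
    (hf : f.Monic) (hg : g.Monic) : lamF ψ a b (f * g) = lamF ψ a b f * lamF ψ a b g := by
  unfold lamF
  rw [mul_coeff_zero]
  by_cases h1 : f.coeff 0 = 0
  · simp [h1]
  by_cases h2 : g.coeff 0 = 0
  · simp [h2]
  rw [if_neg (mul_ne_zero h1 h2), if_neg h1, if_neg h2, ← AddChar.map_add_eq_mul]
  congr 1
  rw [hf.nextCoeff_mul hg, mul_coeff_one]
  field_simp
  ring

open Polynomial in
theorem lamF_one {F : Type*} [Field F] [DecidableEq F] (ψ : AddChar F ℂ) (a b : F) :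
    lamF ψ a b 1 = 1 := by
  unfold lamF
  simp [nextCoeff, coeff_one]

open Polynomial in
theorem lamF_pow {F : Type*} [Field F] [DecidableEq F] (ψ : AddChar F ℂ) (a b : F) {f : F[X]}
    (hf : f.Monic) (j : ℕ) : lamF ψ a b (f ^ j) = lamF ψ a b f ^ j := by
  induction j with
  | zero => simp [lamF_one]
  | succ j ih => rw [pow_succ, lamF_mul ψ a b (hf.pow j) hf, ih, pow_succ]

noncomputable def cF {F : Type*} [Field F] [Fintype F] [DecidableEq F] (ψ : AddChar F ℂ) (a b : F) (n : ℕ) : ℂ :=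
  ∑ f ∈ MonF F n, lamF ψ a b f

theorem sum_psi_mul {F : Type*} [Field F] [Fintype F] [DecidableEq F] {ψ : AddChar F ℂ} (hψ : ψ ≠ 1) (a : F) :
    ∑ x : F, ψ (a * x) = if a = 0 then (Fintype.card F : ℂ) else 0 := by
  have := AddChar.sum_mulShift a (AddChar.IsPrimitive.of_ne_one hψ)
  simp only [mul_comm _ a] at this
  rw [this]
  split_ifs <;> simp

theorem cF_zero {F : Type*} [Field F] [Fintype F] [DecidableEq F] (ψ : AddChar F ℂ) (a b : F) :
    cF ψ a b 0 = 1 := by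
  unfold cF
  rw [sum_MonF]
  simp [mkM, lamF_one]

open Polynomial in
theorem cF_one {F : Type*} [Field F] [Fintype F] [DecidableEq F] (ψ : AddChar F ℂ) (a b : F) :
    cF ψ a b 1 = ∑ x : F, if x = 0 then 0 else ψ (a * x + b * x⁻¹) := by
  unfold cF
  rw [sum_MonF]
  rw [← (Equiv.funUnique (Fin 1) F).symm.sum_comp]
  rw [← Equiv.sum_comp (Equiv.neg F) (fun x => lamF ψ a b (mkM 1 ((Equiv.funUnique (Fin 1) F).symm x)))]
  refine Finset.sum_congr rfl fun x _ => ?_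
  have : mkM 1 ((Equiv.funUnique (Fin 1) F).symm (Equiv.neg F x)) = X - C x := by
    simp [mkM, sub_eq_add_neg]
  rw [this]
  unfold lamF
  rw [nextCoeff_X_sub_C]
  simp only [coeff_sub, coeff_X_zero, coeff_C_zero, zero_sub, neg_eq_zero, coeff_X_one, coeff_C_succ, sub_zero]
  by_cases h : x = 0
  · simp [h]
  · rw [if_neg h, if_neg h]
    congr 1
    field_simp
    ring

open Polynomial in
theorem cF_two {F : Type*} [Field F] [Fintype F] [DecidableEq F] {ψ : AddChar F ℂ} (hψ : ψ ≠ 1) {a b : F}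
    (ha : a ≠ 0) (hb : b ≠ 0) : cF ψ a b 2 = Fintype.card F := by
  unfold cF
  rw [sum_MonF, ← (finTwoArrowEquiv F).symm.sum_comp, Fintype.sum_prod_type]
  have h1 : ∀ v u : F, lamF ψ a b (mkM 2 ((finTwoArrowEquiv F).symm (v, u))) =
      if v = 0 then 0 else ψ (-(a + b / v) * u) := by
    intro v u
    have : mkM 2 ((finTwoArrowEquiv F).symm (v, u)) = C 1 * X ^ 2 + C u * X + C v := by
      simp [mkM, finTwoArrowEquiv]
      ring
    rw [this]
    unfold lamF
    have hd : (C 1 * X ^ 2 + C u * X + C v : F[X]).natDegree = 2 := natDegree_quadratic one_ne_zero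
    rw [nextCoeff, hd, if_neg two_ne_zero]
    simp [coeff_X, coeff_C, coeff_X_pow]
    by_cases h : v = 0
    · simp [h]
    · simp only [h, if_false]
      congr 1
      field_simp
      ring
  simp only [h1]
  rw [Finset.sum_eq_single (-(b / a))]
  · simp only [neg_eq_zero, div_eq_zero_iff, ha, hb, or_self, if_false]
    have : a + b / -(b / a) = 0 := by field_simp; ring
    rw [this]; simp
  · intro v _ hv
    by_cases h : v = 0
    · simp [h]
    · simp only [h, if_false]
      rw [sum_psi_mul hψ, if_neg]
      intro h2
      apply hv
      field_simp at h2 ⊢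
      linear_combination -h2
  · simp

open Polynomial in
theorem cF_ge {F : Type*} [Field F] [Fintype F] [DecidableEq F] {ψ : AddChar F ℂ} (hψ : ψ ≠ 1) {a : F} (b : F)
    (ha : a ≠ 0) (n : ℕ) : cF ψ a b (n + 3) = 0 := by
  unfold cF
  rw [sum_MonF, ← (Fin.snocEquiv (fun _ : Fin (n + 3) => F)).sum_comp, Fintype.sum_prod_type_right]
  apply Finset.sum_eq_zero
  intro c _
  have h1 : ∀ x : F, lamF ψ a b (mkM (n + 3) (Fin.snocEquiv (fun _ : Fin (n + 3) => F) (x, c))) =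
     (if c 0 = 0 then 0 else ψ (-(b * (c 1 / c 0)))) * ψ (-a * x) := by
    intro x
    unfold lamF
    have e0 := mkM_coeff _ (Fin.snocEquiv (fun _ : Fin (n + 3) => F) (x, c)) 0
    have e1 := mkM_coeff _ (Fin.snocEquiv (fun _ : Fin (n + 3) => F) (x, c)) 1
    have e2 := mkM_coeff _ (Fin.snocEquiv (fun _ : Fin (n + 3) => F) (x, c)) (Fin.last _)
    have f0 : Fin.snocEquiv (fun _ : Fin (n + 3) => F) (x, c) 0 = c 0 := by
      exact Fin.snoc_castSucc (α := fun _ => F) x c 0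
    have f1 : Fin.snocEquiv (fun _ : Fin (n + 3) => F) (x, c) 1 = c 1 := by
      exact Fin.snoc_castSucc (α := fun _ => F) x c 1
    have f2 : Fin.snocEquiv (fun _ : Fin (n + 3) => F) (x, c) (Fin.last _) = x := by
      exact Fin.snoc_last (α := fun _ => F) x c
    rw [f0] at e0
    rw [f1] at e1
    rw [f2] at e2
    rw [nextCoeff, mkM_natDegree]
    simp only [Fin.val_zero, Fin.val_last, Fin.val_one] at e0 e1 e2
    rw [e0, e1]
    have : n + 3 - 1 = n + 2 := rfl
    rw [this, e2, if_neg (show ¬ (n + 3 = 0) from Nat.succ_ne_zero _)]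
    by_cases h : c 0 = 0
    · rw [if_pos h, if_pos h, zero_mul]
    · simp only [h, if_false]
      rw [← AddChar.map_add_eq_mul]
      congr 1
      ring
  simp only [h1]
  rw [← Finset.mul_sum, sum_psi_mul hψ, if_neg (neg_ne_zero.2 ha), mul_zero]

end

section

open Polynomial in
/-- monic irreducibles of degree ≤ n -/
noncomputable def IrrF (F : Type*) [Field F] [Fintype F] (n : ℕ) : Finset F[X] := by
  classical
  exact ((Finset.Icc 1 n).biUnion (fun d => MonF F d)).filter Irreducible

open Polynomial in
theorem mem_IrrF {F : Type*} [Field F] [Fintype F] {n : ℕ} {f : F[X]} :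
    f ∈ IrrF F n ↔ f.Monic ∧ Irreducible f ∧ f.natDegree ≤ n := by
  classical
  unfold IrrF
  simp only [Finset.mem_filter, Finset.mem_biUnion, mem_MonF, Finset.mem_Icc]
  constructor
  · rintro ⟨⟨d, h1, h2, h3⟩, h4⟩
    exact ⟨h2, h4, by omega⟩
  · rintro ⟨h1, h2, h3⟩
    exact ⟨⟨f.natDegree, ⟨h2.natDegree_pos, h3⟩, h1, rfl⟩, h2⟩

open Polynomial UniqueFactorizationMonoid in
theorem deg_eq_sum_count {F : Type*} [Field F] [Fintype F] [DecidableEq F] {n : ℕ} {f : F[X]} (hf : f.Monic)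
    (hn : f.natDegree = n) : n = ∑ π ∈ IrrF F n, (normalizedFactors f).count π * π.natDegree := by
  classical
  have h1 : (normalizedFactors f).prod = f := by
    have := leadingCoeff_mul_prod_normalizedFactors f
    rw [hf.leadingCoeff] at this
    simpa using this
  have h2 : f.natDegree = ((normalizedFactors f).map natDegree).sum := by
    conv_lhs => rw [← h1]
    apply natDegree_multiset_prod
    intro h
    exact (irreducible_of_normalized_factor _ h).ne_zero rfl
  rw [← hn]
  conv_lhs => rw [h2]
  rw [Finset.sum_multiset_map_count]
  apply Finset.sum_subset_zero_on_sdiff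
  · intro π hπ
    rw [Multiset.mem_toFinset] at hπ
    have hirr := irreducible_of_normalized_factor _ hπ
    rw [mem_IrrF]
    refine ⟨?_, hirr, ?_⟩
    · rw [← normalize_normalized_factor _ hπ]
      exact monic_normalize hirr.ne_zero
    · exact natDegree_le_of_dvd (dvd_of_mem_normalizedFactors hπ) hf.ne_zero
  · intro π hπ
    rw [Finset.mem_sdiff, Multiset.mem_toFinset] at hπ
    rw [Multiset.count_eq_zero_of_notMem hπ.2, zero_mul]
  · intro π _
    simp

open Polynomial UniqueFactorizationMonoid in
theorem pow_dvd_iff_count {F : Type*} [Field F] [DecidableEq F] {f π : F[X]} (hf : f ≠ 0) (hπ : Irreducible π)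
    (hm : π.Monic) (j : ℕ) : π ^ j ∣ f ↔ j ≤ (normalizedFactors f).count π := by
  rw [pow_dvd_iff_le_emultiplicity, emultiplicity_eq_count_normalizedFactors hπ hf, hm.normalize_eq_self]
  exact Nat.cast_le

open Polynomial UniqueFactorizationMonoid in
theorem count_eq_card {F : Type*} [Field F] [DecidableEq F] {f π : F[X]} (hf : f ≠ 0) (hπ : Irreducible π)
    (hm : π.Monic) [DecidablePred fun k => π.natDegree ∣ k ∧ π ^ (k / π.natDegree) ∣ f] :
    (normalizedFactors f).count π = ((Finset.Icc 1 f.natDegree).filter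
      (fun k => π.natDegree ∣ k ∧ π ^ (k / π.natDegree) ∣ f)).card := by
  have hd := hπ.natDegree_pos
  have : ((Finset.Icc 1 f.natDegree).filter
      (fun k => π.natDegree ∣ k ∧ π ^ (k / π.natDegree) ∣ f)) =
      (Finset.Icc 1 ((normalizedFactors f).count π)).image (fun j => π.natDegree * j) := by
    ext k
    simp only [Finset.mem_filter, Finset.mem_Icc, Finset.mem_image]
    constructor
    · rintro ⟨h1, ⟨j, rfl⟩, h3⟩
      rw [Nat.mul_div_cancel_left _ hd, pow_dvd_iff_count hf hπ hm] at h3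
      refine ⟨j, ⟨?_, h3⟩, rfl⟩
      rcases Nat.eq_zero_or_pos j with h | h
      · subst h; simp at h1
      · exact h
    · rintro ⟨j, ⟨h1, h2⟩, rfl⟩
      rw [Nat.mul_div_cancel_left _ hd]
      have h3 := (pow_dvd_iff_count hf hπ hm j).2 h2
      refine ⟨⟨Nat.mul_pos hd h1, ?_⟩, dvd_mul_right _ _, h3⟩
      have := natDegree_le_of_dvd h3 hf
      rw [natDegree_pow] at this
      linarith
  rw [this, Finset.card_image_of_injective]
  · simp
  · intro x y h
    exact Nat.eq_of_mul_eq_mul_left hd h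

open Polynomial in
noncomputable def LamF {F : Type*} [Field F] [Fintype F] [DecidableEq F] (ψ : AddChar F ℂ) (a b : F) (k : ℕ) : ℂ :=
  ∑ π ∈ IrrF F k, if π.natDegree ∣ k then (π.natDegree : ℂ) * lamF ψ a b π ^ (k / π.natDegree) else 0

open Polynomial in
theorem LamF_eq {F : Type*} [Field F] [Fintype F] [DecidableEq F] (ψ : AddChar F ℂ) (a b : F) {k n : ℕ}
    (hk : 0 < k) (hkn : k ≤ n) : LamF ψ a b k =
  ∑ π ∈ IrrF F n, if π.natDegree ∣ k then (π.natDegree : ℂ) * lamF ψ a b π ^ (k / π.natDegree) else 0 := by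
  unfold LamF
  apply Finset.sum_subset
  · intro π
    simp only [mem_IrrF]
    rintro ⟨h1, h2, h3⟩
    exact ⟨h1, h2, h3.trans hkn⟩
  · intro π h1 h2
    rw [mem_IrrF] at h1 h2
    rw [if_neg]
    intro h
    exact h2 ⟨h1.1, h1.2.1, Nat.le_of_dvd hk h⟩

open Polynomial in
theorem sum_dvd_MonF {F : Type*} [Field F] [Fintype F] [DecidableEq F] (ψ : AddChar F ℂ) (a b : F) {n k : ℕ}
    (hk : k ≤ n) {P : F[X]} (hP : P.Monic) (hPd : P.natDegree = k) [DecidablePred fun f : F[X] => P ∣ f] :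
    ∑ f ∈ (MonF F n).filter (fun f => P ∣ f), lamF ψ a b f = lamF ψ a b P * cF ψ a b (n - k) := by
  unfold cF
  rw [Finset.mul_sum]
  symm
  refine Finset.sum_nbij (fun g => P * g) ?_ ?_ ?_ ?_
  · intro g hg
    rw [mem_MonF] at hg
    rw [Finset.mem_filter, mem_MonF]
    refine ⟨⟨hP.mul hg.1, ?_⟩, dvd_mul_right _ _⟩
    rw [hP.natDegree_mul hg.1, hPd, hg.2]; omega
  · intro g _ g' _ h
    exact mul_left_cancel₀ hP.ne_zero h
  · intro f hf
    rw [Finset.mem_coe, Finset.mem_filter, mem_MonF] at hf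
    obtain ⟨⟨h1, h2⟩, g, rfl⟩ := hf
    have hg : g.Monic := hP.of_mul_monic_left h1
    refine ⟨g, ?_, rfl⟩
    rw [Finset.mem_coe, mem_MonF]
    refine ⟨hg, ?_⟩
    rw [hP.natDegree_mul hg] at h2; omega
  · intro g hg
    rw [mem_MonF] at hg
    exact (lamF_mul ψ a b hP hg.1).symm

open Polynomial in
theorem conv_identity {F : Type*} [Field F] [Fintype F] [DecidableEq F] (ψ : AddChar F ℂ) (a b : F) (n : ℕ) :
    (n : ℂ) * cF ψ a b n = ∑ k ∈ Finset.Icc 1 n, LamF ψ a b k * cF ψ a b (n - k) := by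
  classical
  have h1 : (n : ℂ) * cF ψ a b n = ∑ f ∈ MonF F n, ∑ π ∈ IrrF F n, ∑ k ∈ Finset.Icc 1 n,
      if π.natDegree ∣ k ∧ π ^ (k / π.natDegree) ∣ f then (π.natDegree : ℂ) * lamF ψ a b f else 0 := by
    unfold cF
    rw [Finset.mul_sum]
    refine Finset.sum_congr rfl fun f hf => ?_
    rw [mem_MonF] at hf
    have := deg_eq_sum_count hf.1 hf.2
    have h2 : (n : ℂ) = ∑ π ∈ IrrF F n, ((UniqueFactorizationMonoid.normalizedFactors f).count π : ℂ) * π.natDegree := by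
      exact_mod_cast this
    rw [h2, Finset.sum_mul]
    refine Finset.sum_congr rfl fun π hπ => ?_
    rw [mem_IrrF] at hπ
    rw [count_eq_card hf.1.ne_zero hπ.2.1 hπ.1, ← Finset.sum_filter, Finset.sum_const, nsmul_eq_mul, hf.2, mul_assoc]
  rw [h1, Finset.sum_comm]
  have h2 : ∀ π ∈ IrrF F n, ∑ f ∈ MonF F n, ∑ k ∈ Finset.Icc 1 n,
      (if π.natDegree ∣ k ∧ π ^ (k / π.natDegree) ∣ f then (π.natDegree : ℂ) * lamF ψ a b f else 0) =
      ∑ k ∈ Finset.Icc 1 n, (if π.natDegree ∣ k then (π.natDegree : ℂ) * lamF ψ a b π ^ (k / π.natDegree) else 0) * cF ψ a b (n - k) := by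
    intro π hπ
    rw [mem_IrrF] at hπ
    rw [Finset.sum_comm]
    refine Finset.sum_congr rfl fun k hk => ?_
    rw [Finset.mem_Icc] at hk
    by_cases hd : π.natDegree ∣ k
    · simp only [hd, true_and, if_true]
      rw [← Finset.sum_filter, ← Finset.mul_sum, sum_dvd_MonF ψ a b hk.2 (hπ.1.pow _), lamF_pow ψ a b hπ.1, mul_assoc]
      rw [natDegree_pow, Nat.div_mul_cancel hd]
    · simp [hd]
  rw [Finset.sum_congr rfl h2, Finset.sum_comm]
  refine Finset.sum_congr rfl fun k hk => ?_
  rw [Finset.mem_Icc] at hk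
  rw [LamF_eq ψ a b hk.1 hk.2, Finset.sum_mul]

open Polynomial in
theorem trace_inv_eq {F K : Type*} [Field F] [Field K] [Algebra F K] [FiniteDimensional F K]
    {x : K} (hx : x ≠ 0) :
    (minpoly F x⁻¹).natDegree = (minpoly F x).natDegree ∧
    (minpoly F x⁻¹).nextCoeff = (minpoly F x).coeff 1 / (minpoly F x).coeff 0 := by
  have hxi := Algebra.IsIntegral.isIntegral (R := F) x
  have hxi' := Algebra.IsIntegral.isIntegral (R := F) x⁻¹
  have hadj : IntermediateField.adjoin F {x⁻¹} = IntermediateField.adjoin F {x} := by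
    apply le_antisymm
    · rw [IntermediateField.adjoin_simple_le_iff]
      exact inv_mem (IntermediateField.mem_adjoin_simple_self F x)
    · rw [IntermediateField.adjoin_simple_le_iff]
      have := inv_mem (IntermediateField.mem_adjoin_simple_self F x⁻¹)
      rwa [inv_inv] at this
  have hdeg : (minpoly F x⁻¹).natDegree = (minpoly F x).natDegree := by
    rw [← IntermediateField.adjoin.finrank hxi', ← IntermediateField.adjoin.finrank hxi, hadj]
  refine ⟨hdeg, ?_⟩
  set π := minpoly F x with hπ
  have h0 : π.coeff 0 ≠ 0 := minpoly.coeff_zero_ne_zero hxi hx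
  have hd : 0 < π.natDegree := minpoly.natDegree_pos hxi
  have htr : π.natTrailingDegree = 0 := by
    rw [natTrailingDegree_eq_zero]; right; exact h0
  have hrevd : π.reverse.natDegree = π.natDegree := by rw [reverse_natDegree, htr, Nat.sub_zero]
  have hrevl : π.reverse.leadingCoeff = π.coeff 0 := by
    rw [reverse_leadingCoeff, trailingCoeff, htr]
  obtain ⟨q, hq⟩ : ∃ q : F[X], q = C (π.coeff 0)⁻¹ * π.reverse := ⟨_, rfl⟩
  have hqm : q.Monic := by
    rw [Monic, hq, leadingCoeff_mul, leadingCoeff_C, hrevl, inv_mul_cancel₀ h0]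
  have hqd : q.natDegree = π.natDegree := by
    rw [hq, natDegree_C_mul (inv_ne_zero h0), hrevd]
  have hroot : aeval x⁻¹ q = 0 := by
    letI := invertibleOfNonzero hx
    have := (eval₂_reverse_eq_zero_iff (algebraMap F K) x π).2 (by rw [← aeval_def]; exact minpoly.aeval F x)
    rw [invOf_eq_inv] at this
    rw [hq, map_mul, aeval_def _ π.reverse, this, mul_zero]
  have heq : minpoly F x⁻¹ = q := by
    symm
    apply eq_of_monic_of_dvd_of_natDegree_le (minpoly.monic hxi') hqm (minpoly.dvd F _ hroot)
    rw [hqd, hdeg]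
  rw [heq, nextCoeff_of_natDegree_pos (by rw [hqd]; exact hd), hqd, hq, coeff_C_mul, coeff_reverse,
    revAt_le (by omega)]
  have : π.natDegree - (π.natDegree - 1) = 1 := by omega
  rw [this]
  field_simp

open Polynomial in
theorem psi_trace_eq {F K : Type*} [Field F] [Fintype F] [DecidableEq F] [Field K] [Fintype K] [Algebra F K] [DecidableEq K]
    (ψ : AddChar F ℂ) (a b : F) (x : K) :
    (if x = 0 then 0 else ψ (Algebra.trace F K (algebraMap F K a * x + algebraMap F K b * x⁻¹))) =
      lamF ψ a b (minpoly F x) ^ (Module.finrank F K / (minpoly F x).natDegree) := by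
  have hxi := Algebra.IsIntegral.isIntegral (R := F) x
  have hfr : ∀ y : K, Module.finrank (IntermediateField.adjoin F {y}) K = Module.finrank F K / (minpoly F y).natDegree := by
    intro y
    have hyi := Algebra.IsIntegral.isIntegral (R := F) y
    rw [← IntermediateField.adjoin.finrank hyi, ← Module.finrank_mul_finrank F (IntermediateField.adjoin F {y}) K]
    rw [Nat.mul_div_cancel_left]
    exact Module.finrank_pos
  by_cases h : x = 0
  · subst h
    have h1 : minpoly F (0 : K) = X := minpoly.zero F K
    rw [if_pos rfl, h1]
    simp only [lamF, coeff_X_zero, if_true, natDegree_X, Nat.div_one]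
    rw [zero_pow]
    exact (Module.finrank_pos).ne'
  · rw [if_neg h]
    obtain ⟨h1, h2⟩ := trace_inv_eq (F := F) h
    have h0 : (minpoly F x).coeff 0 ≠ 0 := minpoly.coeff_zero_ne_zero hxi h
    unfold lamF
    rw [if_neg h0, ← AddChar.map_nsmul_eq_pow]
    congr 1
    rw [map_add, ← Algebra.smul_def, ← Algebra.smul_def, map_smul, map_smul,
      trace_eq_finrank_mul_minpoly_nextCoeff, trace_eq_finrank_mul_minpoly_nextCoeff, hfr, hfr, h1, h2]
    simp only [smul_eq_mul, nsmul_eq_mul]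
    ring

open Polynomial in
theorem LamF_eq_kloos {F K : Type*} [Field F] [Fintype F] [DecidableEq F] [Field K] [Fintype K] [Algebra F K] [DecidableEq K]
    (ψ : AddChar F ℂ) (a b : F) :
    ∑ x : K, (if x = 0 then 0 else ψ (Algebra.trace F K (algebraMap F K a * x + algebraMap F K b * x⁻¹))) =
      LamF ψ a b (Module.finrank F K) := by
  classical
  have hk : 0 < Module.finrank F K := Module.finrank_pos
  simp only [psi_trace_eq]
  have hmem : ∀ x : K, (minpoly F x).natDegree ∣ Module.finrank F K := fun x => minpoly.degree_dvd (Algebra.IsIntegral.isIntegral x)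
  rw [← Finset.sum_fiberwise_of_maps_to (s := Finset.univ) (t := IrrF F (Module.finrank F K)) (g := fun x : K => minpoly F x)]
  · unfold LamF
    refine Finset.sum_congr rfl fun π hπ => ?_
    rw [mem_IrrF] at hπ
    rw [Finset.sum_congr rfl (g := fun _ => lamF ψ a b π ^ (Module.finrank F K / π.natDegree))]
    · rw [Finset.sum_const, nsmul_eq_mul]
      have hroots : (Finset.univ.filter fun x : K => minpoly F x = π) = (π.map (algebraMap F K)).roots.toFinset := by
        ext x
        rw [Finset.mem_filter, Multiset.mem_toFinset, mem_roots (hπ.1.map _).ne_zero, IsRoot, eval_map_algebraMap]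
        simp only [Finset.mem_univ, true_and]
        constructor
        · rintro rfl; exact minpoly.aeval _ _
        · intro h; exact (minpoly.eq_of_irreducible_of_monic hπ.2.1 h hπ.1).symm
      split_ifs with hd
      · congr 2
        rw [hroots]
        have hdvd : π ∣ X ^ (Nat.card F) ^ (Module.finrank F K) - X :=
          (Irreducible.natDegree_dvd_iff_dvd_X_pow_card_pow_sub_X hπ.2.1).1 hd
        have hcard : Nat.card F ^ (Module.finrank F K) = Fintype.card K := by
          rw [← Module.natCard_eq_pow_finrank (K := F) (V := K), Nat.card_eq_fintype_card]
        rw [hcard] at hdvd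
        have hdvd2 : π.map (algebraMap F K) ∣ X ^ (Fintype.card K) - X := by
          have := Polynomial.map_dvd (algebraMap F K) hdvd
          simpa using this
        have hne : (X ^ (Fintype.card K) - X : K[X]) ≠ 0 := FiniteField.X_pow_card_sub_X_ne_zero K Fintype.one_lt_card
        have hsplit : (π.map (algebraMap F K)).Splits := by
          have h0 : (X ^ (Fintype.card K) - X : K[X]).Splits := by
            have := (FiniteField.isSplittingField_sub K F).splits
            simpa using this
          exact h0.of_dvd hne hdvd2
        have hnd : (π.map (algebraMap F K)).roots.Nodup := by
          refine Multiset.nodup_of_le (roots.le_of_dvd hne hdvd2) ?_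
          rw [FiniteField.roots_X_pow_card_sub_X]
          exact Finset.univ.nodup
        rw [Multiset.toFinset_card_of_nodup hnd, ← hsplit.natDegree_eq_card_roots, natDegree_map]
      · rw [Finset.card_eq_zero.2]
        · simp
        · rw [Finset.filter_eq_empty_iff]
          rintro x _ rfl
          exact hd (hmem x)
    · intro x hx
      rw [Finset.mem_filter] at hx
      rw [hx.2]
  · intro x _
    rw [mem_IrrF]
    have hx := Algebra.IsIntegral.isIntegral (R := F) x
    exact ⟨minpoly.monic hx, minpoly.irreducible hx, Nat.le_of_dvd hk (hmem x)⟩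

theorem exists_roots_quadratic (S q : ℂ) : ∃ α β : ℂ, α + β = -S ∧ α * β = q := by
  obtain ⟨z, hz⟩ := IsAlgClosed.exists_pow_nat_eq (S ^ 2 - 4 * q) (n := 2) (by norm_num)
  exact ⟨(-S + z) / 2, (-S - z) / 2, by ring, by linear_combination (-1 / 4 : ℂ) * hz⟩

theorem kloos_ext {F : Type*} [Field F] [Fintype F] [DecidableEq F] {ψ : AddChar F ℂ} (hψ : ψ ≠ 1)
    {a b : F} (ha : a ≠ 0) (hb : b ≠ 0) :
    ∃ α β : ℂ, α + β = -(∑ x : F, if x = 0 then 0 else ψ (a * x + b * x⁻¹)) ∧ α * β = Fintype.card F ∧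
      ∀ n, 0 < n → LamF ψ a b n = -(α ^ n + β ^ n) := by
  obtain ⟨α, β, h1, h2⟩ := exists_roots_quadratic (∑ x : F, if x = 0 then 0 else ψ (a * x + b * x⁻¹)) (Fintype.card F)
  refine ⟨α, β, h1, h2, ?_⟩
  have c0 := cF_zero ψ a b
  have c1 := cF_one ψ a b
  have c2 := cF_two hψ ha hb
  have c3 := cF_ge hψ b ha
  rw [← c1] at h1
  rw [← c2] at h2
  intro n
  induction n using Nat.strong_induction_on with
  | _ n ih =>
    intro hn
    have hc := conv_identity ψ a b n
    match n, hn with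
    | 1, _ =>
      simp only [Finset.Icc_self, Finset.sum_singleton, Nat.sub_self, c0] at hc
      push_cast at hc
      linear_combination -hc + h1
    | 2, _ =>
      have e1 := ih 1 (by norm_num) (by norm_num)
      rw [Finset.sum_Icc_succ_top (by norm_num)] at hc
      simp only [Finset.Icc_self, Finset.sum_singleton, Nat.sub_self, c0] at hc
      push_cast at hc
      norm_num at hc
      rw [e1, ← h2] at hc
      have h1' : cF ψ a b 1 = -(α + β) := by rw [h1]; ring
      rw [h1'] at hc
      linear_combination -hc
    | m + 3, _ =>
      have e1 := ih (m + 1) (by omega) (by omega)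
      have e2 := ih (m + 2) (by omega) (by omega)
      rw [c3, Finset.sum_Icc_succ_top (by omega), Finset.sum_Icc_succ_top (by omega), Finset.sum_Icc_succ_top (by omega)] at hc
      have hz : ∑ k ∈ Finset.Icc 1 m, LamF ψ a b k * cF ψ a b (m + 3 - k) = 0 := by
        apply Finset.sum_eq_zero
        intro k hk
        rw [Finset.mem_Icc] at hk
        have : m + 3 - k = (m - k) + 3 := by omega
        rw [this, c3, mul_zero]
      have s1 : m + 3 - (m + 1) = 2 := by omega
      have s2 : m + 3 - (m + 1 + 1) = 1 := by omega
      have s3 : m + 3 - (m + 1 + 1 + 1) = 0 := by omega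
      rw [hz, s1, s2, s3, c0, e1] at hc
      have e2' : LamF ψ a b (m + 1 + 1) = -(α ^ (m + 2) + β ^ (m + 2)) := e2
      have h1' : cF ψ a b 1 = -(α + β) := by rw [h1]; ring
      rw [e2', h1', ← h2] at hc
      linear_combination -hc

end

section

open Filter Topology in
theorem power_sum_bound {ι : Type*} [Fintype ι] (z : ι → ℂ) (C R : ℝ) (hR : 0 < R) (m0 : ℕ)
    (h : ∀ m, m0 ≤ m → ‖∑ i, z i ^ m‖ ≤ C * R ^ m) (i : ι) : ‖z i‖ ≤ R := by
  by_contra hlt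
  push Not at hlt
  have hzi : ‖z i‖ ≠ 0 := (hR.trans hlt).ne'
  have hu : ∀ j, ∃ u : Circle, z j = ‖z j‖ * (u : ℂ) := by
    intro j
    by_cases h0 : z j = 0
    · exact ⟨1, by simp [h0]⟩
    · refine ⟨⟨z j / ‖z j‖, ?_⟩, ?_⟩
      · rw [Submonoid.unitSphere, Submonoid.mem_mk]
        simp [h0]
      · have : (‖z j‖ : ℂ) ≠ 0 := by simpa using h0
        simp only
        field_simp
  choose u hu using hu
  have hs : {g : ι → Circle | ∀ j, (1 / 2 : ℝ) < ((g j : Circle) : ℂ).re} ∈ 𝓝 (1 : ι → Circle) := by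
    have : {g : ι → Circle | ∀ j, (1 / 2 : ℝ) < ((g j : Circle) : ℂ).re} =
        ⋂ j, {g : ι → Circle | (1 / 2 : ℝ) < ((g j : Circle) : ℂ).re} := by ext; simp
    rw [this]
    refine IsOpen.mem_nhds (isOpen_iInter_of_finite fun j => ?_) ?_
    · refine isOpen_lt continuous_const ?_
      exact Complex.continuous_re.comp (continuous_subtype_val.comp (continuous_apply j))
    · simp; norm_num
  have hfr := (mapClusterPt_iff_frequently.1 (mapClusterPt_one_atTop_pow u)) _ hs
  have hev : ∀ᶠ m : ℕ in atTop, 2 * C < (‖z i‖ / R) ^ m :=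
    (tendsto_pow_atTop_atTop_of_one_lt ((one_lt_div hR).2 hlt)).eventually_gt_atTop _
  obtain ⟨m, hm, hm1, hm2⟩ := (hfr.and_eventually (hev.and (eventually_ge_atTop m0))).exists
  simp only [Set.mem_setOf_eq, Pi.pow_apply] at hm
  have hre : ∀ j, ‖z j‖ ^ m / 2 ≤ (z j ^ m).re := by
    intro j
    have : z j ^ m = ((‖z j‖ ^ m : ℝ) : ℂ) * ((u j ^ m : Circle) : ℂ) := by
      conv_lhs => rw [hu j]
      rw [mul_pow]; push_cast; rfl
    rw [this, Complex.re_ofReal_mul]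
    have := hm j
    nlinarith [pow_nonneg (norm_nonneg (z j)) m]
  have h1 : ‖z i‖ ^ m / 2 ≤ C * R ^ m := by
    calc ‖z i‖ ^ m / 2 ≤ ∑ j, ‖z j‖ ^ m / 2 :=
          Finset.single_le_sum (f := fun j => ‖z j‖ ^ m / 2) (fun j _ => by positivity) (Finset.mem_univ i)
      _ ≤ ∑ j, (z j ^ m).re := Finset.sum_le_sum fun j _ => hre j
      _ = (∑ j, z j ^ m).re := by rw [Complex.re_sum]
      _ ≤ ‖∑ j, z j ^ m‖ := Complex.re_le_norm _
      _ ≤ _ := h m hm2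
  rw [div_pow, lt_div_iff₀ (pow_pos hR m)] at hm1
  linarith

theorem card_conic {K : Type*} [Field K] [Fintype K] [DecidableEq K] (hK : ringChar K ≠ 2) {a b : K} (ha : a ≠ 0)
    (hb : b ≠ 0) (t : K) :
    ((Finset.univ.filter fun x : K => x ≠ 0 ∧ a * x + b * x⁻¹ = t).card : ℤ) = 1 + quadraticChar K (t ^ 2 - 4 * a * b) := by
  rw [add_comm, ← quadraticChar_card_sqrts hK]
  have h2 : (2 : K) ≠ 0 := Ring.two_ne_zero hK
  norm_cast
  refine Finset.card_bij (fun x _ => 2 * a * x - t) ?_ ?_ ?_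
  · intro x hx
    simp only [Finset.mem_filter, Finset.mem_univ, true_and] at hx
    simp only [Set.mem_toFinset, Set.mem_setOf_eq]
    obtain ⟨h0, rfl⟩ := hx
    field_simp
    ring
  · intro x _ y _ h
    have : 2 * a * x = 2 * a * y := by linear_combination h
    exact mul_left_cancel₀ (mul_ne_zero h2 ha) this
  · intro y hy
    simp only [Set.mem_toFinset, Set.mem_setOf_eq] at hy
    have hx : a * ((y + t) / (2 * a)) ^ 2 - t * ((y + t) / (2 * a)) + b = 0 := by
      field_simp
      linear_combination hy
    refine ⟨(y + t) / (2 * a), ?_, ?_⟩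
    · simp only [Finset.mem_filter, Finset.mem_univ, true_and]
      generalize (y + t) / (2 * a) = x at *
      have h0 : x ≠ 0 := by rintro rfl; simp at hx; exact hb hx
      refine ⟨h0, ?_⟩
      field_simp
      linear_combination hx
    · field_simp
      ring

theorem card_AS {p : ℕ} [Fact p.Prime] {K : Type*} [Field K] [Fintype K] [DecidableEq K] [Algebra (ZMod p) K] (z : K) :
    (Finset.univ.filter fun y : K => y ^ p - y = z).card = if Algebra.trace (ZMod p) K z = 0 then p else 0 := by
  have hpp : p.Prime := Fact.out
  haveI : CharP K p := charP_of_injective_algebraMap (algebraMap (ZMod p) K).injective p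
  haveI : ExpChar K p := ExpChar.prime hpp
  have hfrob : ∀ x : K, Algebra.trace (ZMod p) K (x ^ p) = Algebra.trace (ZMod p) K x := by
    intro x
    have := Algebra.trace_eq_of_algEquiv (FiniteField.frobeniusAlgEquivOfAlgebraic (ZMod p) K) x
    rw [← this]
    simp [FiniteField.coe_frobeniusAlgEquivOfAlgebraic, ZMod.card]
  have hfix : ∀ c : ZMod p, (algebraMap (ZMod p) K c) ^ p = algebraMap (ZMod p) K c := by
    intro c; rw [← map_pow, ZMod.pow_card]
  let P : K →ₗ[ZMod p] K :=
    { toFun := fun y => y ^ p - y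
      map_add' := by intro x y; rw [add_pow_char]; ring
      map_smul' := by
        intro c x
        simp only [Algebra.smul_def, mul_pow, hfix, RingHom.id_apply]
        ring }
  have hPa : ∀ y, P y = y ^ p - y := fun y => rfl
  have hker : ∀ y, P y = 0 → ∃ c : ZMod p, algebraMap (ZMod p) K c = y := by
    intro y hy
    have h1 : y ^ p = y := sub_eq_zero.1 hy
    have h2 := (Subfield.mem_bot_iff_pow_eq_self K p).2 h1
    rw [← ZMod.fieldRange_castHom_eq_bot p] at h2
    obtain ⟨c, hc⟩ := h2
    exact ⟨c, by rw [← hc]; exact congrFun (congrArg _ (Subsingleton.elim _ _)) c⟩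
  have hrange : LinearMap.range P = LinearMap.ker (Algebra.trace (ZMod p) K) := by
    apply Submodule.eq_of_le_of_finrank_eq
    · rintro _ ⟨y, rfl⟩
      rw [LinearMap.mem_ker, hPa, map_sub, hfrob, sub_self]
    · have hk : LinearMap.ker P = LinearMap.range (Algebra.linearMap (ZMod p) K) := by
        ext y
        constructor
        · intro hy
          exact hker y hy
        · rintro ⟨c, rfl⟩
          rw [LinearMap.mem_ker, hPa]
          simp only [Algebra.linearMap_apply]
          rw [hfix, sub_self]
      have h1 := LinearMap.finrank_range_add_finrank_ker P
      have h2 := LinearMap.finrank_range_add_finrank_ker (Algebra.trace (ZMod p) K)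
      have h3 : Module.finrank (ZMod p) (LinearMap.ker P) = 1 := by
        rw [hk, LinearMap.finrank_range_of_inj (algebraMap (ZMod p) K).injective, Module.finrank_self]
      have h4 : Module.finrank (ZMod p) (LinearMap.range (Algebra.trace (ZMod p) K)) = 1 := by
        rw [LinearMap.range_eq_top.2 (Algebra.trace_surjective (ZMod p) K), finrank_top, Module.finrank_self]
      omega
  split_ifs with h
  · have hz : z ∈ LinearMap.range P := by rw [hrange]; exact h
    obtain ⟨y0, hy0⟩ := hz
    have : (Finset.univ.filter fun y : K => y ^ p - y = z) =
        (Finset.univ : Finset (ZMod p)).image (fun c => y0 + algebraMap (ZMod p) K c) := by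
      ext y
      simp only [Finset.mem_filter, Finset.mem_univ, true_and, Finset.mem_image]
      constructor
      · intro hy
        obtain ⟨c, hc⟩ := hker (y - y0) (by rw [map_sub, hy0, hPa, hy, sub_self])
        exact ⟨c, by rw [hc]; ring⟩
      · rintro ⟨c, rfl⟩
        rw [← hPa, map_add, hy0, hPa, hfix, sub_self, add_zero]
    rw [this, Finset.card_image_of_injective]
    · simp [ZMod.card]
    · intro c c' hc
      exact (algebraMap (ZMod p) K).injective (add_left_cancel hc)
  · rw [Finset.card_eq_zero, Finset.filter_eq_empty_iff]
    rintro y _ rfl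
    apply h
    rw [map_sub, hfrob, sub_self]

theorem card_trace_zero {p : ℕ} [Fact p.Prime] {K : Type*} [Field K] [Fintype K] [DecidableEq K]
    [Algebra (ZMod p) K] (hp2 : p ≠ 2) {a b : K} (ha : a ≠ 0) (hb : b ≠ 0) :
    (p : ℤ) * (Finset.univ.filter fun x : K => x ≠ 0 ∧ Algebra.trace (ZMod p) K (a * x + b * x⁻¹) = 0).card =
      Fintype.card K + ∑ y : K, quadraticChar K ((y ^ p - y) ^ 2 - 4 * a * b) := by
  haveI : CharP K p := charP_of_injective_algebraMap (algebraMap (ZMod p) K).injective p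
  have hK : ringChar K ≠ 2 := by rw [ringChar.eq K p]; exact hp2
  have h1 : ∑ y : K, (1 + quadraticChar K ((y ^ p - y) ^ 2 - 4 * a * b)) =
      Fintype.card K + ∑ y : K, quadraticChar K ((y ^ p - y) ^ 2 - 4 * a * b) := by
    rw [Finset.sum_add_distrib]; simp
  rw [← h1]
  simp_rw [← card_conic hK ha hb]
  have h2 : ∀ t : K, ((Finset.univ.filter fun x : K => x ≠ 0 ∧ a * x + b * x⁻¹ = t).card : ℤ) =
      ∑ x : K, if x ≠ 0 ∧ a * x + b * x⁻¹ = t then 1 else 0 := by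
    intro t; rw [Finset.sum_boole]
  simp_rw [h2]
  rw [Finset.sum_comm]
  have h3 : ∀ x : K, (∑ y : K, if x ≠ 0 ∧ a * x + b * x⁻¹ = y ^ p - y then (1 : ℤ) else 0) =
      if x ≠ 0 ∧ Algebra.trace (ZMod p) K (a * x + b * x⁻¹) = 0 then (p : ℤ) else 0 := by
    intro x
    by_cases hx : x = 0
    · simp [hx]
    · have := card_AS (p := p) (a * x + b * x⁻¹)
      simp only [ne_eq, hx, not_false_eq_true, true_and]
      rw [Finset.sum_boole]
      simp_rw [eq_comm (a := a * x + b * x⁻¹)]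
      rw [this]
      push_cast
      rfl
  simp_rw [h3]
  rw [Finset.sum_ite, Finset.sum_const_zero, add_zero, Finset.sum_const, nsmul_eq_mul, mul_comm]

theorem kloos_avg {p : ℕ} [Fact p.Prime] {K : Type*} [Field K] [Fintype K] [DecidableEq K]
    [Algebra (ZMod p) K] (hp2 : p ≠ 2) {μ : ℕ} (hμ : 3 ≤ μ) (hcard : Fintype.card K = (p ^ μ) ^ 2)
    {ψ : AddChar (ZMod p) ℂ} (hψ : ψ ≠ 1) {a b : ZMod p} (ha : a ≠ 0) (hb : b ≠ 0) :
    ‖∑ u : (ZMod p)ˣ, LamF ψ (u * a) (u * b) (Module.finrank (ZMod p) K)‖ ≤ (1 + 13 * p : ℝ) * (p : ℝ) ^ μ := by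
  haveI : CharP K p := charP_of_injective_algebraMap (algebraMap (ZMod p) K).injective p
  have hpp : p.Prime := Fact.out
  set a' := algebraMap (ZMod p) K a with ha'
  set b' := algebraMap (ZMod p) K b with hb'
  have ha0 : a' ≠ 0 := by simpa [ha'] using ha
  have hb0 : b' ≠ 0 := by simpa [hb'] using hb
  have h1 : ∑ u : (ZMod p)ˣ, LamF ψ (u * a) (u * b) (Module.finrank (ZMod p) K) =
      ((p : ℤ) * (Finset.univ.filter fun x : K => x ≠ 0 ∧ Algebra.trace (ZMod p) K (a' * x + b' * x⁻¹) = 0).card -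
       (Fintype.card K - 1) : ℤ) := by
    simp_rw [← LamF_eq_kloos (K := K)]
    rw [Finset.sum_comm]
    have h2 : ∀ x : K, (∑ u : (ZMod p)ˣ, if x = 0 then 0 else ψ (Algebra.trace (ZMod p) K
        (algebraMap (ZMod p) K (u * a) * x + algebraMap (ZMod p) K (u * b) * x⁻¹))) =
        (if x ≠ 0 ∧ Algebra.trace (ZMod p) K (a' * x + b' * x⁻¹) = 0 then (p : ℂ) else 0) -
        (if x = 0 then 0 else 1) := by
      intro x
      by_cases hx : x = 0
      · simp [hx]
      · simp only [hx, if_false, ne_eq, not_false_eq_true, true_and]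
        have h3 : ∀ u : ZMod p, Algebra.trace (ZMod p) K
            (algebraMap (ZMod p) K (u * a) * x + algebraMap (ZMod p) K (u * b) * x⁻¹) =
            Algebra.trace (ZMod p) K (a' * x + b' * x⁻¹) * u := by
          intro u
          rw [map_mul, map_mul, mul_assoc, mul_assoc, ← mul_add, ← Algebra.smul_def, map_smul, smul_eq_mul, mul_comm]
        simp_rw [h3]
        have h4 := sum_psi_mul hψ (Algebra.trace (ZMod p) K (a' * x + b' * x⁻¹))
        rw [ZMod.card] at h4
        rw [← h4, eq_sub_iff_add_eq]
        rw [← Finset.sum_erase_add _ _ (Finset.mem_univ (0 : ZMod p))]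
        congr 1
        · refine Finset.sum_bij (fun u _ => (u : ZMod p)) ?_ ?_ ?_ ?_
          · intro u _; simp
          · intro u _ v _ h; exact Units.ext h
          · intro v hv
            simp only [Finset.mem_erase, Finset.mem_univ, and_true] at hv
            exact ⟨Units.mk0 v hv, Finset.mem_univ _, rfl⟩
          · intros; rfl
        · simp
    simp_rw [h2]
    rw [Finset.sum_sub_distrib, Finset.sum_ite, Finset.sum_const_zero, add_zero, Finset.sum_const, nsmul_eq_mul]
    have h5 : (∑ x : K, if x = 0 then (0 : ℂ) else 1) = Fintype.card K - 1 := by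
      have : ∀ x : K, (if x = 0 then (0 : ℂ) else 1) = 1 - if x = 0 then 1 else 0 := by
        intro x; split_ifs <;> simp
      simp_rw [this]
      rw [Finset.sum_sub_distrib]; simp
    rw [h5]
    push_cast
    ring
  rw [h1, card_trace_zero hp2 ha0 hb0]
  have he : 4 * a' * b' ≠ 0 := by
    have h2 : (2 : K) ≠ 0 := Ring.two_ne_zero (by rw [ringChar.eq K p]; exact hp2)
    have : (4 : K) = 2 * 2 := by norm_num
    rw [this]
    exact mul_ne_zero (mul_ne_zero (mul_ne_zero h2 h2) ha0) hb0
  have h6 := stepanov_bound hp2 hμ hcard (4 * a' * b') he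
  rw [Complex.norm_intCast]
  have h7 : |(Fintype.card K + ∑ y : K, quadraticChar K ((y ^ p - y) ^ 2 - 4 * a' * b') - (Fintype.card K - 1) : ℤ)|
      ≤ (1 + 13 * p) * p ^ μ := by
    have : (1 : ℤ) ≤ p ^ μ := one_le_pow₀ (by exact_mod_cast hpp.one_lt.le)
    rw [abs_le] at h6 ⊢
    constructor <;> linarith [h6.1, h6.2]
  exact_mod_cast h7

theorem weil_prime {p : ℕ} [Fact p.Prime] (hp2 : p ≠ 2) {ψ : AddChar (ZMod p) ℂ} (hψ : ψ ≠ 1) {a b : ZMod p}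
    (ha : a ≠ 0) (hb : b ≠ 0) :
    ‖∑ x : ZMod p, if x = 0 then 0 else ψ (a * x + b * x⁻¹)‖ ≤ 2 * √(p : ℝ) := by
  classical
  have hpp : p.Prime := Fact.out
  have hp0 : (0 : ℝ) < p := by exact_mod_cast hpp.pos
  have hex : ∀ u : (ZMod p)ˣ, _ := fun u => kloos_ext (F := ZMod p) hψ (mul_ne_zero u.ne_zero ha) (mul_ne_zero u.ne_zero hb)
  choose α β h1 h2 h3 using hex
  let z : (ZMod p)ˣ × Bool → ℂ := fun i => if i.2 then (α i.1) ^ 2 else (β i.1) ^ 2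
  have hz := power_sum_bound z (1 + 13 * p) p hp0 3 (by
    intro m hm
    have hm0 : m ≠ 0 := by omega
    haveI : Fintype (GaloisField p (2 * m)) := Fintype.ofFinite _
    have hcard : Fintype.card (GaloisField p (2 * m)) = (p ^ m) ^ 2 := by
      rw [Fintype.card_eq_nat_card, GaloisField.card p (2 * m) (by omega), ← pow_mul, mul_comm]
    have := kloos_avg (K := GaloisField p (2 * m)) hp2 hm hcard hψ ha hb
    rw [GaloisField.finrank p (by omega)] at this
    rw [Fintype.sum_prod_type]
    simp only [z, Fintype.sum_bool, if_true]
    have hsum : ∑ u : (ZMod p)ˣ, LamF ψ (u * a) (u * b) (2 * m) =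
        -∑ u : (ZMod p)ˣ, ((α u ^ 2) ^ m + (if false = true then α u ^ 2 else β u ^ 2) ^ m) := by
      rw [← Finset.sum_neg_distrib]
      refine Finset.sum_congr rfl fun u _ => ?_
      rw [if_neg (by simp), h3 u _ (by omega), pow_mul, pow_mul]
    rw [hsum, norm_neg] at this
    exact this)
  have hα : ‖α 1‖ ≤ √(p : ℝ) := by
    apply Real.le_sqrt_of_sq_le
    have := hz (1, true)
    simpa [z] using this
  have hβ : ‖β 1‖ ≤ √(p : ℝ) := by
    apply Real.le_sqrt_of_sq_le
    have := hz (1, false)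
    simpa [z] using this
  have h4 := h1 1
  simp only [Units.val_one, one_mul] at h4
  rw [← norm_neg, ← h4]
  calc _ ≤ _ := norm_add_le _ _
    _ ≤ _ := by linarith

end

section

/-- Kloosterman sum over a finite commutative ring. -/
def KS {R : Type*} [CommRing R] [Fintype Rˣ] (ψ : AddChar R ℂ) (c : Rˣ) (m n : R) : ℂ :=
  ∑ x : Rˣ, ψ (m * x + n * (c * x⁻¹ : Rˣ))

theorem norm_KS_le {R : Type*} [CommRing R] [Finite R] [Fintype Rˣ] (ψ : AddChar R ℂ) (c : Rˣ) (m n : R) :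
    ‖KS ψ c m n‖ ≤ Fintype.card Rˣ := by
  refine (norm_sum_le _ _).trans ?_
  simp [AddChar.norm_apply]

theorem KS_prod {R S : Type*} [CommRing R] [CommRing S] [Fintype Rˣ] [Fintype Sˣ] [Fintype (R × S)ˣ]
    (ψ : AddChar (R × S) ℂ) (c : (R × S)ˣ) (m n : R × S) :
    KS ψ c m n = KS (ψ.compAddMonoidHom (AddMonoidHom.inl R S)) (MulEquiv.prodUnits c).1 m.1 n.1 *
      KS (ψ.compAddMonoidHom (AddMonoidHom.inr R S)) (MulEquiv.prodUnits c).2 m.2 n.2 := by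
  unfold KS
  rw [Finset.sum_mul_sum, ← Finset.sum_product']
  refine Fintype.sum_equiv (MulEquiv.prodUnits.toEquiv) _ _ fun x => ?_
  rw [AddChar.compAddMonoidHom_apply, AddChar.compAddMonoidHom_apply, ← AddChar.map_add_eq_mul]
  congr 1
  ext <;> simp [MulEquiv.prodUnits]

theorem KS_equiv {R S : Type*} [CommRing R] [CommRing S] [Fintype Rˣ] [Fintype Sˣ]
    (f : S ≃+* R) (ψ : AddChar R ℂ) (c : Rˣ) (m n : R) :
    KS ψ c m n = KS (ψ.compAddMonoidHom (f : S →+ R)) (Units.mapEquiv f.symm.toMulEquiv c) (f.symm m) (f.symm n) := by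
  unfold KS
  refine Fintype.sum_equiv (Units.mapEquiv f.symm.toMulEquiv).toEquiv _ _ fun x => ?_
  rw [AddChar.compAddMonoidHom_apply]
  congr 1
  have h1 : ((Units.mapEquiv f.symm.toMulEquiv c * ((Units.mapEquiv f.symm.toMulEquiv).toEquiv x)⁻¹ : Sˣ) : S) =
      f.symm (c * x⁻¹ : Rˣ) := by
    have : (Units.mapEquiv f.symm.toMulEquiv).toEquiv x = Units.mapEquiv f.symm.toMulEquiv x := rfl
    rw [this, ← map_inv, ← map_mul]; rfl
  have h2 : ((Units.mapEquiv f.symm.toMulEquiv).toEquiv x : S) = f.symm x := rfl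
  rw [h2, h1, ← map_mul, ← map_mul, ← map_add]
  exact (RingEquiv.apply_symm_apply f _).symm

theorem prim_inl {R S : Type*} [CommRing R] [CommRing S] {ψ : AddChar (R × S) ℂ} (h : ψ.IsPrimitive) :
    (ψ.compAddMonoidHom (AddMonoidHom.inl R S)).IsPrimitive := by
  intro a ha hc
  apply h (a := (a, 0)) (by simpa using ha)
  ext x
  have := DFunLike.congr_fun hc x.1
  simp only [AddChar.mulShift_apply, AddChar.compAddMonoidHom_apply, AddChar.one_apply, AddMonoidHom.inl_apply] at this ⊢
  rw [← this]
  congr 1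
  ext <;> simp

theorem prim_inr {R S : Type*} [CommRing R] [CommRing S] {ψ : AddChar (R × S) ℂ} (h : ψ.IsPrimitive) :
    (ψ.compAddMonoidHom (AddMonoidHom.inr R S)).IsPrimitive := by
  intro a ha hc
  apply h (a := (0, a)) (by simpa using ha)
  ext x
  have := DFunLike.congr_fun hc x.2
  simp only [AddChar.mulShift_apply, AddChar.compAddMonoidHom_apply, AddChar.one_apply, AddMonoidHom.inr_apply] at this ⊢
  rw [← this]
  congr 1
  ext <;> simp

theorem prim_equiv {R S : Type*} [CommRing R] [CommRing S] (f : S ≃+* R) {ψ : AddChar R ℂ} (h : ψ.IsPrimitive) :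
    (ψ.compAddMonoidHom (f : S →+ R)).IsPrimitive := by
  intro a ha hc
  apply h (a := f a) (by simpa using ha)
  ext x
  have := DFunLike.congr_fun hc (f.symm x)
  simpa [AddChar.mulShift_apply, AddChar.compAddMonoidHom_apply] using this

theorem KS_prime {p : ℕ} [Fact p.Prime] {ψ : AddChar (ZMod p) ℂ} (hψ : ψ.IsPrimitive) (c : (ZMod p)ˣ) (m n : ℕ) :
    ‖KS ψ c (m : ZMod p) (n : ZMod p)‖ ≤ 2 * √((p : ℝ) * ((m.gcd n).gcd p : ℕ)) := by
  have hpp : p.Prime := Fact.out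
  have hp1 : (1 : ℝ) ≤ p := by exact_mod_cast hpp.one_lt.le
  have hψ1 : ψ ≠ 1 := by
    have := hψ (a := 1) one_ne_zero
    rwa [AddChar.mulShift_one] at this
  have hgpos : 0 < (m.gcd n).gcd p := Nat.gcd_pos_of_pos_right _ hpp.pos
  have hg1 : (1 : ℝ) ≤ ((m.gcd n).gcd p : ℕ) := by exact_mod_cast hgpos
  have h1 : (1 : ℝ) ≤ √((p : ℝ) * ((m.gcd n).gcd p : ℕ)) := by
    rw [Real.one_le_sqrt]; nlinarith
  have htriv : ‖KS ψ c (m : ZMod p) (n : ZMod p)‖ ≤ p - 1 := by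
    refine (norm_KS_le _ _ _ _).trans ?_
    rw [ZMod.card_units_eq_totient, Nat.totient_prime hpp, Nat.cast_sub hpp.one_lt.le]
    simp
  by_cases hp2 : p = 2
  · have : (p : ℝ) = 2 := by exact_mod_cast hp2
    linarith
  have hone : ∀ v : ZMod p, v ≠ 0 → ‖∑ x : (ZMod p)ˣ, ψ (v * x)‖ ≤ 1 := by
    intro v hv
    have h := sum_psi_mul hψ1 v
    rw [if_neg hv, ← Finset.sum_erase_add _ _ (Finset.mem_univ (0 : ZMod p))] at h
    have h2 : ∑ x : (ZMod p)ˣ, ψ (v * x) = ∑ x ∈ Finset.univ.erase (0 : ZMod p), ψ (v * x) := by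
      refine Finset.sum_bij (fun u _ => (u : ZMod p)) ?_ ?_ ?_ ?_
      · intro u _; simp
      · intro u _ v _ h; exact Units.ext h
      · intro v hv
        simp only [Finset.mem_erase, Finset.mem_univ, and_true] at hv
        exact ⟨Units.mk0 v hv, Finset.mem_univ _, rfl⟩
      · intros; rfl
    rw [h2, eq_neg_of_add_eq_zero_left h]
    simp
  by_cases hm : (m : ZMod p) = 0 <;> by_cases hn : (n : ZMod p) = 0
  · rw [ZMod.natCast_eq_zero_iff] at hm hn
    have : (m.gcd n).gcd p = p := Nat.gcd_eq_right (Nat.dvd_gcd hm hn)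
    rw [this, Real.sqrt_mul_self (by linarith)]
    linarith
  · have : KS ψ c (m : ZMod p) (n : ZMod p) = ∑ x : (ZMod p)ˣ, ψ ((n * c) * x) := by
      unfold KS
      refine Fintype.sum_equiv (Equiv.inv _) _ _ fun x => ?_
      rw [hm, zero_mul, zero_add, Units.val_mul, Equiv.inv_apply, mul_assoc]
    rw [this]
    linarith [hone (n * c) (mul_ne_zero hn c.ne_zero)]
  · have : KS ψ c (m : ZMod p) (n : ZMod p) = ∑ x : (ZMod p)ˣ, ψ (m * x) := by
      unfold KS
      refine Finset.sum_congr rfl fun x _ => ?_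
      rw [hn, zero_mul, add_zero]
    rw [this]
    linarith [hone m hm]
  · have hw := weil_prime hp2 hψ1 hm (mul_ne_zero hn c.ne_zero)
    have : KS ψ c (m : ZMod p) (n : ZMod p) = ∑ x : ZMod p, if x = 0 then 0 else ψ (m * x + (n * c) * x⁻¹) := by
      unfold KS
      rw [← Finset.sum_erase_add _ _ (Finset.mem_univ (0 : ZMod p)), if_pos rfl, add_zero]
      refine Finset.sum_bij (fun u _ => (u : ZMod p)) ?_ ?_ ?_ ?_
      · intro u _; simp
      · intro u _ v _ h; exact Units.ext h
      · intro v hv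
        simp only [Finset.mem_erase, Finset.mem_univ, and_true] at hv
        exact ⟨Units.mk0 v hv, Finset.mem_univ _, rfl⟩
      · intro u _
        rw [if_neg u.ne_zero]
        rw [Units.val_mul, Units.val_inv_eq_inv_val, mul_assoc]
    rw [this]
    refine hw.trans ?_
    gcongr
    nlinarith

/-- The general Kloosterman bound, with a square-full defect. -/
theorem KS_bound (q : ℕ) (hq : 0 < q) : ∃ s t : ℕ, 0 < s ∧ 0 < t ∧ s ^ 2 * t ^ 3 ∣ q ∧
    ∀ [NeZero q] (ψ : AddChar (ZMod q) ℂ), ψ.IsPrimitive → ∀ (c : (ZMod q)ˣ) (m n : ℕ),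
      ‖KS ψ c (m : ZMod q) (n : ZMod q)‖ ≤
        q.divisors.card * √((q : ℝ) * ((s ^ 2 * t ^ 3 : ℕ) : ℝ) * (((m.gcd n).gcd q : ℕ) : ℝ)) := by
  induction q using Nat.recOnPosPrimePosCoprime with
  | prime_pow p k hp hk =>
    haveI : Fact p.Prime := ⟨hp⟩
    rcases Nat.lt_or_ge 1 k with hk1 | hk1
    · have hst : ∃ s t : ℕ, 0 < s ∧ 0 < t ∧ s ^ 2 * t ^ 3 = p ^ k := by
        rcases Nat.even_or_odd' k with ⟨j, rfl | rfl⟩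
        · exact ⟨p ^ j, 1, pow_pos hp.pos _, one_pos, by rw [← pow_mul]; simp [mul_comm]⟩
        · refine ⟨p ^ (j - 1), p, pow_pos hp.pos _, hp.pos, ?_⟩
          rw [← pow_mul, ← pow_add]
          congr 1; omega
      obtain ⟨s, t, hs, ht, hst⟩ := hst
      refine ⟨s, t, hs, ht, hst ▸ dvd_rfl, ?_⟩
      intro _ ψ hψ c m n
      rw [hst]
      have hgpos : 0 < (m.gcd n).gcd (p ^ k) := Nat.gcd_pos_of_pos_right _ hq
      have hg1 : (1 : ℝ) ≤ ((m.gcd n).gcd (p ^ k) : ℕ) := by exact_mod_cast hgpos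
      have hd : (1 : ℝ) ≤ (p ^ k).divisors.card := by
        exact_mod_cast Finset.card_pos.2 ⟨1, by simp [hp.ne_zero]⟩
      refine (norm_KS_le _ _ _ _).trans ?_
      rw [ZMod.card_units_eq_totient]
      have h1 : ((p ^ k).totient : ℝ) ≤ (p ^ k : ℕ) := by exact_mod_cast Nat.totient_le _
      have h2 : ((p ^ k : ℕ) : ℝ) ≤ √(((p ^ k : ℕ) : ℝ) * ((p ^ k : ℕ) : ℝ) * ((m.gcd n).gcd (p ^ k) : ℕ)) := by
        apply Real.le_sqrt_of_sq_le
        nlinarith [sq_nonneg ((p ^ k : ℕ) : ℝ)]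
      nlinarith [Real.sqrt_nonneg (((p ^ k : ℕ) : ℝ) * ((p ^ k : ℕ) : ℝ) * ((m.gcd n).gcd (p ^ k) : ℕ))]
    · have hk' : k = 1 := by omega
      subst hk'
      refine ⟨1, 1, one_pos, one_pos, by simp, ?_⟩
      rw [pow_one]
      intro _ ψ hψ c m n
      have := KS_prime hψ c m n
      rw [Nat.Prime.divisors hp, Finset.card_pair hp.one_lt.ne]
      simpa using this
  | zero => omega
  | one =>
    refine ⟨1, 1, one_pos, one_pos, by simp, ?_⟩
    intro _ ψ hψ c m n
    refine (norm_KS_le _ _ _ _).trans ?_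
    simp
  | coprime a b ha hb hab iha ihb =>
    obtain ⟨s, t, hs, ht, hst, hA⟩ := iha (by omega)
    obtain ⟨s', t', hs', ht', hst', hB⟩ := ihb (by omega)
    refine ⟨s * s', t * t', by positivity, by positivity, ?_, ?_⟩
    · have := mul_dvd_mul hst hst'
      rwa [mul_pow, mul_pow, mul_mul_mul_comm]
    intro _ ψ hψ c m n
    haveI : NeZero a := ⟨by omega⟩
    haveI : NeZero b := ⟨by omega⟩
    let f := (ZMod.chineseRemainder hab).symm
    rw [KS_equiv f, KS_prod, norm_mul]
    have hA' := hA _ (prim_inl (prim_equiv f hψ)) (MulEquiv.prodUnits (Units.mapEquiv f.symm.toMulEquiv c)).1 m n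
    have hB' := hB _ (prim_inr (prim_equiv f hψ)) (MulEquiv.prodUnits (Units.mapEquiv f.symm.toMulEquiv c)).2 m n
    have hm : f.symm (m : ZMod (a * b)) = ((m : ZMod a), (m : ZMod b)) := by
      rw [map_natCast]; rfl
    have hn : f.symm (n : ZMod (a * b)) = ((n : ZMod a), (n : ZMod b)) := by
      rw [map_natCast]; rfl
    rw [hm, hn]
    refine (mul_le_mul hA' hB' (norm_nonneg _) (by positivity)).trans (le_of_eq ?_)
    rw [Nat.Coprime.card_divisors_mul hab, Nat.Coprime.gcd_mul _ hab]
    rw [mul_mul_mul_comm, ← Real.sqrt_mul (by positivity)]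
    push_cast
    congr 2
    ring

end

section

theorem tau_bound (ε : ℝ) (hε : 0 < ε) : ∃ C : ℝ, 1 ≤ C ∧ ∀ n : ℕ, 0 < n → (n.divisors.card : ℝ) ≤ C * (n : ℝ) ^ ε := by
  have hl2 : 0 < Real.log 2 := Real.log_pos (by norm_num)
  set C1 : ℝ := 1 + 1 / (ε * Real.log 2) with hC1
  have hC11 : 1 ≤ C1 := by rw [hC1]; have : 0 < 1 / (ε * Real.log 2) := by positivity
                           linarith
  set P : ℕ := ⌈(2 : ℝ) ^ (1 / ε)⌉₊ with hP
  have hsmall : ∀ p k : ℕ, p.Prime → ((k : ℝ) + 1) ≤ C1 * ((p ^ k : ℕ) : ℝ) ^ ε := by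
    intro p k hp
    have h2p : (2 : ℝ) ≤ p := by exact_mod_cast hp.two_le
    have h1 : 1 + k * (ε * Real.log 2) ≤ ((p ^ k : ℕ) : ℝ) ^ ε := by
      have hh : Real.exp (k * (ε * Real.log 2)) ≤ ((p ^ k : ℕ) : ℝ) ^ ε := by
        rw [Real.rpow_def_of_pos (by have := hp.pos; positivity)]
        apply Real.exp_le_exp.2
        push_cast
        rw [Real.log_pow]
        have : Real.log 2 ≤ Real.log p := Real.log_le_log (by norm_num) h2p
        have : k * (ε * Real.log 2) ≤ k * (ε * Real.log p) := by gcongr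
        linarith
      have := Real.add_one_le_exp (k * (ε * Real.log 2))
      linarith
    have h3 : (k : ℝ) + 1 ≤ C1 * (1 + k * (ε * Real.log 2)) := by
      have : C1 * (1 + k * (ε * Real.log 2)) = 1 + k * (ε * Real.log 2) + 1 / (ε * Real.log 2) + k := by
        rw [hC1]; field_simp; ring
      rw [this]
      have : 0 < 1 / (ε * Real.log 2) := by positivity
      have : 0 ≤ k * (ε * Real.log 2) := by positivity
      linarith
    exact h3.trans (by gcongr)
  have hlarge : ∀ p k : ℕ, p.Prime → P ≤ p → ((k : ℝ) + 1) ≤ ((p ^ k : ℕ) : ℝ) ^ ε := by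
    intro p k hp hPp
    have h1 : (2 : ℝ) ^ (1 / ε) ≤ p := (Nat.le_ceil _).trans (by exact_mod_cast hPp)
    have h2 : (2 : ℝ) ≤ (p : ℝ) ^ ε := by
      calc (2 : ℝ) = ((2 : ℝ) ^ (1 / ε)) ^ ε := by
            rw [← Real.rpow_mul (by norm_num), one_div, inv_mul_cancel₀ hε.ne', Real.rpow_one]
        _ ≤ _ := by gcongr
    push_cast
    rw [← Real.rpow_natCast, ← Real.rpow_mul (by positivity), mul_comm, Real.rpow_mul (by positivity), Real.rpow_natCast]
    calc ((k : ℝ) + 1) ≤ 2 ^ k := by exact_mod_cast Nat.lt_two_pow_self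
      _ ≤ _ := by gcongr
  have key : ∀ n : ℕ, 0 < n → (n.divisors.card : ℝ) ≤ C1 ^ (n.primeFactors.filter (· < P)).card * (n : ℝ) ^ ε := by
    intro n hn
    induction n using Nat.recOnPosPrimePosCoprime with
    | prime_pow p k hp hk =>
      rw [Nat.divisors_prime_pow hp, Finset.card_map, Finset.card_range, Nat.primeFactors_prime_pow hk.ne' hp]
      by_cases hPp : p < P
      · rw [Finset.filter_true_of_mem (by simpa using hPp), Finset.card_singleton, pow_one]
        exact_mod_cast hsmall p k hp
      · rw [Finset.filter_false_of_mem (by simpa using hPp), Finset.card_empty, pow_zero, one_mul]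
        exact_mod_cast hlarge p k hp (not_lt.1 hPp)
    | zero => omega
    | one => simp
    | coprime a b ha hb hab iha ihb =>
      rw [Nat.Coprime.card_divisors_mul hab, hab.primeFactors_mul, Finset.filter_union,
        Finset.card_union_of_disjoint (Finset.disjoint_filter_filter hab.disjoint_primeFactors)]
      push_cast
      rw [Real.mul_rpow (by positivity) (by positivity), pow_add]
      calc _ ≤ _ := mul_le_mul (iha (by omega)) (ihb (by omega)) (by positivity) (by positivity)
        _ = _ := by ring
  refine ⟨C1 ^ P, one_le_pow₀ hC11, fun n hn => (key n hn).trans ?_⟩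
  gcongr
  calc _ ≤ (Finset.range P).card := Finset.card_le_card (fun x hx => by
        simp only [Finset.mem_filter] at hx; exact Finset.mem_range.2 hx.2)
    _ = P := Finset.card_range P

theorem sum_inv_sqrt (n : ℕ) : ∑ r ∈ Finset.Icc 1 n, 1 / √(r : ℝ) ≤ 2 * √(n : ℝ) := by
  induction n with
  | zero => simp
  | succ n ih =>
    rw [Finset.sum_Icc_succ_top (by omega)]
    have h1 : 1 / √((n + 1 : ℕ) : ℝ) ≤ 2 * (√((n + 1 : ℕ) : ℝ) - √(n : ℝ)) := by
      have hp : 0 < √((n + 1 : ℕ) : ℝ) := Real.sqrt_pos.2 (by positivity)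
      have h2 := Real.sq_sqrt (show (0 : ℝ) ≤ ((n + 1 : ℕ) : ℝ) by positivity)
      have h3 := Real.sq_sqrt (show (0 : ℝ) ≤ (n : ℝ) by positivity)
      rw [div_le_iff₀ hp]
      push_cast at *
      nlinarith [sq_nonneg (√((n : ℝ) + 1) - √(n : ℝ))]
    linarith

theorem sum_inv (n : ℕ) : ∑ r ∈ Finset.Icc 1 n, 1 / (r : ℝ) ≤ 1 + Real.log n := by
  have := harmonic_le_one_add_log n
  rw [harmonic_eq_sum_Icc] at this
  push_cast at this
  simpa using this

theorem sum_sqf (Q : ℕ) (s t : ℕ → ℕ) (hs : ∀ q, 0 < q → 0 < s q) (ht : ∀ q, 0 < q → 0 < t q)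
    (hd : ∀ q, 0 < q → s q ^ 2 * t q ^ 3 ∣ q) :
    ∑ q ∈ Finset.Icc 1 Q, √((s q ^ 2 * t q ^ 3 : ℕ) : ℝ) / √(q : ℝ) ≤ 2 * √(Q : ℝ) * (1 + Real.log Q) ^ 2 := by
  let T := Finset.Icc 1 Q
  let U : Finset (ℕ × ℕ × ℕ) := (T ×ˢ T ×ˢ T).filter fun x => x.1 ^ 2 * x.2.1 ^ 3 * x.2.2 ≤ Q
  let f : ℕ → ℕ × ℕ × ℕ := fun q => (s q, t q, q / (s q ^ 2 * t q ^ 3))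
  have hf : ∀ q, 0 < q → s q ^ 2 * t q ^ 3 * (q / (s q ^ 2 * t q ^ 3)) = q := fun q hq => Nat.mul_div_cancel' (hd q hq)
  have hfU : ∀ q ∈ T, f q ∈ U := by
    intro q hq
    simp only [T, Finset.mem_Icc] at hq
    have hw := hd q hq.1
    have hq0 : 0 < q := hq.1
    have hs0 := hs q hq0
    have ht0 := ht q hq0
    have hwle := Nat.le_of_dvd hq0 hw
    have h1 : s q ≤ q := Nat.le_of_dvd hq0 ((dvd_pow_self _ (by norm_num)).trans ((Dvd.intro _ rfl).trans hw))
    have h2 : t q ≤ q := Nat.le_of_dvd hq0 ((dvd_pow_self _ (by norm_num)).trans ((Dvd.intro_left _ rfl).trans hw))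
    simp only [U, T, f, Finset.mem_filter, Finset.mem_product, Finset.mem_Icc]
    rw [hf q hq0]
    refine ⟨⟨⟨hs0, h1.trans hq.2⟩, ⟨ht0, h2.trans hq.2⟩, Nat.div_pos hwle (by positivity), (Nat.div_le_self _ _).trans hq.2⟩, hq.2⟩
  have h1 : ∑ q ∈ T, √((s q ^ 2 * t q ^ 3 : ℕ) : ℝ) / √(q : ℝ) ≤ ∑ x ∈ U, 1 / √(x.2.2 : ℝ) := by
    calc _ = ∑ q ∈ T, 1 / √((f q).2.2 : ℝ) := by
          refine Finset.sum_congr rfl fun q hq => ?_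
          have hq0 : 0 < q := (Finset.mem_Icc.1 hq).1
          have hs0 := hs q hq0
          have ht0 := ht q hq0
          conv_lhs => rw [← hf q hq0]
          simp only [f]
          conv_lhs => rw [Nat.cast_mul (s q ^ 2 * t q ^ 3) (_ / _), Real.sqrt_mul (by positivity)]
          rw [hf q hq0]
          have : √((s q ^ 2 * t q ^ 3 : ℕ) : ℝ) ≠ 0 := (Real.sqrt_pos.2 (by positivity)).ne'
          field_simp
      _ = ∑ x ∈ T.image f, 1 / √(x.2.2 : ℝ) := by
          rw [Finset.sum_image]
          intro q hq q' hq' h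
          have h1 := hf q (Finset.mem_Icc.1 hq).1
          have h2 := hf q' (Finset.mem_Icc.1 hq').1
          simp only [f, Prod.mk.injEq] at h
          rw [← h1, ← h2, h.1, h.2.1] 
          rw [h.1, h.2.1] at h
          rw [h.2.2]
      _ ≤ _ := by
          refine Finset.sum_le_sum_of_subset_of_nonneg ?_ fun _ _ _ => by positivity
          intro x hx
          obtain ⟨q, hq, rfl⟩ := Finset.mem_image.1 hx
          exact hfU q hq
  refine h1.trans ?_
  have h2 : ∑ x ∈ U, 1 / √(x.2.2 : ℝ) ≤ ∑ a ∈ T, ∑ b ∈ T, 2 * √(Q : ℝ) * (1 / (a : ℝ)) * (1 / (b : ℝ)) := by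
    rw [Finset.sum_filter, Finset.sum_product]
    refine Finset.sum_le_sum fun a ha => ?_
    rw [Finset.sum_product]
    refine Finset.sum_le_sum fun b hb => ?_
    have ha0 : 0 < a := (Finset.mem_Icc.1 ha).1
    have hb0 : 0 < b := (Finset.mem_Icc.1 hb).1
    rw [← Finset.sum_filter]
    have hsub : (T.filter fun r => a ^ 2 * b ^ 3 * r ≤ Q) ⊆ Finset.Icc 1 (Q / (a ^ 2 * b ^ 3)) := by
      intro r hr
      simp only [T, Finset.mem_filter, Finset.mem_Icc] at hr ⊢
      exact ⟨hr.1.1, (Nat.le_div_iff_mul_le (by positivity)).2 (by linarith)⟩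
    calc _ ≤ ∑ r ∈ Finset.Icc 1 (Q / (a ^ 2 * b ^ 3)), 1 / √(r : ℝ) :=
          Finset.sum_le_sum_of_subset_of_nonneg hsub fun _ _ _ => by positivity
      _ ≤ 2 * √((Q / (a ^ 2 * b ^ 3) : ℕ) : ℝ) := sum_inv_sqrt _
      _ ≤ 2 * √((Q : ℝ) / (a * b) ^ 2) := by
          gcongr
          refine Nat.cast_div_le.trans ?_
          push_cast
          gcongr
          have hb1 : (1 : ℝ) ≤ b := by exact_mod_cast hb0
          rw [mul_pow]
          gcongr
          norm_num
      _ = _ := by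
          rw [Real.sqrt_div (by positivity), Real.sqrt_sq (by positivity)]
          field_simp
  refine h2.trans ?_
  have h3 : ∑ a ∈ T, ∑ b ∈ T, 2 * √(Q : ℝ) * (1 / (a : ℝ)) * (1 / (b : ℝ)) = 2 * √(Q : ℝ) * (∑ a ∈ T, 1 / (a : ℝ)) ^ 2 := by
    rw [sq, Finset.sum_mul_sum, Finset.mul_sum]
    refine Finset.sum_congr rfl fun a _ => ?_
    rw [Finset.mul_sum]
    refine Finset.sum_congr rfl fun b _ => ?_
    ring
  rw [h3]
  have h4 := sum_inv Q
  have h5 : (0 : ℝ) ≤ ∑ a ∈ T, 1 / (a : ℝ) := Finset.sum_nonneg fun _ _ => by positivity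
  gcongr

end

section

/-- distance to the nearest multiple of `q` -/
def nuq {q : ℕ} (k : ZMod q) : ℕ := k.valMinAbs.natAbs

theorem nuq_pos {q : ℕ} {k : ZMod q} (hk : k ≠ 0) : 0 < nuq k := by
  unfold nuq
  rw [Int.natAbs_pos]
  simpa using hk

theorem nuq_le {q : ℕ} [NeZero q] (k : ZMod q) : nuq k ≤ q :=
  (ZMod.natAbs_valMinAbs_le k).trans (Nat.div_le_self _ _)

theorem norm_std_sub_one {q : ℕ} [NeZero q] (k : ZMod q) :
    4 * (nuq k : ℝ) / q ≤ ‖ZMod.stdAddChar k - 1‖ := by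
  have hq : (0 : ℝ) < q := by exact_mod_cast NeZero.pos q
  set j := k.valMinAbs with hj
  have hk : k = ((j : ℤ) : ZMod q) := (ZMod.coe_valMinAbs k).symm
  have h1 : ZMod.stdAddChar k = Complex.exp (Complex.I * ((2 * Real.pi * j / q : ℝ) : ℂ)) := by
    rw [hk, ZMod.stdAddChar_coe]
    congr 1
    push_cast
    ring
  rw [h1, Complex.norm_exp_I_mul_ofReal_sub_one, norm_mul, Real.norm_eq_abs, Real.norm_eq_abs, abs_two]
  have h2 : (2 * Real.pi * j / q) / 2 = Real.pi * j / q := by ring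
  rw [h2]
  have hν : (nuq k : ℝ) = |(j : ℝ)| := by
    unfold nuq
    rw [← hj, Nat.cast_natAbs]; push_cast; rfl
  have hle : |(j : ℝ)| ≤ q / 2 := by
    rw [← hν]
    have : nuq k ≤ q / 2 := ZMod.natAbs_valMinAbs_le k
    have h3 : (nuq k : ℝ) ≤ ((q / 2 : ℕ) : ℝ) := by exact_mod_cast this
    exact h3.trans Nat.cast_div_le
  have h4 : |Real.sin (Real.pi * j / q)| = |Real.sin (Real.pi * |(j : ℝ)| / q)| := by
    rcases abs_choice (j : ℝ) with h | h
    · rw [h]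
    · rw [h, mul_neg, neg_div, Real.sin_neg, abs_neg]
  rw [h4, hν]
  have h5 : 2 / Real.pi * (Real.pi * |(j : ℝ)| / q) ≤ Real.sin (Real.pi * |(j : ℝ)| / q) := by
    apply Real.mul_le_sin
    · have := Real.pi_pos; positivity
    · rw [div_le_iff₀ hq]
      nlinarith [Real.pi_pos]
  have h6 : 2 / Real.pi * (Real.pi * |(j : ℝ)| / q) = 2 * |(j : ℝ)| / q := by
    have := Real.pi_pos.ne'
    field_simp
  rw [h6] at h5
  have h7 := h5.trans (le_abs_self _)
  calc 4 * |(j : ℝ)| / q = 2 * (2 * |(j : ℝ)| / q) := by ring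
    _ ≤ _ := by linarith

theorem geom_tele {q : ℕ} [NeZero q] (k : ZMod q) (u v : ℕ) (h : u ≤ v) :
    (ZMod.stdAddChar k - 1) * ∑ x ∈ Finset.Ioc u v, (ZMod.stdAddChar (k * (x : ZMod q)) : ℂ) =
      ZMod.stdAddChar (k * ((v + 1 : ℕ) : ZMod q)) - ZMod.stdAddChar (k * ((u + 1 : ℕ) : ZMod q)) := by
  induction v, h using Nat.le_induction with
  | base => simp
  | succ v hv ih =>
    rw [← Finset.insert_Ioc_right_eq_Ioc_add_one hv, Finset.sum_insert (by simp), mul_add, ih]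
    have : ZMod.stdAddChar (k * ((v + 1 + 1 : ℕ) : ZMod q)) =
       (ZMod.stdAddChar k : ℂ) * ZMod.stdAddChar (k * ((v + 1 : ℕ) : ZMod q)) := by
      rw [← AddChar.map_add_eq_mul]; congr 1; push_cast; ring
    rw [this]
    ring

/-- bound for an incomplete linear sum -/
noncomputable def Dq {q : ℕ} (k : ZMod q) : ℝ := if k = 0 then q else q / (2 * nuq k)

theorem Dq_nonneg {q : ℕ} (k : ZMod q) : 0 ≤ Dq k := by
  unfold Dq; split_ifs <;> positivity

theorem geom_bound {q : ℕ} [NeZero q] {k : ZMod q} (hk : k ≠ 0) (v : ℕ) :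
    ‖∑ x ∈ Finset.Ioc 0 v, (ZMod.stdAddChar (k * (x : ZMod q)) : ℂ)‖ ≤ q / (2 * nuq k) := by
  have hq : (0 : ℝ) < q := by exact_mod_cast NeZero.pos q
  have hν : (0 : ℝ) < nuq k := by exact_mod_cast nuq_pos hk
  have h1 := geom_tele k 0 v (Nat.zero_le _)
  have h2 := norm_std_sub_one k
  have h3 := congrArg norm h1
  rw [norm_mul] at h3
  have h4 : ‖(ZMod.stdAddChar (k * ((v + 1 : ℕ) : ZMod q)) : ℂ) - ZMod.stdAddChar (k * ((0 + 1 : ℕ) : ZMod q))‖ ≤ 2 := by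
    refine (norm_sub_le _ _).trans ?_
    rw [AddChar.norm_apply, AddChar.norm_apply]; norm_num
  rw [← h3] at h4
  have h5 : 4 * (nuq k : ℝ) / q * ‖∑ x ∈ Finset.Ioc 0 v, (ZMod.stdAddChar (k * (x : ZMod q)) : ℂ)‖ ≤ 2 :=
    (mul_le_mul_of_nonneg_right h2 (norm_nonneg _)).trans h4
  rw [le_div_iff₀ (by positivity)]
  have h6 : 4 * (nuq k : ℝ) / q * ‖∑ x ∈ Finset.Ioc 0 v, (ZMod.stdAddChar (k * (x : ZMod q)) : ℂ)‖ =
    (4 * (nuq k : ℝ) * ‖∑ x ∈ Finset.Ioc 0 v, (ZMod.stdAddChar (k * (x : ZMod q)) : ℂ)‖) / q := by ring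
  rw [h6, div_le_iff₀ hq] at h5
  linarith

theorem geom_bound' {q : ℕ} [NeZero q] (k : ZMod q) (v : ℕ) (hv : v ≤ q) :
    ‖∑ x ∈ Finset.Ioc 0 v, (ZMod.stdAddChar (k * (x : ZMod q)) : ℂ)‖ ≤ Dq k := by
  unfold Dq
  split_ifs with h
  · refine (norm_sum_le _ _).trans ?_
    simp only [AddChar.norm_apply]
    simpa using hv
  · exact geom_bound h v

theorem sum_nuq_le {q : ℕ} [NeZero q] (F : ℕ → ℝ) (hF : ∀ j, 0 ≤ F j) :
    ∑ k ∈ Finset.univ.filter (fun k : ZMod q => k ≠ 0), F (nuq k) ≤ 2 * ∑ j ∈ Finset.Icc 1 q, F j := by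
  rw [← Finset.sum_fiberwise_of_maps_to (t := Finset.Icc 1 q) (g := nuq)]
  · rw [Finset.mul_sum]
    refine Finset.sum_le_sum fun j _ => ?_
    have : ∑ i ∈ (Finset.univ.filter (fun k : ZMod q => k ≠ 0)).filter (fun k => nuq k = j), F (nuq i) =
        ((Finset.univ.filter (fun k : ZMod q => k ≠ 0)).filter (fun k => nuq k = j)).card * F j := by
      rw [Finset.sum_congr rfl (g := fun _ => F j), Finset.sum_const, nsmul_eq_mul]
      intro x hx
      rw [(Finset.mem_filter.1 hx).2]
    rw [this]
    have hc : ((Finset.univ.filter (fun k : ZMod q => k ≠ 0)).filter (fun k => nuq k = j)).card ≤ 2 := by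
      refine (Finset.card_le_card (t := {(j : ZMod q), -(j : ZMod q)}) ?_).trans Finset.card_le_two
      intro k hk
      have hk := (Finset.mem_filter.1 hk).2
      unfold nuq at hk
      simp only [Finset.mem_insert, Finset.mem_singleton]
      have h1 : ((k.valMinAbs : ℤ) : ZMod q) = k := ZMod.coe_valMinAbs k
      rcases Int.natAbs_eq k.valMinAbs with h | h
      · left; rw [← h1, h, hk]; simp
      · right; rw [← h1, h, hk]; simp
    have := hF j
    have : (((Finset.univ.filter (fun k : ZMod q => k ≠ 0)).filter (fun k => nuq k = j)).card : ℝ) ≤ 2 := by exact_mod_cast hc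
    gcongr
  · intro k hk
    exact Finset.mem_Icc.2 ⟨nuq_pos (Finset.mem_filter.1 hk).2, nuq_le k⟩

theorem gcd_nuq {q : ℕ} [NeZero q] (k : ZMod q) : k.val.gcd q = (nuq k).gcd q := by
  unfold nuq
  have h : ((k.val : ℤ)) ≡ k.valMinAbs [ZMOD q] := by
    rw [← ZMod.intCast_eq_intCast_iff]
    simp
  have h2 : (k.val : ℤ).gcd q = k.valMinAbs.gcd q := by
    rw [← Int.gcd_emod, h, Int.gcd_emod]
  exact h2

theorem sum_Dq {q : ℕ} [NeZero q] : ∑ k : ZMod q, Dq k ≤ q * (2 + Real.log q) := by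
  have h1 := sum_nuq_le (q := q) (fun j => q / (2 * (j : ℝ))) (fun j => by positivity)
  rw [← Finset.sum_filter_add_sum_filter_not Finset.univ (fun k : ZMod q => k ≠ 0)]
  have h2 : ∑ k ∈ Finset.univ.filter (fun k : ZMod q => k ≠ 0), Dq k =
      ∑ k ∈ Finset.univ.filter (fun k : ZMod q => k ≠ 0), q / (2 * (nuq k : ℝ)) := by
    refine Finset.sum_congr rfl fun k hk => ?_
    unfold Dq
    rw [if_neg (Finset.mem_filter.1 hk).2]
  have h3 : ∑ k ∈ Finset.univ.filter (fun k : ZMod q => ¬ k ≠ 0), Dq k = q := by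
    simp only [ne_eq, not_not, Finset.filter_eq', Finset.mem_univ, if_true, Finset.sum_singleton]
    simp [Dq]
  rw [h2, h3]
  have h4 : 2 * ∑ j ∈ Finset.Icc 1 q, (q : ℝ) / (2 * (j : ℝ)) = q * ∑ j ∈ Finset.Icc 1 q, 1 / (j : ℝ) := by
    rw [Finset.mul_sum, Finset.mul_sum]
    refine Finset.sum_congr rfl fun j hj => ?_
    have : (j : ℝ) ≠ 0 := by have := (Finset.mem_Icc.1 hj).1; positivity
    field_simp
  rw [h4] at h1
  have h5 := sum_inv q
  have : (q : ℝ) * ∑ j ∈ Finset.Icc 1 q, 1 / (j : ℝ) ≤ q * (1 + Real.log q) := by gcongr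
  linarith

theorem sqrt_gcd_le (g : ℕ) (hg : 0 < g) : √(g : ℝ) ≤ ∑ e ∈ g.divisors, √(e : ℝ) :=
  Finset.single_le_sum (f := fun e : ℕ => √(e : ℝ)) (fun _ _ => Real.sqrt_nonneg _) (Nat.mem_divisors_self g hg.ne')

theorem sum_gcd_div (q : ℕ) (hq : 0 < q) :
    ∑ j ∈ Finset.Icc 1 q, √((j.gcd q : ℕ) : ℝ) / j ≤ q.divisors.card * (1 + Real.log q) := by
  calc ∑ j ∈ Finset.Icc 1 q, √((j.gcd q : ℕ) : ℝ) / j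
      ≤ ∑ j ∈ Finset.Icc 1 q, ∑ e ∈ q.divisors, (if e ∣ j then √(e : ℝ) / j else 0) := by
        refine Finset.sum_le_sum fun j hj => ?_
        rw [← Finset.sum_filter, ← Finset.sum_div]
        gcongr
        have hj0 : 0 < j := (Finset.mem_Icc.1 hj).1
        refine (sqrt_gcd_le _ (Nat.gcd_pos_of_pos_left _ hj0)).trans ?_
        refine Finset.sum_le_sum_of_subset_of_nonneg ?_ fun _ _ _ => Real.sqrt_nonneg _
        intro e he
        have := Nat.dvd_of_mem_divisors he
        exact Finset.mem_filter.2 ⟨Nat.mem_divisors.2 ⟨this.trans (Nat.gcd_dvd_right _ _), hq.ne'⟩, this.trans (Nat.gcd_dvd_left _ _)⟩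
    _ = ∑ e ∈ q.divisors, ∑ j ∈ (Finset.Icc 1 q).filter (fun j => e ∣ j), √(e : ℝ) / j := by
        rw [Finset.sum_comm]
        refine Finset.sum_congr rfl fun e _ => ?_
        rw [Finset.sum_filter]
    _ ≤ ∑ e ∈ q.divisors, (1 + Real.log q) := by
        refine Finset.sum_le_sum fun e he => ?_
        have he0 : 0 < e := Nat.pos_of_mem_divisors he
        have he1 : (1 : ℝ) ≤ e := by exact_mod_cast he0
        have hsub : (Finset.Icc 1 q).filter (fun j => e ∣ j) ⊆ (Finset.Icc 1 q).image (fun i => e * i) := by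
          intro j hj
          obtain ⟨hj, ⟨i, rfl⟩⟩ := Finset.mem_filter.1 hj
          rw [Finset.mem_Icc] at hj
          refine Finset.mem_image.2 ⟨i, Finset.mem_Icc.2 ⟨?_, ?_⟩, rfl⟩
          · exact Nat.pos_of_mul_pos_left hj.1
          · nlinarith
        calc _ ≤ ∑ j ∈ (Finset.Icc 1 q).image (fun i => e * i), √(e : ℝ) / j :=
              Finset.sum_le_sum_of_subset_of_nonneg hsub fun _ _ _ => by positivity
          _ = ∑ i ∈ Finset.Icc 1 q, √(e : ℝ) / ((e * i : ℕ) : ℝ) := by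
              rw [Finset.sum_image]
              intro x _ y _ h
              exact Nat.eq_of_mul_eq_mul_left he0 h
          _ ≤ ∑ i ∈ Finset.Icc 1 q, 1 / (i : ℝ) := by
              refine Finset.sum_le_sum fun i hi => ?_
              have : 0 < i := (Finset.mem_Icc.1 hi).1
              push_cast
              rw [div_le_div_iff₀ (by positivity) (by positivity), one_mul]
              have : √(e : ℝ) ≤ e := by
                rw [Real.sqrt_le_left (by positivity)]
                nlinarith
              gcongr
          _ ≤ _ := sum_inv q
    _ = _ := by rw [Finset.sum_const, nsmul_eq_mul]

theorem sum_gcd_nuq {q : ℕ} [NeZero q] :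
    ∑ k ∈ Finset.univ.filter (fun k : ZMod q => k ≠ 0), √((k.val.gcd q : ℕ) : ℝ) / nuq k ≤
      2 * (q.divisors.card * (1 + Real.log q)) := by
  simp_rw [gcd_nuq]
  refine (sum_nuq_le (q := q) (fun j => √((j.gcd q : ℕ) : ℝ) / j) (fun j => by positivity)).trans ?_
  gcongr
  exact sum_gcd_div q (NeZero.pos q)

end

section

theorem indicator_fourier {q : ℕ} [NeZero q] (X : Finset (ZMod q × ZMod q)) (u v : ZMod q) :
    (q : ℂ) ^ 2 * (if (u, v) ∈ X then 1 else 0) =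
      ∑ m : ZMod q, ∑ n : ZMod q, (∑ x ∈ X, ZMod.stdAddChar (m * x.1 + n * x.2)) *
        (ZMod.stdAddChar ((-m) * u + (-n) * v) : ℂ) := by
  have hps := ZMod.isPrimitive_stdAddChar q
  have h1 : ∀ m n : ZMod q, (∑ x ∈ X, (ZMod.stdAddChar (m * x.1 + n * x.2) : ℂ)) * ZMod.stdAddChar ((-m) * u + (-n) * v) =
      ∑ x ∈ X, (ZMod.stdAddChar (m * (x.1 - u)) : ℂ) * ZMod.stdAddChar (n * (x.2 - v)) := by
    intro m n
    rw [Finset.sum_mul]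
    refine Finset.sum_congr rfl fun x _ => ?_
    rw [← AddChar.map_add_eq_mul, ← AddChar.map_add_eq_mul]
    congr 1; ring
  simp_rw [h1]
  have h2 : ∀ m : ZMod q, ∑ n : ZMod q, ∑ x ∈ X, (ZMod.stdAddChar (m * (x.1 - u)) : ℂ) * ZMod.stdAddChar (n * (x.2 - v)) =
      ∑ x ∈ X, ZMod.stdAddChar (m * (x.1 - u)) * (if x.2 = v then (q : ℂ) else 0) := by
    intro m
    rw [Finset.sum_comm]
    refine Finset.sum_congr rfl fun x _ => ?_
    rw [← Finset.mul_sum, AddChar.sum_mulShift _ hps, ZMod.card]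
    simp [sub_eq_zero]
  simp_rw [h2]
  rw [Finset.sum_comm]
  have h3 : ∀ x ∈ X, ∑ m : ZMod q, (ZMod.stdAddChar (m * (x.1 - u)) : ℂ) * (if x.2 = v then (q : ℂ) else 0) =
      if x = (u, v) then (q : ℂ) ^ 2 else 0 := by
    intro x _
    rw [← Finset.sum_mul, AddChar.sum_mulShift _ hps, ZMod.card]
    by_cases hu : x.1 = u <;> by_cases hv : x.2 = v <;> simp [hu, hv, Prod.ext_iff, sub_eq_zero, sq]
  rw [Finset.sum_congr rfl h3, Finset.sum_ite_eq']
  split_ifs <;> simp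

/-- exponential sum over the region -/
noncomputable def Greg {q : ℕ} [NeZero q] (b N D0 : ℕ) (m n : ZMod q) : ℂ :=
  ∑ d ∈ Finset.Ioc 0 D0, ∑ a ∈ Finset.Ioc b (N - d), (ZMod.stdAddChar (m * (d : ZMod q) + n * (a : ZMod q)) : ℂ)

theorem Greg_bound {q : ℕ} [NeZero q] {b N D0 : ℕ} (hD : D0 ≤ q) (hDN : D0 + b ≤ N) (m : ZMod q) {n : ZMod q} (hn : n ≠ 0) :
    ‖Greg b N D0 m n‖ ≤ q / (4 * nuq n) * (Dq (m - n) + Dq m) := by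
  have hq : (0 : ℝ) < q := by exact_mod_cast NeZero.pos q
  have hν : (0 : ℝ) < nuq n := by exact_mod_cast nuq_pos hn
  have h1 : (ZMod.stdAddChar n - 1) * Greg b N D0 m n =
      ZMod.stdAddChar (n * ((N + 1 : ℕ) : ZMod q)) * ∑ d ∈ Finset.Ioc 0 D0, (ZMod.stdAddChar ((m - n) * (d : ZMod q)) : ℂ) -
      ZMod.stdAddChar (n * ((b + 1 : ℕ) : ZMod q)) * ∑ d ∈ Finset.Ioc 0 D0, (ZMod.stdAddChar (m * (d : ZMod q)) : ℂ) := by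
    unfold Greg
    rw [Finset.mul_sum, Finset.mul_sum, Finset.mul_sum, ← Finset.sum_sub_distrib]
    refine Finset.sum_congr rfl fun d hd => ?_
    rw [Finset.mem_Ioc] at hd
    have h2 : ∑ a ∈ Finset.Ioc b (N - d), (ZMod.stdAddChar (m * (d : ZMod q) + n * (a : ZMod q)) : ℂ) =
      ZMod.stdAddChar (m * (d : ZMod q)) * ∑ a ∈ Finset.Ioc b (N - d), (ZMod.stdAddChar (n * (a : ZMod q)) : ℂ) := by
      rw [Finset.mul_sum]
      refine Finset.sum_congr rfl fun a _ => ?_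
      rw [AddChar.map_add_eq_mul]
    rw [h2, mul_left_comm, geom_tele n b (N - d) (by omega), mul_sub, ← AddChar.map_add_eq_mul, ← AddChar.map_add_eq_mul,
      ← AddChar.map_add_eq_mul, ← AddChar.map_add_eq_mul]
    have h3 : ((N - d + 1 : ℕ) : ZMod q) = ((N + 1 : ℕ) : ZMod q) - d := by
      have : N + 1 = (N - d + 1) + d := by omega
      rw [this]; push_cast; ring
    rw [h3]
    congr 2 <;> ring
  have h2 := norm_std_sub_one n
  have h3 := congrArg norm h1
  rw [norm_mul] at h3
  have h4 : ‖(ZMod.stdAddChar n : ℂ) - 1‖ * ‖Greg b N D0 m n‖ ≤ Dq (m - n) + Dq m := by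
    rw [h3]
    refine (norm_sub_le _ _).trans ?_
    rw [norm_mul, norm_mul, AddChar.norm_apply, AddChar.norm_apply, one_mul, one_mul]
    exact add_le_add (geom_bound' _ _ hD) (geom_bound' _ _ hD)
  have h5 := (mul_le_mul_of_nonneg_right h2 (norm_nonneg (Greg b N D0 m n))).trans h4
  rw [div_mul_eq_mul_div, div_le_iff₀ hq] at h5
  rw [div_mul_eq_mul_div, le_div_iff₀ (by positivity)]
  linarith

theorem Greg_bound0 {q : ℕ} [NeZero q] {b N D0 : ℕ} {m : ZMod q} (hm : m ≠ 0) :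
    ‖Greg b N D0 m 0‖ ≤ N * (q / (2 * nuq m)) := by
  unfold Greg
  rw [Finset.sum_comm' (t' := Finset.Ioc b N) (s' := fun a => Finset.Ioc 0 (min D0 (N - a)))
    (by intro d a; simp only [Finset.mem_Ioc]; omega)]
  refine (norm_sum_le _ _).trans ?_
  calc _ ≤ ∑ a ∈ Finset.Ioc b N, (q : ℝ) / (2 * nuq m) := by
        refine Finset.sum_le_sum fun a _ => ?_
        simp only [zero_mul, add_zero]
        exact geom_bound hm _
    _ = ((N - b : ℕ) : ℝ) * (q / (2 * nuq m)) := by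
        rw [Finset.sum_const, nsmul_eq_mul, Nat.card_Ioc]
    _ ≤ _ := by gcongr; omega

theorem count_main {q : ℕ} [NeZero q] (X : Finset (ZMod q × ZMod q)) {B : ℝ} (hB : 0 ≤ B)
    (hX : ∀ m n : ZMod q, ‖∑ x ∈ X, (ZMod.stdAddChar (m * x.1 + n * x.2) : ℂ)‖ ≤
      B * √(((m.val.gcd n.val).gcd q : ℕ) : ℝ)) {b N D0 : ℕ} (hD : D0 ≤ q) (hDN : D0 + b ≤ N) :
    |(∑ d ∈ Finset.Ioc 0 D0, ∑ a ∈ Finset.Ioc b (N - d), if ((d : ZMod q), (a : ZMod q)) ∈ X then (1 : ℝ) else 0)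
      - X.card / (q : ℝ) ^ 2 * ∑ d ∈ Finset.Ioc 0 D0, ((N : ℝ) - d - b)| ≤
      B * q.divisors.card * (2 + Real.log q) ^ 2 * (1 + N / q) := by
  have hq : (0 : ℝ) < q := by exact_mod_cast NeZero.pos q
  have hq1 : (1 : ℝ) ≤ q := by exact_mod_cast NeZero.pos q
  have hlog : 0 ≤ Real.log q := Real.log_nonneg hq1
  have hqc : (q : ℂ) ≠ 0 := by exact_mod_cast (NeZero.ne q)
  set Xh : ZMod q → ZMod q → ℂ := fun m n => ∑ x ∈ X, (ZMod.stdAddChar (m * x.1 + n * x.2) : ℂ) with hXh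
  have hXg : ∀ m n : ZMod q, ‖Xh m n‖ ≤ B * √((n.val.gcd q : ℕ) : ℝ) := by
    intro m n
    refine (hX m n).trans ?_
    gcongr
    exact Nat.le_of_dvd (Nat.gcd_pos_of_pos_right _ (NeZero.pos q)) (Nat.gcd_dvd_gcd_of_dvd_left _ (Nat.gcd_dvd_right _ _))
  have hXg0 : ∀ m : ZMod q, ‖Xh m 0‖ ≤ B * √((m.val.gcd q : ℕ) : ℝ) := by
    intro m
    have := hX m 0
    rwa [ZMod.val_zero, Nat.gcd_zero_right] at this
  -- Fourier expansion
  have hF : (q : ℂ) ^ 2 * (∑ d ∈ Finset.Ioc 0 D0, ∑ a ∈ Finset.Ioc b (N - d), if ((d : ZMod q), (a : ZMod q)) ∈ X then (1 : ℂ) else 0)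
      = ∑ m : ZMod q, ∑ n : ZMod q, Xh m n * Greg b N D0 (-m) (-n) := by
    simp_rw [Finset.mul_sum, indicator_fourier X]
    simp only [Greg, Finset.mul_sum]
    have : ∀ d ∈ Finset.Ioc 0 D0, ∑ a ∈ Finset.Ioc b (N - d), ∑ m : ZMod q, ∑ n : ZMod q, Xh m n *
        (ZMod.stdAddChar (-m * (d : ZMod q) + -n * (a : ZMod q)) : ℂ) =
        ∑ m : ZMod q, ∑ n : ZMod q, ∑ a ∈ Finset.Ioc b (N - d), Xh m n * (ZMod.stdAddChar (-m * (d : ZMod q) + -n * (a : ZMod q)) : ℂ) := by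
      intro d _
      rw [Finset.sum_comm]
      refine Finset.sum_congr rfl fun m _ => ?_
      rw [Finset.sum_comm]
    rw [Finset.sum_congr rfl this, Finset.sum_comm]
    refine Finset.sum_congr rfl fun m _ => ?_
    rw [Finset.sum_comm]
  have h00 : Xh 0 0 * Greg b N D0 (-0 : ZMod q) (-0) = X.card * ((∑ d ∈ Finset.Ioc 0 D0, ((N : ℝ) - d - b) : ℝ) : ℂ) := by
    simp only [hXh, Greg, neg_zero, zero_mul, add_zero, AddChar.map_zero_eq_one, Finset.sum_const, nsmul_eq_mul, mul_one, Nat.card_Ioc]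
    congr 1
    push_cast
    refine Finset.sum_congr rfl fun d hd => ?_
    rw [Finset.mem_Ioc] at hd
    rw [Nat.cast_sub (by omega), Nat.cast_sub (by omega)]
  have hν : ∀ k : ZMod q, nuq (-k) = nuq k := by
    intro k; unfold nuq; exact ZMod.natAbs_valMinAbs_neg k
  set E1 : ℂ := ∑ m ∈ Finset.univ.filter (fun k : ZMod q => k ≠ 0), Xh m 0 * Greg b N D0 (-m) (-0) with hE1
  set E2 : ℂ := ∑ n ∈ Finset.univ.filter (fun k : ZMod q => k ≠ 0), ∑ m : ZMod q, Xh m n * Greg b N D0 (-m) (-n) with hE2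
  have hsplit : ∑ m : ZMod q, ∑ n : ZMod q, Xh m n * Greg b N D0 (-m) (-n) =
      Xh 0 0 * Greg b N D0 (-0 : ZMod q) (-0) + E1 + E2 := by
    rw [Finset.sum_comm, ← Finset.sum_filter_not_add_sum_filter Finset.univ (fun k : ZMod q => k ≠ 0)]
    congr 1
    simp only [ne_eq, not_not, Finset.filter_eq', Finset.mem_univ, if_true, Finset.sum_singleton]
    rw [← Finset.sum_filter_not_add_sum_filter Finset.univ (fun k : ZMod q => k ≠ 0)]
    congr 1
    simp only [ne_eq, not_not, Finset.filter_eq', Finset.mem_univ, if_true, Finset.sum_singleton]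
  have hg := sum_gcd_nuq (q := q)
  set G0 := ∑ k ∈ Finset.univ.filter (fun k : ZMod q => k ≠ 0), √((k.val.gcd q : ℕ) : ℝ) / nuq k with hG0
  have hG0n : 0 ≤ G0 := Finset.sum_nonneg fun _ _ => by positivity
  have hb1 : ‖E1‖ ≤ B * N * (q / 2) * G0 := by
    rw [hE1, hG0, Finset.mul_sum]
    refine (norm_sum_le _ _).trans (Finset.sum_le_sum fun m hm => ?_)
    have hm0 : m ≠ 0 := (Finset.mem_filter.1 hm).2
    have hν0 : (0 : ℝ) < nuq m := by exact_mod_cast nuq_pos hm0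
    rw [norm_mul, neg_zero]
    have h1 := Greg_bound0 (b := b) (N := N) (D0 := D0) (neg_ne_zero.2 hm0)
    rw [hν] at h1
    refine (mul_le_mul (hXg0 m) h1 (norm_nonneg _) (by positivity)).trans (le_of_eq ?_)
    field_simp
  have hb2 : ‖E2‖ ≤ B * (q / 4) * (2 * (q * (2 + Real.log q))) * G0 := by
    rw [hE2, hG0, Finset.mul_sum]
    refine (norm_sum_le _ _).trans (Finset.sum_le_sum fun n hn => ?_)
    have hn0 : n ≠ 0 := (Finset.mem_filter.1 hn).2
    have hν0 : (0 : ℝ) < nuq n := by exact_mod_cast nuq_pos hn0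
    refine (norm_sum_le _ _).trans ?_
    calc _ ≤ ∑ m : ZMod q, B * √((n.val.gcd q : ℕ) : ℝ) * (q / (4 * nuq n) * (Dq (-m + n) + Dq (-m))) := by
          refine Finset.sum_le_sum fun m _ => ?_
          rw [norm_mul]
          have h1 := Greg_bound hD hDN (-m) (neg_ne_zero.2 hn0)
          rw [hν, sub_neg_eq_add] at h1
          exact mul_le_mul (hXg m n) h1 (norm_nonneg _) (by positivity)
      _ = B * √((n.val.gcd q : ℕ) : ℝ) * (q / (4 * nuq n)) * (2 * ∑ k : ZMod q, Dq k) := by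
          have e1 : ∑ m : ZMod q, Dq (-m + n) = ∑ k : ZMod q, Dq k :=
            Fintype.sum_equiv ((Equiv.neg _).trans (Equiv.addRight n)) _ _ fun m => rfl
          have e2 : ∑ m : ZMod q, Dq (-m) = ∑ k : ZMod q, Dq k :=
            Fintype.sum_equiv (Equiv.neg _) _ _ fun m => rfl
          rw [← Finset.mul_sum, ← Finset.mul_sum, Finset.sum_add_distrib, e1, e2]
          ring
      _ ≤ B * √((n.val.gcd q : ℕ) : ℝ) * (q / (4 * nuq n)) * (2 * (q * (2 + Real.log q))) := by
          have := sum_Dq (q := q)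
          gcongr
      _ = _ := by field_simp
  -- assemble
  have hfin : ((∑ d ∈ Finset.Ioc 0 D0, ∑ a ∈ Finset.Ioc b (N - d), if ((d : ZMod q), (a : ZMod q)) ∈ X then (1 : ℝ) else 0)
      - X.card / (q : ℝ) ^ 2 * ∑ d ∈ Finset.Ioc 0 D0, ((N : ℝ) - d - b) : ℝ) = ((E1 + E2) / (q : ℂ) ^ 2 : ℂ) := by
    rw [hsplit, h00] at hF
    rw [eq_div_iff (by positivity)]
    rw [add_assoc, ← sub_eq_iff_eq_add'] at hF
    rw [← hF]
    have hite : ∀ x : ZMod q × ZMod q, ((if x ∈ X then (1 : ℝ) else 0 : ℝ) : ℂ) = if x ∈ X then (1 : ℂ) else 0 := by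
      intro x; split_ifs <;> simp
    push_cast
    simp_rw [hite]
    field_simp
  have hnorm := congrArg norm hfin
  rw [Complex.norm_real, Real.norm_eq_abs] at hnorm
  rw [hnorm, norm_div, norm_pow, Complex.norm_natCast, div_le_iff₀ (by positivity)]
  refine (norm_add_le _ _).trans ((add_le_add hb1 hb2).trans ?_)
  set τ : ℝ := (q.divisors.card : ℝ) with hτ
  have hτ0 : 0 ≤ τ := by positivity
  set L := Real.log q with hL
  have e3 : B * N * (q / 2) * G0 + B * (q / 4) * (2 * (q * (2 + L))) * G0 = (B * N * (q / 2) + B * (q / 4) * (2 * (q * (2 + L)))) * G0 := by ring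
  rw [e3]
  have e4 : B * τ * (2 + L) ^ 2 * (1 + N / q) * (q : ℝ) ^ 2 = B * τ * (2 + L) ^ 2 * (q ^ 2 + N * q) := by
    field_simp
  rw [e4]
  calc _ ≤ (B * N * (q / 2) + B * (q / 4) * (2 * (q * (2 + L)))) * (2 * (τ * (1 + L))) := by gcongr
    _ = B * τ * ((1 + L) * (N * q + q ^ 2 * (2 + L))) := by ring
    _ ≤ B * τ * ((2 + L) ^ 2 * (q ^ 2 + N * q)) := by
        apply mul_le_mul_of_nonneg_left _ (by positivity)
        have : 0 ≤ (N : ℝ) * q := by positivity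
        nlinarith [mul_nonneg hlog this, mul_nonneg hlog (mul_nonneg hlog this), sq_nonneg (q : ℝ), mul_nonneg hlog (sq_nonneg (q : ℝ))]
    _ = _ := by ring

end

section

/-- the congruence and parity condition -/
def goodP (b d a : ℕ) : Prop :=
  (Even b ∧ (2 * b : ℤ) ∣ a * d - 1) ∨ (¬ Even b ∧ Even a ∧ Even d ∧ (b : ℤ) ∣ a * d - 1)

theorem std_two {b : ℕ} [NeZero b] [NeZero (2 * b)] (k : ℕ) :
    (ZMod.stdAddChar ((2 * k : ℕ) : ZMod (2 * b)) : ℂ) = ZMod.stdAddChar ((k : ℕ) : ZMod b) := by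
  have h1 := ZMod.stdAddChar_coe (N := 2 * b) ((2 * k : ℕ) : ℤ)
  have h2 := ZMod.stdAddChar_coe (N := b) ((k : ℕ) : ℤ)
  rw [Int.cast_natCast] at h1 h2
  rw [h1, h2]
  congr 1
  have hb : (b : ℂ) ≠ 0 := by exact_mod_cast NeZero.ne b
  push_cast
  field_simp

theorem card_div_le_two_mul (b : ℕ) (hb : 0 < b) : b.divisors.card ≤ (2 * b).divisors.card :=
  Finset.card_le_card (Nat.divisors_subset_of_dvd (by omega) (Dvd.intro_left _ rfl))

theorem exists_X_even (b : ℕ) (hb : 0 < b) (hev : Even b) : ∃ s t : ℕ, 0 < s ∧ 0 < t ∧ s ^ 2 * t ^ 3 ∣ 2 * b ∧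
    ∀ [NeZero (2 * b)], ∃ X : Finset (ZMod (2 * b) × ZMod (2 * b)), X.card = (2 * b).totient ∧
      (∀ d a : ℕ, ((d : ZMod (2 * b)), (a : ZMod (2 * b))) ∈ X ↔ goodP b d a) ∧
      ∀ m n : ZMod (2 * b), ‖∑ x ∈ X, (ZMod.stdAddChar (m * x.1 + n * x.2) : ℂ)‖ ≤
        ((2 * b).divisors.card * √(((2 * b : ℕ) : ℝ) * ((s ^ 2 * t ^ 3 : ℕ) : ℝ))) * √(((m.val.gcd n.val).gcd (2 * b) : ℕ) : ℝ) := by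
  classical
  obtain ⟨s, t, hs, ht, hst, hK⟩ := KS_bound (2 * b) (by omega)
  refine ⟨s, t, hs, ht, hst, ?_⟩
  intro _
  let f : (ZMod (2 * b))ˣ → ZMod (2 * b) × ZMod (2 * b) := fun x => (x, (x⁻¹ : (ZMod (2 * b))ˣ))
  have hf : Function.Injective f := fun x y h => Units.ext (Prod.ext_iff.1 h).1
  refine ⟨Finset.univ.image f, ?_, ?_, ?_⟩
  · rw [Finset.card_image_of_injective _ hf, Finset.card_univ, ZMod.card_units_eq_totient]
  · intro d a
    have h1 : goodP b d a ↔ (d : ZMod (2 * b)) * a = 1 := by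
      unfold goodP
      simp only [hev, not_true, false_and, or_false, true_and]
      have : ((2 * b : ℤ) ∣ a * d - 1) ↔ (((a * d - 1 : ℤ)) : ZMod (2 * b)) = 0 := by
        rw [ZMod.intCast_zmod_eq_zero_iff_dvd]; push_cast; rfl
      rw [this]
      push_cast
      rw [sub_eq_zero, mul_comm (a : ZMod (2 * b))]
    rw [h1]
    simp only [Finset.mem_image, Finset.mem_univ, true_and, f, Prod.mk.injEq]
    constructor
    · rintro ⟨x, hx, hy⟩
      rw [← hx, ← hy, Units.mul_inv]
    · intro h
      refine ⟨⟨d, a, h, (mul_comm _ _).trans h⟩, rfl, rfl⟩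
  · intro m n
    rw [Finset.sum_image (fun x _ y _ h => hf h)]
    have h2 := hK ZMod.stdAddChar (ZMod.isPrimitive_stdAddChar _) 1 m.val n.val
    rw [Real.sqrt_mul (by positivity), ← mul_assoc] at h2
    unfold KS at h2
    simp only [ZMod.natCast_val, ZMod.cast_id', id_eq, one_mul] at h2
    exact h2

theorem exists_X_odd (b : ℕ) (hb : 0 < b) (hev : ¬ Even b) : ∃ s t : ℕ, 0 < s ∧ 0 < t ∧ s ^ 2 * t ^ 3 ∣ 2 * b ∧
    ∀ [NeZero (2 * b)], ∃ X : Finset (ZMod (2 * b) × ZMod (2 * b)), X.card = (2 * b).totient ∧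
      (∀ d a : ℕ, ((d : ZMod (2 * b)), (a : ZMod (2 * b))) ∈ X ↔ goodP b d a) ∧
      ∀ m n : ZMod (2 * b), ‖∑ x ∈ X, (ZMod.stdAddChar (m * x.1 + n * x.2) : ℂ)‖ ≤
        ((2 * b).divisors.card * √(((2 * b : ℕ) : ℝ) * ((s ^ 2 * t ^ 3 : ℕ) : ℝ))) * √(((m.val.gcd n.val).gcd (2 * b) : ℕ) : ℝ) := by
  classical
  obtain ⟨s, t, hs, ht, hst, hK⟩ := KS_bound b hb
  refine ⟨s, t, hs, ht, hst.trans (Dvd.intro_left _ rfl), ?_⟩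
  intro _
  haveI : NeZero b := ⟨by omega⟩
  have hodd : Odd b := Nat.not_even_iff_odd.1 hev
  have h2b : Nat.Coprime 2 b := hodd.coprime_two_left
  have h4b : Nat.Coprime 4 b := by
    have : (4 : ℕ) = 2 ^ 2 := by norm_num
    rw [this]; exact h2b.pow_left 2
  let c : (ZMod b)ˣ := (ZMod.unitOfCoprime 4 h4b)⁻¹
  have hc : (4 : ZMod b) * c = 1 := by
    have : ((ZMod.unitOfCoprime 4 h4b : (ZMod b)ˣ) : ZMod b) = 4 := by
      rw [ZMod.coe_unitOfCoprime]; norm_num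
    rw [← this, Units.mul_inv]
  let j : ZMod b → ZMod (2 * b) := fun x => ((2 * x.val : ℕ) : ZMod (2 * b))
  have hjd : ∀ (d : ℕ) (x : ZMod b), (d : ZMod (2 * b)) = j x ↔ ∃ d', d = 2 * d' ∧ (d' : ZMod b) = x := by
    intro d x
    simp only [j]
    rw [ZMod.natCast_eq_natCast_iff]
    constructor
    · intro h
      have h2 : d % 2 = 0 := by
        have := h.of_mul_right b
        unfold Nat.ModEq at this; omega
      refine ⟨d / 2, by omega, ?_⟩
      have h3 : 2 * (d / 2) ≡ 2 * x.val [MOD 2 * b] := by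
        have : 2 * (d / 2) = d := by omega
        rwa [this]
      have h4 := Nat.ModEq.mul_left_cancel' (by norm_num) h3
      rw [← ZMod.natCast_eq_natCast_iff] at h4
      rw [h4]; simp
    · rintro ⟨d', rfl, rfl⟩
      apply Nat.ModEq.mul_left'
      rw [← ZMod.natCast_eq_natCast_iff]
      simp
  have hj : Function.Injective j := by
    intro x y h
    have h1 := (hjd (2 * x.val) y).1 h
    obtain ⟨d', h2, h3⟩ := h1
    have : d' = x.val := by omega
    rw [← h3, this]; simp
  let f : (ZMod b)ˣ → ZMod (2 * b) × ZMod (2 * b) := fun x => (j x, j (c * x⁻¹ : (ZMod b)ˣ))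
  have hf : Function.Injective f := fun x y h => Units.ext (hj (Prod.ext_iff.1 h).1)
  refine ⟨Finset.univ.image f, ?_, ?_, ?_⟩
  · rw [Finset.card_image_of_injective _ hf, Finset.card_univ, ZMod.card_units_eq_totient, Nat.totient_mul h2b]
    simp
  · intro d a
    have h1 : goodP b d a ↔ ∃ d' a' : ℕ, d = 2 * d' ∧ a = 2 * a' ∧ (4 : ZMod b) * (d' * a') = 1 := by
      unfold goodP
      simp only [hev, not_false_eq_true, false_and, false_or, true_and]
      have hz : ((b : ℤ) ∣ a * d - 1) ↔ (((a * d - 1 : ℤ)) : ZMod b) = 0 := by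
        rw [ZMod.intCast_zmod_eq_zero_iff_dvd]
      rw [hz]
      constructor
      · rintro ⟨⟨a', rfl⟩, ⟨d', rfl⟩, h⟩
        refine ⟨d', a', by ring, by ring, ?_⟩
        push_cast at h
        linear_combination h
      · rintro ⟨d', a', rfl, rfl, h⟩
        refine ⟨even_two_mul _, even_two_mul _, ?_⟩
        push_cast
        linear_combination h
    rw [h1]
    simp only [Finset.mem_image, Finset.mem_univ, true_and, f, Prod.mk.injEq]
    constructor
    · rintro ⟨x, hx, hy⟩
      obtain ⟨d', rfl, hd⟩ := (hjd d x).1 hx.symm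
      obtain ⟨a', rfl, ha⟩ := (hjd a _).1 hy.symm
      refine ⟨d', a', rfl, rfl, ?_⟩
      rw [hd, ha, Units.val_mul, mul_left_comm (x : ZMod b), Units.mul_inv, mul_one, hc]
    · rintro ⟨d', a', rfl, rfl, h⟩
      let x : (ZMod b)ˣ := ⟨d', 4 * a', by linear_combination h, by linear_combination h⟩
      refine ⟨x, ((hjd _ _).2 ⟨d', rfl, rfl⟩).symm, ((hjd _ _).2 ⟨a', rfl, ?_⟩).symm⟩
      rw [Units.val_mul]
      have : ((x⁻¹ : (ZMod b)ˣ) : ZMod b) = 4 * a' := rfl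
      rw [this]
      linear_combination (-(a' : ZMod b)) * hc
  · intro m n
    rw [Finset.sum_image (fun x _ y _ h => hf h)]
    have h2 := hK ZMod.stdAddChar (ZMod.isPrimitive_stdAddChar _) c m.val n.val
    have h3 : ∑ x : (ZMod b)ˣ, (ZMod.stdAddChar (m * (f x).1 + n * (f x).2) : ℂ) =
        KS ZMod.stdAddChar c (m.val : ZMod b) (n.val : ZMod b) := by
      unfold KS
      refine Finset.sum_congr rfl fun x _ => ?_
      have h4 : m * (f x).1 + n * (f x).2 =
          ((2 * (m.val * (x : ZMod b).val + n.val * ((c * x⁻¹ : (ZMod b)ˣ) : ZMod b).val) : ℕ) : ZMod (2 * b)) := by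
        simp only [f, j]
        push_cast
        rw [ZMod.natCast_zmod_val m, ZMod.natCast_zmod_val n]
        ring
      rw [h4, std_two]
      congr 1
      push_cast
      rw [ZMod.natCast_zmod_val (x : ZMod b)]
      congr 2
      rw [ZMod.natCast_zmod_val]
    rw [h3]
    refine h2.trans ?_
    rw [Real.sqrt_mul (by positivity), ← mul_assoc]
    have e1 : (b.divisors.card : ℝ) ≤ (2 * b).divisors.card := by exact_mod_cast card_div_le_two_mul b hb
    have e2 : (m.val.gcd n.val).gcd b ≤ (m.val.gcd n.val).gcd (2 * b) :=
      Nat.le_of_dvd (Nat.gcd_pos_of_pos_right _ (by omega)) (Nat.gcd_dvd_gcd_of_dvd_right _ (Dvd.intro_left _ rfl))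
    have e3 : (b : ℝ) ≤ ((2 * b : ℕ) : ℝ) := by exact_mod_cast (by omega : b ≤ 2 * b)
    gcongr

theorem exists_X (b : ℕ) (hb : 0 < b) : ∃ s t : ℕ, 0 < s ∧ 0 < t ∧ s ^ 2 * t ^ 3 ∣ 2 * b ∧
    ∀ [NeZero (2 * b)], ∃ X : Finset (ZMod (2 * b) × ZMod (2 * b)), X.card = (2 * b).totient ∧
      (∀ d a : ℕ, ((d : ZMod (2 * b)), (a : ZMod (2 * b))) ∈ X ↔ goodP b d a) ∧
      ∀ m n : ZMod (2 * b), ‖∑ x ∈ X, (ZMod.stdAddChar (m * x.1 + n * x.2) : ℂ)‖ ≤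
        ((2 * b).divisors.card * √(((2 * b : ℕ) : ℝ) * ((s ^ 2 * t ^ 3 : ℕ) : ℝ))) * √(((m.val.gcd n.val).gcd (2 * b) : ℕ) : ℝ) := by
  by_cases h : Even b
  · exact exists_X_even b hb h
  · exact exists_X_odd b hb h

end

section

open Classical in
/-- number of admissible triples `(b, d, a)` -/
noncomputable def cntN (N : ℕ) : ℝ :=
  ∑ b ∈ Finset.Icc 1 N, ∑ d ∈ Finset.Ioc 0 (min b (N - b)), ∑ a ∈ Finset.Ioc b (N - d),
    if goodP b d a then (1 : ℝ) else 0

/-- size of the region -/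
noncomputable def AbN (b N : ℕ) : ℝ := ∑ d ∈ Finset.Ioc 0 (min b (N - b)), ((N : ℝ) - d - b)

open Classical in
theorem cnt_b (b N : ℕ) (hb : 0 < b) (hbN : b ≤ N) : ∃ s t : ℕ, 0 < s ∧ 0 < t ∧ s ^ 2 * t ^ 3 ∣ 2 * b ∧
    |(∑ d ∈ Finset.Ioc 0 (min b (N - b)), ∑ a ∈ Finset.Ioc b (N - d), if goodP b d a then (1 : ℝ) else 0)
      - (2 * b).totient / (2 * b : ℝ) ^ 2 * AbN b N| ≤
      3 * N * ((2 * b).divisors.card : ℝ) ^ 2 * (2 + Real.log (2 * N : ℕ)) ^ 2 *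
        (√((s ^ 2 * t ^ 3 : ℕ) : ℝ) / √((2 * b : ℕ) : ℝ)) := by
  obtain ⟨s, t, hs, ht, hst, h⟩ := exists_X b hb
  refine ⟨s, t, hs, ht, hst, ?_⟩
  haveI : NeZero (2 * b) := ⟨by omega⟩
  obtain ⟨X, hXc, hXm, hXF⟩ := h
  have h1 := count_main X (by positivity) hXF (b := b) (N := N) (D0 := min b (N - b)) (by omega) (by omega)
  simp_rw [hXm, hXc] at h1
  have hbR : (0 : ℝ) < b := by exact_mod_cast hb
  have hq : (0 : ℝ) < ((2 * b : ℕ) : ℝ) := by positivity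
  have e0 : (2 * b : ℝ) = ((2 * b : ℕ) : ℝ) := by push_cast; rfl
  unfold AbN
  rw [e0]
  refine h1.trans ?_
  set q : ℕ := 2 * b with hqdef
  have hqN : (q : ℝ) ≤ 2 * N := by exact_mod_cast (by omega : q ≤ 2 * N)
  have hN0 : (0 : ℝ) < N := by exact_mod_cast (by omega : 0 < N)
  have hl1 : Real.log q ≤ Real.log (2 * N : ℕ) := Real.log_le_log hq (by push_cast; exact hqN)
  have hl0 : 0 ≤ Real.log q := Real.log_nonneg (by exact_mod_cast (by omega : 1 ≤ q))
  have e1 : (1 : ℝ) + N / q ≤ 3 * N / q := by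
    have : (1 : ℝ) ≤ 2 * N / q := by rw [le_div_iff₀ hq]; linarith
    have e : 3 * (N : ℝ) / q = 2 * N / q + N / q := by ring
    rw [e]; linarith
  have e2 : √((q : ℝ) * ((s ^ 2 * t ^ 3 : ℕ) : ℝ)) = q * (√((s ^ 2 * t ^ 3 : ℕ) : ℝ) / √(q : ℝ)) := by
    rw [Real.sqrt_mul hq.le]
    have := Real.mul_self_sqrt hq.le
    have h0 : √(q : ℝ) ≠ 0 := (Real.sqrt_pos.2 hq).ne'
    rw [mul_div_assoc', eq_div_iff h0]
    linear_combination √((s ^ 2 * t ^ 3 : ℕ) : ℝ) * this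
  rw [e2]
  calc _ ≤ (q.divisors.card * (q * (√((s ^ 2 * t ^ 3 : ℕ) : ℝ) / √(q : ℝ)))) * q.divisors.card * (2 + Real.log (2 * N : ℕ)) ^ 2 * (3 * N / q) := by
        gcongr
    _ = _ := by field_simp

theorem log_le_pow (δ : ℝ) (hδ : 0 < δ) (x : ℝ) (hx : 1 ≤ x) : 2 + Real.log x ≤ (2 + 1 / δ) * x ^ δ := by
  have h1 := Real.log_le_rpow_div (by linarith : 0 ≤ x) hδ
  have h2 : 1 ≤ x ^ δ := Real.one_le_rpow hx hδ.le
  have : (2 + 1 / δ) * x ^ δ = 2 * x ^ δ + x ^ δ / δ := by ring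
  rw [this]; linarith

theorem cnt_error (ε : ℝ) (hε : 0 < ε) : ∃ C : ℝ, 0 < C ∧ ∀ N : ℕ, 0 < N →
    |cntN N - ∑ b ∈ Finset.Icc 1 N, (2 * b).totient / (2 * b : ℝ) ^ 2 * AbN b N| ≤ C * (N : ℝ) ^ (3 / 2 + ε) := by
  classical
  set δ := ε / 6 with hδ
  have hδ0 : 0 < δ := by positivity
  obtain ⟨C, hC1, hC⟩ := tau_bound δ hδ0
  refine ⟨3 * C ^ 2 * 2 * (2 + 1 / δ) ^ 4 * 2 ^ (3 / 2 + ε), by positivity, fun N hN => ?_⟩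
  have hN0 : (0 : ℝ) < N := by exact_mod_cast hN
  set Q : ℕ := 2 * N with hQ
  have hQ0 : (0 : ℝ) < Q := by positivity
  have hQ1 : (1 : ℝ) ≤ Q := by exact_mod_cast (by omega : 1 ≤ Q)
  set Lg := 2 + Real.log Q with hLg
  have hLg0 : 0 ≤ Lg := by have := Real.log_nonneg hQ1; positivity
  have hb := fun b (h : b ∈ Finset.Icc 1 N) => cnt_b b N (Finset.mem_Icc.1 h).1 (Finset.mem_Icc.1 h).2
  choose! s t hs ht hst hE using hb
  have hsum := sum_sqf Q (fun q => if q ∈ (Finset.Icc 1 N).image (2 * ·) then s (q / 2) else 1)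
    (fun q => if q ∈ (Finset.Icc 1 N).image (2 * ·) then t (q / 2) else 1)
    (by
      intro q _
      split_ifs with h
      · obtain ⟨b, hb, rfl⟩ := Finset.mem_image.1 h
        rw [Nat.mul_div_cancel_left _ (by norm_num)]; exact hs b hb
      · norm_num)
    (by
      intro q _
      split_ifs with h
      · obtain ⟨b, hb, rfl⟩ := Finset.mem_image.1 h
        rw [Nat.mul_div_cancel_left _ (by norm_num)]; exact ht b hb
      · norm_num)
    (by
      intro q _
      split_ifs with h
      · obtain ⟨b, hb, rfl⟩ := Finset.mem_image.1 h
        rw [Nat.mul_div_cancel_left _ (by norm_num)]; exact hst b hb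
      · simp)
  have hsum2 : ∑ b ∈ Finset.Icc 1 N, √((s b ^ 2 * t b ^ 3 : ℕ) : ℝ) / √((2 * b : ℕ) : ℝ) ≤ 2 * √(Q : ℝ) * Lg ^ 2 := by
    refine le_trans ?_ (hsum.trans ?_)
    · have hinj : Set.InjOn (fun b : ℕ => 2 * b) (Finset.Icc 1 N : Finset ℕ) := fun x _ y _ h => by
        simp only at h; omega
      calc _ = ∑ q ∈ (Finset.Icc 1 N).image (2 * ·), √((s (q / 2) ^ 2 * t (q / 2) ^ 3 : ℕ) : ℝ) / √(q : ℝ) := by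
            rw [Finset.sum_image hinj]
            refine Finset.sum_congr rfl fun b _ => ?_
            rw [Nat.mul_div_cancel_left _ (by norm_num)]
        _ = ∑ q ∈ (Finset.Icc 1 N).image (2 * ·), √(((if q ∈ (Finset.Icc 1 N).image (2 * ·) then s (q / 2) else 1) ^ 2 *
              (if q ∈ (Finset.Icc 1 N).image (2 * ·) then t (q / 2) else 1) ^ 3 : ℕ) : ℝ) / √(q : ℝ) := by
            refine Finset.sum_congr rfl fun q hq => ?_
            rw [if_pos hq, if_pos hq]
        _ ≤ _ := by
            refine Finset.sum_le_sum_of_subset_of_nonneg ?_ fun _ _ _ => by positivity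
            intro q hq
            obtain ⟨b, hb, rfl⟩ := Finset.mem_image.1 hq
            rw [Finset.mem_Icc] at hb ⊢
            omega
    · have := Real.log_nonneg hQ1
      gcongr
      rw [hLg]; linarith
  have hmain : |cntN N - ∑ b ∈ Finset.Icc 1 N, (2 * b).totient / (2 * b : ℝ) ^ 2 * AbN b N| ≤
      3 * N * (C * (Q : ℝ) ^ δ) ^ 2 * Lg ^ 2 * (2 * √(Q : ℝ) * Lg ^ 2) := by
    unfold cntN
    rw [← Finset.sum_sub_distrib]
    refine (Finset.abs_sum_le_sum_abs _ _).trans ?_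
    refine le_trans (Finset.sum_le_sum (g := fun b => 3 * N * (C * (Q : ℝ) ^ δ) ^ 2 * Lg ^ 2 *
      (√((s b ^ 2 * t b ^ 3 : ℕ) : ℝ) / √((2 * b : ℕ) : ℝ))) fun b hb => ?_) ?_
    · refine (hE b hb).trans ?_
      rw [Finset.mem_Icc] at hb
      have h1 := hC (2 * b) (by omega)
      have h2 : ((2 * b : ℕ) : ℝ) ^ δ ≤ (Q : ℝ) ^ δ := by
        apply Real.rpow_le_rpow (by positivity) _ hδ0.le
        exact_mod_cast (by omega : 2 * b ≤ Q)
      have h3 : ((2 * b).divisors.card : ℝ) ≤ C * (Q : ℝ) ^ δ := h1.trans (by gcongr)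
      gcongr
    · rw [← Finset.mul_sum]
      gcongr
  refine hmain.trans ?_
  have hl := log_le_pow δ hδ0 Q hQ1
  rw [← hLg] at hl
  have hN2 : (N : ℝ) ≤ Q := by exact_mod_cast (by omega : N ≤ Q)
  calc _ = 3 * C ^ 2 * 2 * (N * √(Q : ℝ)) * ((Q : ℝ) ^ δ) ^ 2 * Lg ^ 4 := by ring
    _ ≤ 3 * C ^ 2 * 2 * (Q * √(Q : ℝ)) * ((Q : ℝ) ^ δ) ^ 2 * ((2 + 1 / δ) * (Q : ℝ) ^ δ) ^ 4 := by gcongr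
    _ = 3 * C ^ 2 * 2 * (2 + 1 / δ) ^ 4 * (Q * √(Q : ℝ) * ((Q : ℝ) ^ δ) ^ 6) := by ring
    _ = 3 * C ^ 2 * 2 * (2 + 1 / δ) ^ 4 * (Q : ℝ) ^ (3 / 2 + ε) := by
        congr 1
        rw [Real.sqrt_eq_rpow, ← Real.rpow_natCast, ← Real.rpow_mul hQ0.le, ← Real.rpow_one_add' hQ0.le (by norm_num),
          ← Real.rpow_add hQ0]
        congr 1
        rw [hδ]; push_cast; ring
    _ = _ := by
        rw [hQ]; push_cast
        rw [Real.mul_rpow (by norm_num) hN0.le]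
        ring

end

section

/-- coefficients `μ(e)/e` at odd `e` -/
noncomputable def codd (e : ℕ) : ℝ := if Odd e then (ArithmeticFunction.moebius e : ℝ) / e else 0

theorem totient_moebius (m : ℕ) (hm : 0 < m) :
    (m.totient : ℝ) / m = ∑ e ∈ m.divisors, (ArithmeticFunction.moebius e : ℝ) / e := by
  have h := (ArithmeticFunction.sum_eq_iff_sum_mul_moebius_eq (R := ℝ) (f := fun n => (n.totient : ℝ))
    (g := fun n => (n : ℝ))).1 (fun n _ => by exact_mod_cast Nat.sum_totient n) m hm
  rw [← h, Nat.sum_divisorsAntidiagonal (f := fun x y => (ArithmeticFunction.moebius x : ℝ) * (y : ℝ)), Finset.sum_div]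
  refine Finset.sum_congr rfl fun e he => ?_
  have hd := Nat.dvd_of_mem_divisors he
  have he0 : (e : ℝ) ≠ 0 := by exact_mod_cast (Nat.pos_of_mem_divisors he).ne'
  have hm0 : (m : ℝ) ≠ 0 := by exact_mod_cast hm.ne'
  rw [Nat.cast_div hd he0]
  field_simp

theorem totient_two_mul (b : ℕ) (hb : 0 < b) :
    ((2 * b).totient : ℝ) / b = ∑ e ∈ b.divisors, codd e := by
  obtain ⟨k, m, hm, rfl⟩ := Nat.exists_eq_two_pow_mul_odd hb.ne'
  have hm0 : 0 < m := hm.pos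
  have e1 : (2 * (2 ^ k * m)).totient = 2 ^ k * m.totient := by
    rw [← mul_assoc, ← pow_succ', Nat.totient_mul]
    · rw [Nat.totient_prime_pow_succ Nat.prime_two]; simp
    · exact Nat.Coprime.pow_left _ (Nat.coprime_two_left.2 hm)
  rw [e1]
  push_cast
  rw [mul_div_mul_left _ _ (by positivity), totient_moebius m hm0]
  unfold codd
  rw [← Finset.sum_filter]
  refine Finset.sum_congr ?_ fun _ _ => rfl
  ext e
  simp only [Nat.mem_divisors, Finset.mem_filter]
  constructor
  · rintro ⟨h, _⟩
    exact ⟨⟨h.mul_left _, by positivity⟩, hm.of_dvd_nat h⟩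
  · rintro ⟨⟨h, _⟩, ho⟩
    refine ⟨?_, hm0.ne'⟩
    exact Nat.Coprime.dvd_of_dvd_mul_left (Nat.Coprime.pow_right _ (Nat.coprime_two_right.2 ho)) h

theorem abs_codd (e : ℕ) : |codd e| ≤ 1 / e := by
  unfold codd
  split_ifs
  · rw [abs_div, Nat.abs_cast]
    gcongr
    have := ArithmeticFunction.abs_moebius_le_one (n := e)
    exact_mod_cast this
  · simp

theorem summ_mu : Summable fun n : ℕ => (ArithmeticFunction.moebius n : ℝ) / (n : ℝ) ^ 2 := by
  refine Summable.of_norm_bounded (g := fun n : ℕ => 1 / (n : ℝ) ^ 2) (Real.summable_one_div_nat_pow.2 (by norm_num)) fun n => ?_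
  rw [norm_div, Real.norm_eq_abs, Real.norm_eq_abs, abs_of_nonneg (a := (n : ℝ) ^ 2) (by positivity)]
  gcongr
  have := ArithmeticFunction.abs_moebius_le_one (n := n)
  exact_mod_cast this

theorem tsum_mu : ∑' n : ℕ, (ArithmeticFunction.moebius n : ℝ) / (n : ℝ) ^ 2 = 6 / Real.pi ^ 2 := by
  have h := ArithmeticFunction.LSeries_zeta_mul_Lseries_moebius (s := 2) (by norm_num)
  rw [ArithmeticFunction.LSeries_zeta_eq_riemannZeta (by norm_num), riemannZeta_two] at h
  have h2 : LSeries (fun n => ((ArithmeticFunction.moebius n : ℤ) : ℂ)) 2 =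
      ((∑' n : ℕ, (ArithmeticFunction.moebius n : ℝ) / (n : ℝ) ^ 2 : ℝ) : ℂ) := by
    rw [LSeries, Complex.ofReal_tsum]
    refine tsum_congr fun n => ?_
    rw [LSeries.term_def]
    split_ifs with h0
    · simp [h0]
    · push_cast
      norm_cast
  rw [h2] at h
  have h3 : Real.pi ^ 2 / 6 * (∑' n : ℕ, (ArithmeticFunction.moebius n : ℝ) / (n : ℝ) ^ 2) = 1 := by
    exact_mod_cast h
  have hp := Real.pi_pos
  field_simp at h3 ⊢
  linarith

theorem hasSum_codd : HasSum (fun n : ℕ => codd n / n) (8 / Real.pi ^ 2) := by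
  have hs := summ_mu
  set f := fun n : ℕ => (ArithmeticFunction.moebius n : ℝ) / (n : ℝ) ^ 2 with hf
  have hE : Summable fun k : ℕ => f (2 * k) := hs.comp_injective (fun a b h => by simpa using h)
  have hO : Summable fun k : ℕ => f (2 * k + 1) := hs.comp_injective (fun a b h => by simpa using h)
  have h1 := tsum_even_add_odd hE hO
  rw [tsum_mu] at h1
  have hcO : ∀ k : ℕ, codd (2 * k + 1) / ((2 * k + 1 : ℕ) : ℝ) = f (2 * k + 1) := fun k => by
    rw [codd, if_pos ⟨k, rfl⟩, hf]; dsimp only; rw [div_div, sq]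
  have hcE : ∀ k : ℕ, codd (2 * k) / ((2 * k : ℕ) : ℝ) = 0 := fun k => by
    rw [codd, if_neg (by simp), zero_div]
  have hc : HasSum (fun n : ℕ => codd n / n) (∑' k, f (2 * k + 1)) := by
    have := HasSum.even_add_odd (f := fun n : ℕ => codd n / n) (m := 0) (m' := ∑' k, f (2 * k + 1))
      (by simp_rw [hcE]; exact hasSum_zero) (by simp_rw [hcO]; exact hO.hasSum)
    simpa using this
  have hEc : ∀ k : ℕ, f (2 * k) = -(1 / 4) * (codd k / k) := fun k => by
    rw [hf, codd]
    dsimp only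
    split_ifs with h
    · rw [ArithmeticFunction.isMultiplicative_moebius.map_mul_of_coprime (Nat.coprime_two_left.2 h)]
      rw [ArithmeticFunction.moebius_apply_prime Nat.prime_two]
      push_cast
      have : (k : ℝ) ≠ 0 := by exact_mod_cast h.pos.ne'
      field_simp; norm_num
    · have h2 : ¬ Squarefree (2 * k) := by
        intro hsq
        obtain ⟨j, rfl⟩ := (Nat.not_odd_iff_even.1 h)
        have := hsq 2 ⟨j, by ring⟩
        norm_num at this
      rw [ArithmeticFunction.moebius_eq_zero_of_not_squarefree h2]
      simp
  have h2 : ∑' k, f (2 * k) = -(1 / 4) * ∑' k, f (2 * k + 1) := by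
    simp_rw [hEc]
    rw [tsum_mul_left, hc.tsum_eq]
  rw [h2] at h1
  have : ∑' k, f (2 * k + 1) = 8 / Real.pi ^ 2 := by
    have e : (8 : ℝ) / Real.pi ^ 2 = 4 / 3 * (6 / Real.pi ^ 2) := by ring
    rw [e, ← h1]; ring
  rwa [this] at hc

theorem codd_tail (N : ℕ) (hN : 0 < N) : |∑ e ∈ Finset.Icc 1 N, codd e / e - 8 / Real.pi ^ 2| ≤ 1 / (N : ℝ) := by
  have ht := hasSum_codd.tendsto_sum_nat
  have key : ∀ n : ℕ, N < n → |∑ e ∈ Finset.Icc 1 N, codd e / e - ∑ e ∈ Finset.range n, codd e / e| ≤ 1 / (N : ℝ) := by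
    intro n hn
    have hsub : Finset.Icc 1 N ⊆ Finset.range n := fun x hx => by
      rw [Finset.mem_Icc] at hx; rw [Finset.mem_range]; omega
    rw [← Finset.sum_sdiff hsub, abs_sub_comm, add_sub_cancel_right]
    refine (Finset.abs_sum_le_sum_abs _ _).trans ?_
    calc _ ≤ ∑ e ∈ Finset.range n \ Finset.Icc 1 N, ((e : ℝ) ^ 2)⁻¹ := by
          refine Finset.sum_le_sum fun e _ => ?_
          rw [abs_div, Nat.abs_cast, sq, mul_inv, ← div_eq_mul_inv, ← one_div]
          gcongr
          exact abs_codd e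
      _ ≤ ∑ e ∈ insert 0 (Finset.Ioc N n), ((e : ℝ) ^ 2)⁻¹ := by
          refine Finset.sum_le_sum_of_subset_of_nonneg (fun x hx => ?_) fun _ _ _ => by positivity
          simp only [Finset.mem_sdiff, Finset.mem_range, Finset.mem_Icc, Finset.mem_insert, Finset.mem_Ioc] at hx ⊢
          omega
      _ = ∑ e ∈ Finset.Ioc N n, ((e : ℝ) ^ 2)⁻¹ := by
          rw [Finset.sum_insert (by simp)]; simp
      _ ≤ (N : ℝ)⁻¹ - (n : ℝ)⁻¹ := sum_Ioc_inv_sq_le_sub hN.ne' hn.le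
      _ ≤ 1 / N := by
          have : 0 ≤ (n : ℝ)⁻¹ := by positivity
          rw [one_div]; linarith
  refine le_of_tendsto (((tendsto_const_nhds.sub ht)).abs) ?_
  filter_upwards [Filter.eventually_gt_atTop N] with n hn using key n hn

/-- the weight function -/
noncomputable def Hf (N x : ℝ) : ℝ :=
  if x ≤ N / 2 then (N - 3 * x / 2) / 4 else if x ≤ N then (N - x) ^ 2 / (8 * x) else 0

theorem Hf_nonneg (N x : ℝ) (hN : 0 < N) : 0 ≤ Hf N x := by
  unfold Hf
  split_ifs with h1 h2
  · linarith
  · push Not at h1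
    have : 0 < x := by linarith
    positivity
  · exact le_rfl

theorem Hf_anti (N : ℝ) (hN : 0 < N) : Antitone (Hf N) := by
  intro x y hxy
  unfold Hf
  by_cases h1 : y ≤ N / 2
  · rw [if_pos h1, if_pos (hxy.trans h1)]; linarith
  rw [if_neg h1]
  by_cases h2 : y ≤ N
  · rw [if_pos h2]
    push Not at h1
    have hy : 0 < y := by linarith
    by_cases h3 : x ≤ N / 2
    · rw [if_pos h3, div_le_iff₀ (by positivity)]
      nlinarith
    · rw [if_neg h3, if_pos (hxy.trans h2)]
      have hx : 0 < x := by linarith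
      have e1 : (N - y) ^ 2 ≤ (N - x) ^ 2 := by nlinarith
      gcongr
  · rw [if_neg h2]
    have := Hf_nonneg N x hN
    rwa [Hf] at this

theorem Hf_integral (N M : ℝ) (hN : 0 < N) (hM : N ≤ M) : ∫ x in (0 : ℝ)..M, Hf N x = N ^ 2 * Real.log 2 / 8 := by
  have hi : ∀ a b, IntervalIntegrable (Hf N) MeasureTheory.volume a b := fun a b =>
    (Hf_anti N hN).intervalIntegrable
  rw [← intervalIntegral.integral_add_adjacent_intervals (hi 0 (N / 2)) (hi (N / 2) M),
    ← intervalIntegral.integral_add_adjacent_intervals (hi (N / 2) N) (hi N M)]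
  have e1 : ∫ x in (0 : ℝ)..(N / 2), Hf N x = ∫ x in (0 : ℝ)..(N / 2), (N / 4 - 3 / 8 * x) := by
    refine intervalIntegral.integral_congr fun x hx => ?_
    rw [Set.uIcc_of_le (by linarith)] at hx
    simp only [Hf, if_pos hx.2]
    ring
  have e2 : ∫ x in (N / 2)..N, Hf N x = ∫ x in (N / 2)..N, (N ^ 2 / 8 * x⁻¹ - N / 4 + 1 / 8 * x) := by
    refine intervalIntegral.integral_congr fun x hx => ?_
    rw [Set.uIcc_of_le (by linarith)] at hx
    have hx0 : 0 < x := by linarith [hx.1]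
    simp only [Hf, if_pos hx.2]
    split_ifs with h
    · have : x = N / 2 := le_antisymm h hx.1
      subst this
      field_simp; ring
    · field_simp; ring
  have e3 : ∫ x in N..M, Hf N x = ∫ x in N..M, (0 : ℝ) := by
    refine intervalIntegral.integral_congr fun x hx => ?_
    rw [Set.uIcc_of_le hM] at hx
    simp only [Hf]
    rw [if_neg (by linarith [hx.1])]
    split_ifs with h
    · have : x = N := le_antisymm h hx.1
      subst this; simp
    · rfl
  have h0 : (0 : ℝ) ∉ Set.uIcc (N / 2) N := by
    rw [Set.uIcc_of_le (by linarith)]; intro h; linarith [h.1]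
  have hinv : IntervalIntegrable (fun x : ℝ => x⁻¹) MeasureTheory.volume (N / 2) N :=
    intervalIntegral.intervalIntegrable_inv (fun x hx hx0 => h0 (hx0 ▸ hx)) continuousOn_id
  rw [e1, e2, e3, intervalIntegral.integral_sub (by simp) (by apply Continuous.intervalIntegrable; fun_prop),
    intervalIntegral.integral_add ((hinv.const_mul _).sub (by simp)) (by apply Continuous.intervalIntegrable; fun_prop),
    intervalIntegral.integral_sub (hinv.const_mul _) (by simp)]
  have hid : ∀ c a b : ℝ, ∫ x in a..b, c * x = c * ((b ^ 2 - a ^ 2) / 2) := fun c a b => by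
    rw [intervalIntegral.integral_const_mul (f := fun x => x), integral_id]
  rw [hid, hid]
  simp only [intervalIntegral.integral_const_mul, integral_inv h0, integral_id, intervalIntegral.integral_const]
  have : N / (N / 2) = 2 := by field_simp
  rw [this]
  simp only [smul_eq_mul]
  ring

theorem Hf_sum (N e : ℕ) (hN : 0 < N) (he : 0 < e) :
    |∑ k ∈ Finset.Icc 1 N, Hf N ((e : ℝ) * k) - (N : ℝ) ^ 2 * Real.log 2 / 8 / e| ≤ (N : ℝ) / 4 := by
  have hN0 : (0 : ℝ) < N := by exact_mod_cast hN
  have he0 : (0 : ℝ) < e := by exact_mod_cast he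
  have he1 : (1 : ℝ) ≤ e := by exact_mod_cast he
  have ha : Antitone fun x : ℝ => Hf N (e * x) := fun x y h => Hf_anti N hN0 (by gcongr)
  have h1 := AntitoneOn.sum_le_integral (x₀ := 0) (a := N) (ha.antitoneOn _)
  have h2 := AntitoneOn.integral_le_sum (x₀ := 0) (a := N) (ha.antitoneOn _)
  simp only [zero_add] at h1 h2
  have hI : ∫ x in (0 : ℝ)..N, Hf N (e * x) = (N : ℝ) ^ 2 * Real.log 2 / 8 / e := by
    rw [intervalIntegral.integral_comp_mul_left _ he0.ne', mul_zero, Hf_integral N _ hN0 (by nlinarith), smul_eq_mul]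
    ring
  rw [hI] at h1 h2
  have e1 : ∑ i ∈ Finset.range N, Hf N ((e : ℝ) * ((i + 1 : ℕ) : ℝ)) = ∑ k ∈ Finset.Icc 1 N, Hf N ((e : ℝ) * k) := by
    rw [Finset.range_eq_Ico, Finset.sum_Ico_add' (fun k : ℕ => Hf N ((e : ℝ) * k)) 0 N 1]
    rfl
  have e2 : ∑ i ∈ Finset.range N, Hf N ((e : ℝ) * i) + Hf N (e * (N : ℕ)) =
      ∑ i ∈ Finset.range N, Hf N ((e : ℝ) * ((i + 1 : ℕ) : ℝ)) + Hf N (e * (0 : ℕ)) := by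
    rw [← Finset.sum_range_succ (fun i : ℕ => Hf N ((e : ℝ) * i)), Finset.sum_range_succ' (fun i : ℕ => Hf N ((e : ℝ) * i))]
  have e3 : Hf N ((e : ℝ) * (0 : ℕ)) = N / 4 := by
    simp only [Hf, Nat.cast_zero, mul_zero]
    rw [if_pos (by positivity)]; ring
  have e4 := Hf_nonneg N (e * (N : ℕ)) hN0
  rw [e1] at h1 e2
  rw [e3] at e2
  rw [abs_le]
  constructor <;> linarith

end

section

theorem Ab_eq (b N : ℕ) (hb : 0 < b) (hbN : b ≤ N) : |AbN b N / (4 * b) - Hf N b| ≤ 1 / 8 := by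
  have hb0 : (0 : ℝ) < b := by exact_mod_cast hb
  have hbN' : (b : ℝ) ≤ N := by exact_mod_cast hbN
  have hs : ∀ D : ℕ, ∑ d ∈ Finset.Ioc 0 D, ((N : ℝ) - d - b) = D * (N - b) - D * (D + 1) / 2 := by
    intro D
    induction D with
    | zero => simp
    | succ D ih =>
      rw [← Finset.insert_Ioc_right_eq_Ioc_add_one (by omega), Finset.sum_insert (by simp), ih]
      push_cast; ring
  unfold AbN
  rw [hs]
  rcases le_or_gt (2 * b) N with h | h
  · rw [min_eq_left (by omega), Hf, if_pos (by
      have : (2 * b : ℝ) ≤ N := by exact_mod_cast h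
      linarith)]
    have : ((b : ℝ) * (N - b) - b * (b + 1) / 2) / (4 * b) - ((N : ℝ) - 3 * b / 2) / 4 = -1 / 8 := by
      field_simp; ring
    rw [this]; norm_num [abs_le]
  · have h' : (N : ℝ) < 2 * b := by exact_mod_cast h
    rw [min_eq_right (by omega), Hf, if_neg (by linarith), if_pos hbN', Nat.cast_sub hbN]
    have : (((N : ℝ) - b) * (N - b) - (N - b) * (N - b + 1) / 2) / (4 * b) - (N - b : ℝ) ^ 2 / (8 * b) = -((N - b) / (8 * b)) := by
      field_simp; ring
    rw [this, abs_neg, abs_of_nonneg (by apply div_nonneg <;> linarith), div_le_div_iff₀ (by positivity) (by norm_num)]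
    linarith

theorem sum_swap (N : ℕ) (hN : 0 < N) : ∑ b ∈ Finset.Icc 1 N, (∑ e ∈ b.divisors, codd e) * Hf N b =
    ∑ e ∈ Finset.Icc 1 N, codd e * ∑ k ∈ Finset.Icc 1 N, Hf N ((e : ℝ) * k) := by
  have hN0 : (0 : ℝ) < N := by exact_mod_cast hN
  have h1 : ∀ b ∈ Finset.Icc 1 N, (∑ e ∈ b.divisors, codd e) * Hf N b =
      ∑ e ∈ Finset.Icc 1 N, if e ∣ b then codd e * Hf N b else 0 := by
    intro b hb
    rw [Finset.mem_Icc] at hb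
    rw [← Finset.sum_filter, Finset.sum_mul]
    refine Finset.sum_congr ?_ fun _ _ => rfl
    ext e
    simp only [Nat.mem_divisors, Finset.mem_filter, Finset.mem_Icc]
    constructor
    · rintro ⟨h, _⟩
      have := Nat.le_of_dvd (by omega) h
      have := Nat.pos_of_dvd_of_pos h (by omega)
      exact ⟨⟨by omega, by omega⟩, h⟩
    · rintro ⟨_, h⟩
      exact ⟨h, by omega⟩
  rw [Finset.sum_congr rfl h1, Finset.sum_comm]
  refine Finset.sum_congr rfl fun e he => ?_
  rw [Finset.mem_Icc] at he
  rw [← Finset.sum_filter, ← Finset.mul_sum]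
  congr 1
  have h2 : (Finset.Icc 1 N).filter (e ∣ ·) = ((Finset.Icc 1 N).filter fun k => e * k ≤ N).image (e * ·) := by
    ext b
    simp only [Finset.mem_filter, Finset.mem_Icc, Finset.mem_image]
    constructor
    · rintro ⟨hb, k, rfl⟩
      have : 0 < k := Nat.pos_of_ne_zero (by rintro rfl; omega)
      have := Nat.le_mul_of_pos_left k (by omega : 0 < e)
      exact ⟨k, ⟨⟨by omega, by omega⟩, hb.2⟩, rfl⟩
    · rintro ⟨k, ⟨hk, h⟩, rfl⟩
      exact ⟨⟨Nat.mul_pos (by omega) (by omega), h⟩, dvd_mul_right _ _⟩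
  rw [h2, Finset.sum_image (fun x _ y _ h => by simpa [show e ≠ 0 by omega] using h), Finset.sum_filter]
  refine Finset.sum_congr rfl fun k _ => ?_
  split_ifs with h
  · push_cast; rfl
  · have h3 : (N : ℝ) < e * k := by push Not at h; exact_mod_cast h
    rw [Hf, if_neg (by linarith), if_neg (by linarith)]

theorem main_term (N : ℕ) (hN : 0 < N) :
    |∑ b ∈ Finset.Icc 1 N, (2 * b).totient / (2 * b : ℝ) ^ 2 * AbN b N - (N : ℝ) ^ 2 * Real.log 2 / Real.pi ^ 2| ≤
      N * (2 + Real.log N) := by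
  have hN0 : (0 : ℝ) < N := by exact_mod_cast hN
  have hl2 : Real.log 2 ≤ 1 := by have := Real.log_two_lt_d9; linarith
  have hl20 : 0 ≤ Real.log 2 := Real.log_nonneg (by norm_num)
  have h1 : |∑ b ∈ Finset.Icc 1 N, (2 * b).totient / (2 * b : ℝ) ^ 2 * AbN b N -
      ∑ b ∈ Finset.Icc 1 N, (∑ e ∈ b.divisors, codd e) * Hf N b| ≤ N * (1 / 4) := by
    rw [← Finset.sum_sub_distrib]
    refine (Finset.abs_sum_le_sum_abs _ _).trans ?_
    refine (Finset.sum_le_sum (g := fun _ => (1 : ℝ) / 4) fun b hb => ?_).trans (by simp)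
    rw [Finset.mem_Icc] at hb
    have hb0 : (0 : ℝ) < b := by exact_mod_cast (by omega : 0 < b)
    rw [← totient_two_mul b (by omega)]
    have e : (2 * b).totient / (2 * b : ℝ) ^ 2 * AbN b N - (2 * b).totient / (b : ℝ) * Hf N b =
        (2 * b).totient / (b : ℝ) * (AbN b N / (4 * b) - Hf N b) := by
      field_simp; ring
    rw [e, abs_mul]
    have e1 : ((2 * b).totient : ℝ) ≤ 2 * b := by exact_mod_cast Nat.totient_le _
    have e2 : ((2 * b).totient : ℝ) / b ≤ 2 := by rw [div_le_iff₀ hb0]; exact e1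
    rw [abs_of_nonneg (a := ((2 * b).totient : ℝ) / b) (by positivity)]
    calc _ ≤ 2 * (1 / 8 : ℝ) := by
          gcongr
          exact Ab_eq b N (by omega) hb.2
      _ = _ := by norm_num
  rw [sum_swap N hN] at h1
  have h2 : |∑ e ∈ Finset.Icc 1 N, codd e * ∑ k ∈ Finset.Icc 1 N, Hf N ((e : ℝ) * k) -
      (N : ℝ) ^ 2 * Real.log 2 / 8 * ∑ e ∈ Finset.Icc 1 N, codd e / e| ≤ N / 4 * (1 + Real.log N) := by
    rw [Finset.mul_sum, ← Finset.sum_sub_distrib]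
    refine (Finset.abs_sum_le_sum_abs _ _).trans ?_
    refine le_trans (Finset.sum_le_sum (g := fun e : ℕ => (N : ℝ) / 4 * (1 / (e : ℝ))) fun e he => ?_) ?_
    · rw [Finset.mem_Icc] at he
      have : codd e * ∑ k ∈ Finset.Icc 1 N, Hf N ((e : ℝ) * k) - (N : ℝ) ^ 2 * Real.log 2 / 8 * (codd e / e) =
        codd e * (∑ k ∈ Finset.Icc 1 N, Hf N ((e : ℝ) * k) - (N : ℝ) ^ 2 * Real.log 2 / 8 / e) := by ring
      rw [this, abs_mul, mul_comm]
      gcongr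
      · exact Hf_sum N e hN (by omega)
      · exact abs_codd e
    · rw [← Finset.mul_sum]
      gcongr
      exact sum_inv N
  have h3 : |(N : ℝ) ^ 2 * Real.log 2 / 8 * ∑ e ∈ Finset.Icc 1 N, codd e / e - (N : ℝ) ^ 2 * Real.log 2 / Real.pi ^ 2| ≤ (N : ℝ) / 8 := by
    have : (N : ℝ) ^ 2 * Real.log 2 / 8 * ∑ e ∈ Finset.Icc 1 N, codd e / e - (N : ℝ) ^ 2 * Real.log 2 / Real.pi ^ 2 =
      (N : ℝ) ^ 2 * Real.log 2 / 8 * (∑ e ∈ Finset.Icc 1 N, codd e / e - 8 / Real.pi ^ 2) := by ring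
    rw [this, abs_mul, abs_of_nonneg (a := (N : ℝ) ^ 2 * Real.log 2 / 8) (by positivity)]
    calc _ ≤ (N : ℝ) ^ 2 * 1 / 8 * (1 / N) := by
          gcongr
          exact codd_tail N hN
      _ = N / 8 := by field_simp
  have hlog : 0 ≤ Real.log N := Real.log_nonneg (by exact_mod_cast hN)
  have hNl : 0 ≤ N * Real.log N := by positivity
  rw [abs_le] at h1 h2 h3 ⊢
  constructor <;> nlinarith

theorem cnt_asymp (ε : ℝ) (hε : 0 < ε) : ∃ C : ℝ, 0 < C ∧ ∀ N : ℕ, 0 < N →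
    |cntN N - (N : ℝ) ^ 2 * Real.log 2 / Real.pi ^ 2| ≤ C * (N : ℝ) ^ (3 / 2 + ε) := by
  obtain ⟨C, hC, h⟩ := cnt_error ε hε
  refine ⟨C + (2 + 1 / (1 / 2)), by positivity, fun N hN => ?_⟩
  have h1 := h N hN
  have h2 := main_term N hN
  have hN1 : (1 : ℝ) ≤ N := by exact_mod_cast hN
  have h3 := log_le_pow (1 / 2) (by norm_num) N hN1
  have h4 : (N : ℝ) * (2 + Real.log N) ≤ (2 + 1 / (1 / 2)) * (N : ℝ) ^ (3 / 2 + ε) := by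
    calc _ ≤ (N : ℝ) * ((2 + 1 / (1 / 2)) * (N : ℝ) ^ (1 / 2 : ℝ)) := by gcongr
      _ = (2 + 1 / (1 / 2)) * (N : ℝ) ^ (3 / 2 : ℝ) := by
          rw [show (3 / 2 : ℝ) = 1 + 1 / 2 by norm_num, Real.rpow_add (by linarith), Real.rpow_one]; ring
      _ ≤ _ := by
          gcongr
          linarith
  have := abs_sub_le (cntN N) (∑ b ∈ Finset.Icc 1 N, (2 * b).totient / (2 * b : ℝ) ^ 2 * AbN b N) ((N : ℝ) ^ 2 * Real.log 2 / Real.pi ^ 2)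
  linarith

end

section

/-- the class of integer matrices `(a, b; c, d)` that are products of ECF matrices -/
structure InP (a b c d : ℤ) : Prop where
  hca : c < a
  hd1 : -c < d
  hd2 : d < c
  det : a * d - b * c = 1 ∨ a * d - b * c = -1
  par : (a % 2 = 0 ∧ b % 2 = 1 ∧ c % 2 = 1 ∧ d % 2 = 0) ∨ (a % 2 = 1 ∧ b % 2 = 0 ∧ c % 2 = 0 ∧ d % 2 = 1)

theorem InP.cpos {a b c d : ℤ} (h : InP a b c d) : 0 < c := by
  have := h.hd1; have := h.hd2; omega

theorem InP.b_lt {a b c d : ℤ} (h : InP a b c d) : -a < b ∧ b < a := by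
  have hc := h.cpos
  have h1 := h.hd1; have h2 := h.hd2; have h3 := h.hca
  constructor
  · by_contra hb
    push Not at hb
    rcases h.det with h4 | h4 <;> nlinarith
  · by_contra hb
    push Not at hb
    rcases h.det with h4 | h4 <;> nlinarith

theorem InP.base (a e : ℤ) (ha : 2 ≤ a) (ha2 : a % 2 = 0) (he : e = 1 ∨ e = -1) : InP a e 1 0 := by
  refine ⟨by omega, by omega, by omega, by omega, Or.inl ⟨ha2, by omega, by norm_num, by norm_num⟩⟩

theorem InP.step {a b c d : ℤ} (h : InP a b c d) (x e : ℤ) (hx : 2 ≤ x) (hx2 : x % 2 = 0) (he : e = 1 ∨ e = -1) :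
    InP (x * a + e * c) (x * b + e * d) a b := by
  obtain ⟨hb1, hb2⟩ := h.b_lt
  have hc := h.cpos
  have hca := h.hca
  obtain ⟨y, rfl⟩ : ∃ y, x = 2 * y := ⟨x / 2, by omega⟩
  refine ⟨?_, hb1, hb2, ?_, ?_⟩
  · rcases he with rfl | rfl <;> nlinarith
  · have : (2 * y * a + e * c) * b - (2 * y * b + e * d) * a = -e * (a * d - b * c) := by ring
    rw [this]
    rcases he with rfl | rfl <;> rcases h.det with h4 | h4 <;> rw [h4] <;> norm_num
  · rw [mul_assoc, mul_assoc]
    generalize y * a = z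
    generalize y * b = w
    have := h.par
    rcases he with rfl | rfl <;> omega

/-- descent step -/
theorem InP.descent {a b c d : ℤ} (h : InP a b c d) : ∃ x e : ℤ, 2 ≤ x ∧ x % 2 = 0 ∧ (e = 1 ∨ e = -1) ∧
    ((a = x ∧ b = e ∧ c = 1 ∧ d = 0) ∨ ∃ c' d' : ℤ, InP c d c' d' ∧ c' < c ∧ a = x * c + e * c' ∧ b = x * d + e * d') := by
  have hc := h.cpos
  have h1 := h.hd1; have h2 := h.hd2; have h3 := h.hca
  have hp := h.par
  by_cases hc1 : c = 1
  · have hd : d = 0 := by omega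
    have hdet := h.det
    subst hc1 hd
    refine ⟨a, b, by omega, by omega, by omega, Or.inl ⟨rfl, rfl, rfl, rfl⟩⟩
  · have hc2 : 2 ≤ c := by omega
    set k := (a + c) / (2 * c) with hk
    set s := (a + c) % (2 * c) with hs
    have e0 : 2 * c * k + s = a + c := Int.mul_ediv_add_emod _ _
    have s0 : 0 ≤ s := Int.emod_nonneg _ (by omega)
    have s1 : s < 2 * c := Int.emod_lt_of_pos _ (by omega)
    have hk1 : 1 ≤ k := by
      by_contra hk0
      push Not at hk0
      nlinarith
    have hndvd : ¬ c ∣ a := by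
      rintro ⟨y, rfl⟩
      have : c ∣ 1 := by
        rcases h.det with h4 | h4
        · exact ⟨y * d - b, by linear_combination -h4⟩
        · exact ⟨-(y * d - b), by linear_combination h4⟩
      have := Int.le_of_dvd one_pos this
      omega
    have hr0 : s ≠ c := fun h0 => hndvd ⟨2 * k, by rw [h0] at e0; linear_combination -e0⟩
    have hr1 : s ≠ 0 := fun h0 => hndvd ⟨2 * k - 1, by rw [h0] at e0; linear_combination -e0⟩
    obtain ⟨e, he, c', hc', hc'0, hc'1⟩ : ∃ e : ℤ, (e = 1 ∨ e = -1) ∧ ∃ c', s - c = e * c' ∧ 0 < c' ∧ c' < c := by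
      rcases lt_or_gt_of_ne hr0 with h0 | h0
      · exact ⟨-1, Or.inr rfl, c - s, by ring, by omega, by omega⟩
      · exact ⟨1, Or.inl rfl, s - c, by ring, by omega, by omega⟩
    have hee : e * e = 1 := by rcases he with rfl | rfl <;> norm_num
    have ea : a = 2 * k * c + e * c' := by linear_combination -e0 + hc'
    obtain ⟨d', hd'⟩ : ∃ d', d' = e * (b - 2 * k * d) := ⟨_, rfl⟩
    have eb : b = 2 * k * d + e * d' := by rw [hd']; linear_combination (b - 2 * k * d) * (-hee)
    have hdet' : c * d' - d * c' = 1 ∨ c * d' - d * c' = -1 := by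
      have : a * d - b * c = -e * (c * d' - d * c') := by rw [ea, eb]; ring
      have h4 := h.det
      rw [this] at h4
      rcases he with rfl | rfl <;> omega
    have hpar' : (c % 2 = 0 ∧ d % 2 = 1 ∧ c' % 2 = 1 ∧ d' % 2 = 0) ∨ (c % 2 = 1 ∧ d % 2 = 0 ∧ c' % 2 = 0 ∧ d' % 2 = 1) := by
      rw [ea, eb, mul_assoc, mul_assoc] at hp
      generalize k * c = z at hp
      generalize k * d = w at hp
      rcases he with rfl | rfl <;> omega
    refine ⟨2 * k, e, by omega, by omega, he, Or.inr ⟨c', d', ⟨hc'1, ?_, ?_, by rw [mul_comm d c'] at *; simpa [mul_comm] using hdet', hpar'⟩, hc'1, ea, eb⟩⟩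
    · have hle : -c' ≤ d' := by
        by_contra hb
        push Not at hb
        rcases hdet' with h4 | h4 <;> nlinarith
      have : -c' ≠ d' := by rintro rfl; omega
      omega
    · have hle : d' ≤ c' := by
        by_contra hb
        push Not at hb
        rcases hdet' with h4 | h4 <;> nlinarith
      have : c' ≠ d' := by rintro rfl; omega
      omega

/-- partial products -/
noncomputable def Pn (n : ℕ) (u : ℝ) : Matrix (Fin 2) (Fin 2) ℤ :=
  ((List.range n).map (fun i => Mmat (aE (TE^[i] u)) (eE (TE^[i] u)))).prod

theorem Pn_zero (u : ℝ) : Pn 0 u = 1 := by simp [Pn]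

theorem Pn_succ (n : ℕ) (u : ℝ) : Pn (n + 1) u = Mmat (aE u) (eE u) * Pn n (TE u) := by
  simp only [Pn, List.range_succ_eq_map, List.map_cons, List.map_map, List.prod_cons, Function.iterate_zero, id]
  rfl

theorem Pn_add (m n : ℕ) (u : ℝ) : Pn (m + n) u = Pn m u * Pn n (TE^[m] u) := by
  induction m generalizing u with
  | zero => simp [Pn_zero]
  | succ m ih =>
    rw [show m + 1 + n = (m + n) + 1 by ring, Pn_succ, ih, Pn_succ, mul_assoc, Function.iterate_succ_apply]

theorem digit_spec (u : ℝ) (hu : Irrational u) (h1 : 1 < u) : 2 ≤ aE u ∧ aE u % 2 = 0 ∧ (eE u = 1 ∨ eE u = -1) ∧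
    Irrational (TE u) ∧ 1 < TE u ∧ u * TE u = aE u * TE u + eE u := by
  have hf1 := Int.floor_le ((u + 1) / 2)
  have hf2 := Int.lt_floor_add_one ((u + 1) / 2)
  have hk : 1 ≤ ⌊(u + 1) / 2⌋ := Int.le_floor.2 (by push_cast; linarith)
  have ha : (aE u : ℝ) = 2 * (⌊(u + 1) / 2⌋ : ℝ) := by simp [aE]
  have hne : u - aE u ≠ 0 := sub_ne_zero.2 (hu.ne_int _)
  have he : eE u = 1 ∨ eE u = -1 := by unfold eE; split_ifs <;> simp
  have hlow : (-1 : ℝ) < u - aE u := by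
    have := hu.ne_int (aE u - 1)
    push_cast at this
    refine lt_of_le_of_ne (by linarith) fun h => this (by linarith)
  refine ⟨by unfold aE; omega, by unfold aE; omega, he, ?_, ?_, ?_⟩
  · unfold TE
    have h0 : Irrational (u - aE u) := by exact_mod_cast hu.sub_intCast (aE u)
    rcases he with h | h <;> rw [h]
    · simpa using h0.inv
    · simpa [neg_div] using h0.inv.neg
  · unfold TE eE
    split_ifs with h
    · push_cast
      rw [lt_div_iff₀ (by linarith)]; linarith
    · push_cast
      have : u - aE u < 0 := lt_of_le_of_ne (by linarith) hne
      rw [lt_div_iff_of_neg this]; linarith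
  · unfold TE
    field_simp
    ring

theorem digit_unique (x e : ℤ) (v : ℝ) (hx : 2 ≤ x) (hx2 : x % 2 = 0) (he : e = 1 ∨ e = -1) (hv : Irrational v) (h1 : 1 < v) :
    aE (x + e / v) = x ∧ eE (x + e / v) = e ∧ TE (x + e / v) = v ∧ Irrational (x + e / v) ∧ 1 < (x + e / v : ℝ) := by
  have hv0 : 0 < v := by linarith
  have hi1 : 1 / v < 1 := by rw [div_lt_one hv0]; exact h1
  have hi0 : 0 < 1 / v := by positivity
  have hb : -1 < (e : ℝ) / v ∧ (e : ℝ) / v < 1 := by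
    rcases he with rfl | rfl <;> push_cast
    · constructor <;> linarith
    · rw [neg_div]; constructor <;> linarith
  obtain ⟨y, rfl⟩ : ∃ y, x = 2 * y := ⟨x / 2, by omega⟩
  have hxR : (2 : ℝ) ≤ ((2 * y : ℤ) : ℝ) := by exact_mod_cast hx
  have ha : aE ((2 * y : ℤ) + e / v) = 2 * y := by
    unfold aE
    congr 1
    rw [Int.floor_eq_iff]
    push_cast
    constructor <;> linarith [hb.1, hb.2]
  have hee : eE ((2 * y : ℤ) + e / v) = e := by
    unfold eE
    rw [ha]
    rcases he with rfl | rfl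
    · rw [if_pos (by push_cast; linarith)]
    · rw [if_neg (by push_cast; rw [neg_div]; linarith)]
  refine ⟨ha, hee, ?_, ?_, by linarith [hb.1]⟩
  · unfold TE
    rw [ha, hee]
    have : (e : ℝ) ≠ 0 := by rcases he with rfl | rfl <;> norm_num
    field_simp
    ring_nf
    try field_simp
  · have : Irrational ((e : ℝ) / v) := by
      rcases he with rfl | rfl
      · simpa using hv.inv
      · simpa [neg_div] using hv.inv.neg
    exact this.intCast_add _

end

section

theorem mat_mul (a b c d a' b' c' d' : ℤ) : (!![a, b; c, d] * !![a', b'; c', d'] : Matrix (Fin 2) (Fin 2) ℤ) =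
    !![a * a' + b * c', a * b' + b * d'; c * a' + d * c', c * b' + d * d'] := Matrix.mul_fin_two _ _ _ _ _ _ _ _

/-- existence of ECF expansion from a matrix in the class -/
theorem expand (n : ℕ) : ∀ a b c d : ℤ, InP a b c d → c.toNat = n → ∀ v : ℝ, Irrational v → 1 < v →
    ∃ u : ℝ, Irrational u ∧ 1 < u ∧ u * (c * v + d) = a * v + b ∧ ∃ k : ℕ, 0 < k ∧ Pn k u = !![a, b; c, d] ∧ TE^[k] u = v := by
  induction n using Nat.strong_induction_on with
  | _ n ih =>
    intro a b c d h hn v hv hv1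
    have hv0 : v ≠ 0 := by linarith
    obtain ⟨x, e, hx, hx2, he, h | ⟨c', d', h', hcc, ha, hb⟩⟩ := h.descent
    · obtain ⟨rfl, rfl, rfl, rfl⟩ := h
      obtain ⟨h1, h2, h3, h4, h5⟩ := digit_unique a b v hx hx2 he hv hv1
      refine ⟨_, h4, h5, ?_, 1, one_pos, ?_, h3⟩
      · push_cast; field_simp; ring
      · rw [Pn_succ, Pn_zero, h1, h2, mul_one, Mmat]
    · have hc' := h'.cpos
      obtain ⟨w, hw, hw1, hw2, k, hk, hk1, hk2⟩ := ih c'.toNat (by omega) c d c' d' h' rfl v hv hv1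
      obtain ⟨h1, h2, h3, h4, h5⟩ := digit_unique x e w hx hx2 he hw hw1
      have hw0 : w ≠ 0 := by linarith
      refine ⟨_, h4, h5, ?_, k + 1, by omega, ?_, ?_⟩
      · rw [ha, hb]; push_cast
        field_simp
        linear_combination (-(e : ℝ)) * hw2
      · rw [Pn_succ, h1, h2, h3, hk1, Mmat, mat_mul, ha, hb]
        congr 1 <;> simp
      · rw [Function.iterate_succ_apply, h3, hk2]

/-- partial products lie in the class -/
theorem Pn_spec (n : ℕ) : ∀ u : ℝ, Irrational u → 1 < u →
    ∃ a b c d : ℤ, Pn (n + 1) u = !![a, b; c, d] ∧ InP a b c d ∧ Irrational (TE^[n + 1] u) ∧ 1 < TE^[n + 1] u ∧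
      u * (c * TE^[n + 1] u + d) = a * TE^[n + 1] u + b := by
  induction n with
  | zero =>
    intro u hu h1
    obtain ⟨e1, e2, e3, e4, e5, e6⟩ := digit_spec u hu h1
    refine ⟨aE u, eE u, 1, 0, ?_, InP.base _ _ e1 e2 e3, e4, e5, ?_⟩
    · rw [Pn_succ, Pn_zero, mul_one, Mmat]
    · rw [Function.iterate_one]; push_cast; linear_combination e6
  | succ n ih =>
    intro u hu h1
    obtain ⟨e1, e2, e3, e4, e5, e6⟩ := digit_spec u hu h1
    obtain ⟨a, b, c, d, h1, h2, h3, h4, h5⟩ := ih (TE u) e4 e5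
    refine ⟨_, _, _, _, ?_, h2.step _ _ e1 e2 e3, ?_⟩
    · rw [Pn_succ, h1, Mmat, mat_mul]; congr 1 <;> simp
    · rw [Function.iterate_succ_apply]
      refine ⟨h3, h4, ?_⟩
      set z := TE^[n + 1] (TE u)
      push_cast
      have ht : TE u ≠ 0 := by linarith
      rw [← h5]
      linear_combination (c * z + d) * e6 + (aE u : ℝ) * h5

theorem InP.den_pos {a b c d : ℤ} (h : InP a b c d) (v : ℝ) (hv : 1 < v) : 0 < (c : ℝ) * v + d := by
  have hc : (0 : ℝ) < c := by exact_mod_cast h.cpos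
  have h1 : (-(c : ℝ)) < d := by exact_mod_cast h.hd1
  nlinarith

/-- a matrix in the class mapping `v` to `u` is a partial product -/
theorem expand_fix {a b c d : ℤ} (h : InP a b c d) (u v : ℝ) (hv : Irrational v) (hv1 : 1 < v)
    (huv : u * (c * v + d) = a * v + b) : ∃ k : ℕ, 0 < k ∧ Pn k u = !![a, b; c, d] ∧ TE^[k] u = v := by
  obtain ⟨u', _, _, h3, h4⟩ := expand _ a b c d h rfl v hv hv1
  have : u' = u := mul_right_cancel₀ (h.den_pos v hv1).ne' (h3.trans huv.symm)
  rwa [this] at h4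

theorem perE_eq (u : ℝ) : perE u = Function.minimalPeriod TE u := by
  unfold perE
  by_cases h : ∃ n, 0 < n ∧ TE^[n] u = u
  · have hm : u ∈ Function.periodicPts TE := by
      obtain ⟨n, hn, hu⟩ := h; exact ⟨n, hn, hu⟩
    apply le_antisymm
    · exact Nat.sInf_le ⟨Function.minimalPeriod_pos_of_mem_periodicPts hm, Function.iterate_minimalPeriod⟩
    · obtain ⟨h1, h2⟩ := Nat.sInf_mem (s := {n : ℕ | 0 < n ∧ TE^[n] u = u}) h
      exact Function.IsPeriodicPt.minimalPeriod_le h1 h2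
  · have e : {n : ℕ | 0 < n ∧ TE^[n] u = u} = ∅ := by
      ext n; simp only [Set.mem_setOf_eq, Set.mem_empty_iff_false, iff_false]
      exact fun hn => h ⟨n, hn⟩
    rw [e, Nat.sInf_empty, Function.minimalPeriod_eq_zero_of_notMem_periodicPts]
    rintro ⟨n, hn, hu⟩
    exact h ⟨n, hn, hu⟩

theorem Pn_per_mul (u : ℝ) (k : ℕ) : Pn (perE u * k) u = OmegaE u ^ k := by
  induction k with
  | zero => simp [Pn_zero]
  | succ k ih =>
    rw [Nat.mul_succ, Pn_add, ih, pow_succ]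
    congr 1
    have : TE^[perE u * k] u = u := by
      rw [perE_eq]
      exact (Function.isPeriodicPt_minimalPeriod TE u).mul_const k
    rw [this]; rfl

theorem Pn_per (u : ℝ) (n : ℕ) (h : TE^[n] u = u) : ∃ k, n = perE u * k ∧ Pn n u = OmegaE u ^ k := by
  obtain ⟨k, hk⟩ := Function.IsPeriodicPt.minimalPeriod_dvd (f := TE) (x := u) (n := n) h
  rw [← perE_eq] at hk
  exact ⟨k, hk, by rw [hk, Pn_per_mul]⟩

theorem InP.matdet {a b c d : ℤ} (h : InP a b c d) :
    (!![a, b; c, d] : Matrix (Fin 2) (Fin 2) ℤ).det = 1 ∨ (!![a, b; c, d] : Matrix (Fin 2) (Fin 2) ℤ).det = -1 := by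
  rw [Matrix.det_fin_two_of]; exact h.det

/-- existence of fixing matrices of determinant one implies periodicity and description by `OmegaTildeE` -/
theorem fix_pow {a b c d : ℤ} (h : InP a b c d) (hdet : a * d - b * c = 1) (u : ℝ) (hu : Irrational u) (hu1 : 1 < u)
    (huv : u * (c * u + d) = a * u + b) :
    0 < perE u ∧ ∃ j : ℕ, 0 < j ∧ !![a, b; c, d] = OmegaTildeE u ^ j := by
  obtain ⟨k, hk, hk1, hk2⟩ := expand_fix h u u hu hu1 huv
  obtain ⟨m, hm, hm2⟩ := Pn_per u k hk2
  have hp : 0 < perE u := Nat.pos_of_ne_zero fun h0 => by rw [h0] at hm; omega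
  have hm0 : 0 < m := Nat.pos_of_ne_zero fun h0 => by rw [h0] at hm; omega
  refine ⟨hp, ?_⟩
  rw [hk1] at hm2
  unfold OmegaTildeE
  split_ifs with hd
  · exact ⟨m, hm0, hm2⟩
  · have hd' : (OmegaE u).det = -1 := by
      obtain ⟨q, hq⟩ : ∃ q, perE u = q + 1 := ⟨perE u - 1, by omega⟩
      obtain ⟨a', b', c', d', h1, h2, _⟩ := Pn_spec q u hu hu1
      rw [← hq] at h1
      have h3 : OmegaE u = !![a', b'; c', d'] := h1
      rw [h3] at hd ⊢
      exact h2.matdet.resolve_left hd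
    have h4 : (-1 : ℤ) ^ m = 1 := by
      rw [← hd', ← Matrix.det_pow, ← hm2, Matrix.det_fin_two_of, hdet]
    have h5 : Even m := by
      by_contra ho
      rw [Nat.not_even_iff_odd] at ho
      rw [ho.neg_one_pow] at h4; omega
    obtain ⟨j, rfl⟩ := h5
    exact ⟨j, by omega, by rw [hm2, ← pow_mul]; congr 1; ring⟩

theorem tilde_spec (u : ℝ) (hu : Irrational u) (hu1 : 1 < u) (hp : 0 < perE u) : ∃ a b c d : ℤ,
    OmegaTildeE u = !![a, b; c, d] ∧ InP a b c d ∧ a * d - b * c = 1 ∧ u * (c * u + d) = a * u + b := by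
  obtain ⟨n, hn, hn1, hn2⟩ : ∃ n, 0 < n ∧ OmegaTildeE u = Pn n u ∧ TE^[n] u = u := by
    have hper : TE^[perE u] u = u := by rw [perE_eq]; exact Function.iterate_minimalPeriod
    unfold OmegaTildeE
    split_ifs with h
    · exact ⟨perE u, hp, rfl, hper⟩
    · refine ⟨perE u * 2, by omega, (Pn_per_mul u 2).symm, ?_⟩
      rw [Function.iterate_mul, ]
      exact Function.iterate_fixed hper 2
  obtain ⟨q, rfl⟩ : ∃ q, n = q + 1 := ⟨n - 1, by omega⟩
  obtain ⟨a, b, c, d, h1, h2, _, _, h3⟩ := Pn_spec q u hu hu1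
  rw [hn2] at h3
  refine ⟨a, b, c, d, hn1.trans h1, h2, ?_, h3⟩
  have : (OmegaTildeE u).det = 1 := by
    unfold OmegaTildeE
    split_ifs with hd
    · exact hd
    · obtain ⟨q', hq⟩ : ∃ q, perE u = q + 1 := ⟨perE u - 1, by omega⟩
      obtain ⟨a', b', c', d', h1, h2, _⟩ := Pn_spec q' u hu hu1
      rw [← hq] at h1
      have h3 : OmegaE u = !![a', b'; c', d'] := h1
      rw [h3] at hd ⊢
      rw [Matrix.det_pow, h2.matdet.resolve_left hd]; norm_num
  rw [hn1, h1, Matrix.det_fin_two_of] at this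
  exact this

end

section

/-- matrices attached to the counted quadratic irrationals -/
structure InM (a b c d : ℤ) : Prop where
  det : a * d - b * c = 1
  par : (a % 2 = 0 ∧ b % 2 = 1 ∧ c % 2 = 1 ∧ d % 2 = 0) ∨ (a % 2 = 1 ∧ b % 2 = 0 ∧ c % 2 = 0 ∧ d % 2 = 1)
  d1 : 1 ≤ d
  db : d ≤ b
  ba : b < a

theorem InP.toM {a b c d : ℤ} (h : InP a b c d) (hdet : a * d - b * c = 1) (hb : 0 < b) : InM a b c d := by
  have hc := h.cpos
  have h1 := h.hd1; have h2 := h.hd2; have h3 := h.hca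
  have hbc : 0 < b * c := by positivity
  refine ⟨hdet, h.par, ?_, ?_, h.b_lt.2⟩
  · by_contra hd; push Not at hd; nlinarith
  · by_contra hd; push Not at hd; nlinarith

theorem InM.cgt {a b c d : ℤ} (h : InM a b c d) : d < c := by
  have h1 := h.d1; have h2 := h.db; have h3 := h.ba; have h4 := h.det; have h5 := h.par
  have : d ≤ c := by
    by_contra hc; push Not at hc; nlinarith
  rcases this.lt_or_eq with h | h
  · exact h
  · subst h; omega

theorem InM.toP {a b c d : ℤ} (h : InM a b c d) : InP a b c d := by
  have h0 := h.cgt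
  have h1 := h.d1; have h2 := h.db; have h3 := h.ba; have h4 := h.det; have h5 := h.par
  refine ⟨?_, by omega, h0, Or.inl h4, h5⟩
  by_contra hc; push Not at hc; nlinarith

theorem toP_of_ineq {a b c d : ℤ} (hdet : a * d - b * c = 1)
    (par : (a % 2 = 0 ∧ b % 2 = 1 ∧ c % 2 = 1 ∧ d % 2 = 0) ∨ (a % 2 = 1 ∧ b % 2 = 0 ∧ c % 2 = 0 ∧ d % 2 = 1))
    (hb : 0 < b) (hc : 0 < c) (ht : 0 < a + d) (h1 : c + d < a + b) (h2 : b + d < a + c) : InP a b c d := by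
  have hbc : 0 < b * c := by positivity
  have had : 0 < a * d := by linarith
  have ha : 0 < a := by
    by_contra h; push Not at h
    have : 0 < d := by omega
    nlinarith
  have hd : 0 < d := by
    by_contra h; push Not at h; nlinarith
  have hca : c < a := by
    by_contra h; push Not at h
    have : b < d := by
      by_contra h'; push Not at h'; nlinarith
    omega
  refine ⟨hca, by omega, ?_, Or.inl hdet, par⟩
  have : d ≤ c := by
    by_contra h; push Not at h
    have hba : b < a := by omega
    nlinarith
  rcases this.lt_or_eq with h | h
  · exact h
  · subst h; omega

theorem irr_lin {ω : ℝ} (hω : Irrational ω) (p q : ℤ) (h : (p : ℝ) * ω + q = 0) : p = 0 ∧ q = 0 := by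
  have hp : p = 0 := by
    by_contra hp
    have hp' : (p : ℝ) ≠ 0 := by exact_mod_cast hp
    apply hω
    refine ⟨-q / p, ?_⟩
    push_cast
    rw [div_eq_iff hp']; linarith
  subst hp
  refine ⟨rfl, ?_⟩
  simpa using h

/-- the set of quadratic irrationals being counted -/
def WW (ω : ℝ) : Prop := 1 < ω ∧ ∃ ω' : ℝ, IsConjPair ω ω' ∧ -1 < ω' ∧ ω' < 0

theorem WW_poly {ω : ℝ} (h : WW ω) : Irrational ω ∧ ∃ A B C : ℤ, 0 < A ∧ (A : ℝ) * ω ^ 2 + B * ω + C = 0 ∧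
    A + B + C < 0 ∧ 0 < A - B + C ∧ C < 0 := by
  obtain ⟨h1, ω', ⟨hi, A, B, C, hA, _, e1, e2, hne⟩, h2, h3⟩ := h
  have hA' : (0 : ℝ) < A := by exact_mod_cast hA
  have hB : (A : ℝ) * (ω + ω') + B = 0 := by
    have : (ω' - ω) * ((A : ℝ) * (ω + ω') + B) = 0 := by linear_combination e2 - e1
    rcases mul_eq_zero.1 this with h | h
    · exact absurd (sub_eq_zero.1 h) hne
    · exact h
  have hB' : (B : ℝ) = -(A * (ω + ω')) := by linarith
  have hC : (C : ℝ) = A * (ω * ω') := by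
    rw [hB'] at e1; linear_combination e1
  refine ⟨hi, A, B, C, hA, e1, ?_, ?_, ?_⟩
  · have : ((A + B + C : ℤ) : ℝ) < 0 := by
      push_cast; rw [hB', hC]
      have : (A : ℝ) * ((ω - 1) * (1 - ω')) > 0 := by apply mul_pos hA'; apply mul_pos <;> linarith
      nlinarith
    exact_mod_cast this
  · have : (0 : ℝ) < ((A - B + C : ℤ) : ℝ) := by
      push_cast; rw [hB', hC]
      have : (A : ℝ) * ((ω + 1) * (1 + ω')) > 0 := by apply mul_pos hA'; apply mul_pos <;> linarith
      nlinarith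
    exact_mod_cast this
  · have : (C : ℝ) < 0 := by
      rw [hC]
      have : (A : ℝ) * (ω * (-ω')) > 0 := by apply mul_pos hA'; apply mul_pos <;> linarith
      nlinarith
    exact_mod_cast this

theorem WW_per {ω : ℝ} (h : WW ω) : 0 < perE ω := by
  have h1 := h.1
  obtain ⟨hi, A, B, C, hA, e1, i1, i2, i3⟩ := WW_poly h
  have hsq : (2 * (A : ℝ) * ω + B) ^ 2 = ((B ^ 2 - 4 * A * C : ℤ) : ℝ) := by
    push_cast; linear_combination 4 * (A : ℝ) * e1
  have hns : ¬ IsSquare (B ^ 2 - 4 * A * C) := by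
    rintro ⟨s, hs⟩
    rw [hs] at hsq
    have : (2 * (A : ℝ) * ω + B - s) * (2 * (A : ℝ) * ω + B + s) = 0 := by push_cast at hsq; linear_combination hsq
    rcases mul_eq_zero.1 this with h | h
    · have := (irr_lin hi (2 * A) (B - s) (by push_cast; linarith)).1; omega
    · have := (irr_lin hi (2 * A) (B + s) (by push_cast; linarith)).1; omega
  have hD : 0 < B ^ 2 - 4 * A * C := by nlinarith [sq_nonneg B]
  obtain ⟨x0, y0, hxy, hy0⟩ := Pell.exists_of_not_isSquare hD hns
  obtain ⟨x, y, hxy, hx, hy⟩ : ∃ x y : ℤ, x ^ 2 - (B ^ 2 - 4 * A * C) * y ^ 2 = 1 ∧ 0 < x ∧ 0 < y := by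
    refine ⟨|x0|, |y0|, by rw [sq_abs, sq_abs]; exact hxy, ?_, abs_pos.2 hy0⟩
    rw [abs_pos]; rintro rfl
    have : 0 < y0 ^ 2 := by positivity
    nlinarith
  have hdet : (x - B * y) * (x + B * y) - (-(2 * C * y)) * (2 * A * y) = 1 := by linear_combination hxy
  have hodd : ((x - B * y) * (x + B * y)) % 2 = 1 := by
    have : (x - B * y) * (x + B * y) = 1 + 2 * (-(2 * C * y) * (A * y)) := by linear_combination hdet
    omega
  have hodd1 : (x - B * y) % 2 = 1 := by
    by_contra hh
    have : (x - B * y) % 2 = 0 := by omega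
    rw [Int.mul_emod, this] at hodd; norm_num at hodd
  have hodd2 : (x + B * y) % 2 = 1 := by
    by_contra hh
    have : (x + B * y) % 2 = 0 := by omega
    rw [Int.mul_emod, this] at hodd; norm_num at hodd
  have hP : InP (x - B * y) (-(2 * C * y)) (2 * A * y) (x + B * y) := by
    refine toP_of_ineq hdet (Or.inr ⟨hodd1, ?_, ?_, hodd2⟩) ?_ (by positivity) (by linarith) ?_ ?_
    · rw [mul_assoc]; omega
    · rw [mul_assoc]; omega
    · nlinarith
    · nlinarith
    · nlinarith
  refine (fix_pow hP hdet ω hi h1 ?_).1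
  push_cast
  linear_combination 2 * (y : ℝ) * e1

theorem WW_tilde {ω : ℝ} (h : WW ω) : ∃ a b c d : ℤ, OmegaTildeE ω = !![a, b; c, d] ∧ InM a b c d ∧
    ω * (c * ω + d) = a * ω + b := by
  obtain ⟨hi, A, B, C, hA, e1, i1, i2, i3⟩ := WW_poly h
  obtain ⟨a, b, c, d, h1, h2, h3, h4⟩ := tilde_spec ω hi h.1 (WW_per h)
  refine ⟨a, b, c, d, h1, h2.toM h3 ?_, h4⟩
  have := (irr_lin hi (A * (d - a) - c * B) (-(A * b) - c * C) (by
    push_cast; linear_combination (A : ℝ) * h4 - (c : ℝ) * e1)).2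
  have hc := h2.cpos
  by_contra hb
  push Not at hb
  nlinarith [mul_pos hc (neg_pos.2 i3)]

theorem InM.fixpt {a b c d : ℤ} (h : InM a b c d) : ∃ ω : ℝ, WW ω ∧ ω * (c * ω + d) = a * ω + b := by
  have h0 := h.cgt
  have h1 := h.d1; have h2 := h.db; have h3 := h.ba; have h4 := h.det
  have hca := h.toP.hca
  have hcR : (0 : ℝ) < c := by exact_mod_cast (by omega : 0 < c)
  have hdetR : (a : ℝ) * d - b * c = 1 := by exact_mod_cast h4
  have hns : ¬ IsSquare ((a + d) ^ 2 - 4) := by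
    rintro ⟨s, hs⟩
    have ht : 3 ≤ a + d := by omega
    have e : (a + d) ^ 2 - 4 = |s| * |s| := by rw [hs, abs_mul_abs_self]
    have hs0 := abs_nonneg s
    set r := |s|
    have r1 : r < a + d := by by_contra hh; push Not at hh; nlinarith
    have r2 : a + d - 1 < r := by by_contra hh; push Not at hh; nlinarith
    omega
  have hD : (0 : ℤ) < (a + d) ^ 2 - 4 := by nlinarith
  have hDR : (0 : ℝ) < (((a + d) ^ 2 - 4 : ℤ) : ℝ) := by exact_mod_cast hD
  have hirr : Irrational (√(((a + d) ^ 2 - 4 : ℤ) : ℝ)) := by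
    rw [irrational_sqrt_intCast_iff]; exact ⟨hns, hD.le⟩
  set S := √(((a + d) ^ 2 - 4 : ℤ) : ℝ) with hS
  have hSpos : 0 < S := Real.sqrt_pos.2 hDR
  have hSS : S * S = ((a : ℝ) + d) ^ 2 - 4 := by
    rw [hS, Real.mul_self_sqrt hDR.le]; push_cast; ring
  set ω := (((a - d : ℤ) : ℝ) + S) / ((2 * c : ℤ) : ℝ) with hω
  set ω' := (((a - d : ℤ) : ℝ) - S) / ((2 * c : ℤ) : ℝ) with hω'
  have hi : Irrational ω := by
    rw [hω]
    exact (hirr.intCast_add _).div_intCast (by omega)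
  have hlt : ω' < ω := by
    rw [hω, hω']; push_cast; gcongr; linarith
  have hsum : (c : ℝ) * (ω + ω') = a - d := by
    rw [hω, hω']; push_cast; field_simp; ring
  have hprod : (c : ℝ) * (ω * ω') = -b := by
    rw [hω, hω']; push_cast; field_simp
    linear_combination (-1) * hSS - 4 * hdetR
  have eq1 : (c : ℝ) * ω ^ 2 + (d - a) * ω - b = 0 := by linear_combination ω * hsum - hprod
  have eq2 : (c : ℝ) * ω' ^ 2 + (d - a) * ω' - b = 0 := by linear_combination ω' * hsum - hprod
  have f1 : (c : ℝ) * ((ω - 1) * (1 - ω')) > 0 := by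
    have : (c : ℝ) + d < a + b := by exact_mod_cast (by omega : c + d < a + b)
    nlinarith
  have f2 : (c : ℝ) * ((ω + 1) * (1 + ω')) > 0 := by
    have : (b : ℝ) + d < a + c := by exact_mod_cast (by omega : b + d < a + c)
    nlinarith
  have f3 : (c : ℝ) * (ω * (-ω')) > 0 := by
    have : (0 : ℝ) < b := by exact_mod_cast (by omega : 0 < b)
    nlinarith
  have f1' := (pos_iff_pos_of_mul_pos (pos_of_mul_pos_right f1 hcR.le))
  have f2' := (pos_iff_pos_of_mul_pos (pos_of_mul_pos_right f2 hcR.le))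
  have f3' := (pos_iff_pos_of_mul_pos (pos_of_mul_pos_right f3 hcR.le))
  have g1 : 1 < ω := by
    by_contra hh
    push Not at hh
    have : ¬ (0 < 1 - ω') := fun h => by have := f1'.2 h; linarith
    linarith
  have g2 : ω' < 0 := by have := f3'.1 (by linarith); linarith
  have g3 : -1 < ω' := by have := f2'.1 (by linarith); linarith
  refine ⟨ω, ⟨g1, ω', ⟨hi, ?_⟩, g3, g2⟩, by linear_combination eq1⟩
  obtain ⟨g, hg⟩ : ∃ g : ℕ, g = Int.gcd (Int.gcd c (d - a) : ℤ) (-b) := ⟨_, rfl⟩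
  have hg1 : (g : ℤ) ∣ (Int.gcd c (d - a) : ℤ) := by rw [hg]; exact Int.gcd_dvd_left _ _
  have hg2 : (g : ℤ) ∣ -b := by rw [hg]; exact Int.gcd_dvd_right _ _
  have hg0 : 0 < g := by
    rw [hg]; exact Int.gcd_pos_of_ne_zero_right _ (by omega)
  obtain ⟨A, hA⟩ := hg1.trans (Int.gcd_dvd_left _ _)
  obtain ⟨B, hB⟩ := hg1.trans (Int.gcd_dvd_right _ _)
  obtain ⟨C, hC⟩ := hg2
  have hgZ : (0 : ℤ) < g := by exact_mod_cast hg0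
  have hgR : (g : ℝ) ≠ 0 := by exact_mod_cast hg0.ne'
  have hAR : (c : ℝ) = g * A := by exact_mod_cast hA
  have hBR : (d : ℝ) - a = g * B := by exact_mod_cast hB
  have hCR : -(b : ℝ) = g * C := by exact_mod_cast hC
  refine ⟨A, B, C, ?_, ?_, ?_, ?_, hlt.ne⟩
  · by_contra hh
    push Not at hh
    nlinarith
  · rw [hA, hB, hC, Int.gcd_mul_left, Nat.cast_mul, Int.natAbs_natCast, Int.gcd_mul_left, Int.natAbs_natCast] at hg
    have : g * 1 = g * Int.gcd (Int.gcd A B : ℤ) C := by rw [mul_one]; exact hg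
    exact (Nat.eq_of_mul_eq_mul_left hg0 this).symm
  · apply mul_left_cancel₀ hgR
    rw [mul_zero, ← eq1, hAR, hBR]
    linear_combination -hCR
  · apply mul_left_cancel₀ hgR
    rw [mul_zero, ← eq2, hAR, hBR]
    linear_combination -hCR

theorem InM.fix_unique {a b c d : ℤ} (h : InM a b c d) (u v : ℝ) (hu : 1 < u) (hv : 1 < v)
    (h1 : u * (c * u + d) = a * u + b) (h2 : v * (c * v + d) = a * v + b) : u = v := by
  have h0 := h.cgt
  have hd := h.d1; have hb := h.db
  have hcR : (0 : ℝ) < c := by exact_mod_cast (by omega : 0 < c)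
  have hbR : (0 : ℝ) < b := by exact_mod_cast (by omega : 0 < b)
  by_contra hne
  have e1 : (u - v) * ((c : ℝ) * u * v + b) = 0 := by linear_combination v * h1 - u * h2
  rcases mul_eq_zero.1 e1 with h | h
  · exact hne (sub_eq_zero.1 h)
  · have : 0 < (c : ℝ) * u * v := by positivity
    linarith

end

section

open Classical in
/-- admissible triples as a finite set -/
noncomputable def TN (N : ℕ) : Finset (ℕ × ℕ × ℕ) :=
  ((Finset.Icc 1 N) ×ˢ (Finset.Icc 1 N) ×ˢ (Finset.Icc 1 N)).filter
    fun x => x.2.1 ≤ x.1 ∧ x.1 < x.2.2 ∧ x.2.2 + x.2.1 ≤ N ∧ goodP x.1 x.2.1 x.2.2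

theorem card_TN (N : ℕ) : ((TN N).card : ℝ) = cntN N := by
  classical
  unfold TN cntN
  rw [Finset.card_filter, Nat.cast_sum, Finset.sum_product]
  refine Finset.sum_congr rfl fun b hb => ?_
  rw [Finset.mem_Icc] at hb
  rw [Finset.sum_product]
  dsimp only
  have hs : Finset.Ioc 0 (min b (N - b)) ⊆ Finset.Icc 1 N := fun d hd => by
    simp only [Finset.mem_Ioc, Finset.mem_Icc, le_min_iff] at *; omega
  rw [← Finset.sum_subset hs]
  · refine Finset.sum_congr rfl fun d hd => ?_
    simp only [Finset.mem_Ioc, le_min_iff] at hd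
    have hs : Finset.Ioc b (N - d) ⊆ Finset.Icc 1 N := fun a ha => by
      simp only [Finset.mem_Ioc, Finset.mem_Icc] at *; omega
    rw [← Finset.sum_subset hs]
    · refine Finset.sum_congr rfl fun a ha => ?_
      simp only [Finset.mem_Ioc] at ha
      by_cases hg : goodP b d a
      · rw [if_pos hg, if_pos ⟨by omega, by omega, by omega, hg⟩]; simp
      · rw [if_neg hg, if_neg fun h => hg h.2.2.2]; simp
    · intro a ha hn
      simp only [Finset.mem_Ioc, Finset.mem_Icc] at ha hn
      rw [if_neg (by rintro ⟨_, _, _, _⟩; omega)]; simp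
  · intro d hd hn
    refine Finset.sum_eq_zero fun a ha => ?_
    simp only [Finset.mem_Ioc, Finset.mem_Icc, le_min_iff] at ha hn hd
    rw [if_neg (by rintro ⟨_, _, _, _⟩; omega)]; simp

theorem mem_TN (N b d a : ℕ) : (b, d, a) ∈ TN N ↔ ∃ c : ℤ, InM a b c d ∧ a + d ≤ N := by
  classical
  simp only [TN, Finset.mem_filter, Finset.mem_product, Finset.mem_Icc]
  constructor
  · rintro ⟨_, h1, h2, h3, hg⟩
    rcases hg with ⟨hb, c, hc⟩ | ⟨hb, ha, hd, c, hc⟩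
    · refine ⟨2 * c, ⟨by linear_combination hc, Or.inr ?_, by omega, by omega, by omega⟩, h3⟩
      have hodd : ((a : ℤ) * d) % 2 = 1 := by
        have : (a : ℤ) * d = 1 + 2 * (b * c) := by linear_combination hc
        omega
      obtain ⟨k, hk⟩ := hb
      refine ⟨?_, by omega, by omega, ?_⟩
      · by_contra hh
        have : (a : ℤ) % 2 = 0 := by omega
        rw [Int.mul_emod, this] at hodd; norm_num at hodd
      · by_contra hh
        have : (d : ℤ) % 2 = 0 := by omega
        rw [Int.mul_emod, this] at hodd; norm_num at hodd
    · refine ⟨c, ⟨by linear_combination hc, Or.inl ?_, by omega, by omega, by omega⟩, h3⟩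
      obtain ⟨k, hk⟩ := ha
      obtain ⟨l, hl⟩ := hd
      rw [Nat.not_even_iff_odd] at hb
      obtain ⟨m, hm⟩ := hb
      refine ⟨by omega, by omega, ?_, by omega⟩
      have hodd : ((b : ℤ) * c) % 2 = 1 := by
        have : (b : ℤ) * c = 2 * (k * d) - 1 := by rw [← hc, hk]; push_cast; ring
        omega
      by_contra hh
      have : c % 2 = 0 := by omega
      rw [Int.mul_emod, this] at hodd; norm_num at hodd
  · rintro ⟨c, h, hN⟩
    have h1 := h.d1; have h2 := h.db; have h3 := h.ba; have h4 := h.det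
    refine ⟨⟨⟨by omega, by omega⟩, ⟨by omega, by omega⟩, by omega, by omega⟩, by omega, by omega, hN, ?_⟩
    rcases h.par with hp | hp
    · refine Or.inr ⟨?_, ?_, ?_, ⟨c, by linear_combination h4⟩⟩
      · rw [Nat.not_even_iff]; omega
      · rw [Nat.even_iff]; omega
      · rw [Nat.even_iff]; omega
    · refine Or.inl ⟨?_, ⟨c / 2, ?_⟩⟩
      · rw [Nat.even_iff]; omega
      · have : c = 2 * (c / 2) := by omega
        rw [this] at h4
        linear_combination h4

theorem trace_two (a b c d : ℤ) : (!![a, b; c, d] : Matrix (Fin 2) (Fin 2) ℤ).trace = a + d := Matrix.trace_fin_two_of _ _ _ _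

theorem trace_rec {a b c d : ℤ} (h : a * d - b * c = 1) (k : ℕ) :
    ((!![a, b; c, d] : Matrix (Fin 2) (Fin 2) ℤ) ^ (k + 2)).trace =
      (a + d) * (!![a, b; c, d] ^ (k + 1)).trace - (!![a, b; c, d] ^ k).trace := by
  have e : (!![a, b; c, d] : Matrix (Fin 2) (Fin 2) ℤ) ^ 2 = (a + d) • !![a, b; c, d] - 1 := by
    rw [sq, mat_mul, Matrix.one_fin_two]
    ext i j
    fin_cases i <;> fin_cases j <;> simp
    · linear_combination -h
    · ring
    · ring
    · linear_combination -h
  rw [pow_add, e, mul_sub, mul_smul_comm, Matrix.trace_sub, Matrix.trace_smul, pow_succ, mul_one, smul_eq_mul]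

theorem trace_grow {a b c d : ℤ} (h : a * d - b * c = 1) (ht : 3 ≤ a + d) (k : ℕ) :
    0 < (!![a, b; c, d] ^ k).trace ∧ (!![a, b; c, d] ^ k).trace ≤ (!![a, b; c, d] ^ (k + 1)).trace ∧
    2 ^ k ≤ (!![a, b; c, d] ^ k).trace ∧ 2 ^ (k + 1) ≤ (!![a, b; c, d] ^ (k + 1)).trace := by
  induction k with
  | zero =>
    rw [zero_add, pow_one, pow_zero, trace_two, Matrix.trace_one]
    simp; omega
  | succ k ih =>
    have h1 := trace_rec h k
    obtain ⟨i1, i2, i3, i4⟩ := ih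
    have : 2 * (!![a, b; c, d] ^ (k + 1)).trace ≤ (!![a, b; c, d] ^ (k + 1 + 1)).trace := by
      rw [h1]; nlinarith
    refine ⟨by linarith, by linarith, i4, ?_⟩
    rw [pow_succ]; linarith

theorem trace_sq {a b c d : ℤ} (h : a * d - b * c = 1) (ht : 3 ≤ a + d) (k : ℕ) (hk : 2 ≤ k) :
    (a + d) ^ 2 - 2 ≤ (!![a, b; c, d] ^ k).trace := by
  induction k, hk using Nat.le_induction with
  | base =>
    have := trace_rec h 0
    rw [zero_add, zero_add, pow_one, pow_zero, trace_two, Matrix.trace_one] at this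
    rw [this]; simp; linarith
  | succ k hk ih => exact ih.trans (trace_grow h ht k).2.1

/-- the counted set by trace -/
def WN (N : ℕ) : Set ℝ := {ω | WW ω ∧ (OmegaTildeE ω).trace ≤ (N : ℤ)}

/-- triple of entries -/
def tri (M : Matrix (Fin 2) (Fin 2) ℤ) : ℕ × ℕ × ℕ := ((M 0 1).toNat, (M 1 1).toNat, (M 0 0).toNat)

/-- matrix from a triple -/
def triMat (x : ℕ × ℕ × ℕ) : Matrix (Fin 2) (Fin 2) ℤ :=
  !![(x.2.2 : ℤ), (x.1 : ℤ); ((x.2.2 : ℤ) * x.2.1 - 1) / x.1, (x.2.1 : ℤ)]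

theorem triMat_tri {a b c d : ℤ} (h : InM a b c d) : triMat (tri !![a, b; c, d]) = !![a, b; c, d] := by
  have h1 := h.d1; have h2 := h.db; have h3 := h.ba; have h4 := h.det
  simp only [tri, triMat, Matrix.of_apply, Matrix.cons_val', Matrix.cons_val_zero, Matrix.cons_val_one, Matrix.cons_val_fin_one]
  rw [Int.toNat_of_nonneg (by omega : 0 ≤ b), Int.toNat_of_nonneg (by omega : 0 ≤ d), Int.toNat_of_nonneg (by omega : 0 ≤ a)]
  have : (a * d - 1) / b = c := by
    rw [show a * d - 1 = b * c by linear_combination h4]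
    exact Int.mul_ediv_cancel_left _ (by omega)
  rw [this]

theorem tri_mem {a b c d : ℤ} (h : InM a b c d) (N : ℕ) (hN : a + d ≤ N) : tri !![a, b; c, d] ∈ TN N := by
  have h1 := h.d1; have h2 := h.db; have h3 := h.ba; have h4 := h.det
  simp only [tri, Matrix.of_apply, Matrix.cons_val', Matrix.cons_val_zero, Matrix.cons_val_one, Matrix.cons_val_fin_one]
  rw [mem_TN]
  refine ⟨c, ?_, by omega⟩
  rwa [Int.toNat_of_nonneg (by omega : 0 ≤ b), Int.toNat_of_nonneg (by omega : 0 ≤ d), Int.toNat_of_nonneg (by omega : 0 ≤ a)]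

theorem WN_inj (N : ℕ) : Set.InjOn (fun ω => tri (OmegaTildeE ω)) (WN N) := by
  intro u hu v hv huv
  obtain ⟨a, b, c, d, h1, h2, h3⟩ := WW_tilde hu.1
  obtain ⟨a', b', c', d', h1', h2', h3'⟩ := WW_tilde hv.1
  dsimp only at huv
  have e : (!![a, b; c, d] : Matrix (Fin 2) (Fin 2) ℤ) = !![a', b'; c', d'] := by
    rw [← triMat_tri h2, ← triMat_tri h2', ← h1, ← h1', huv]
  have ea : a = a' := by simpa using congrFun (congrFun e 0) 0
  have eb : b = b' := by simpa using congrFun (congrFun e 0) 1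
  have ec : c = c' := by simpa using congrFun (congrFun e 1) 0
  have ed : d = d' := by simpa using congrFun (congrFun e 1) 1
  subst ea eb ec ed
  exact h2.fix_unique u v hu.1.1 hv.1.1 h3 h3'

theorem WN_maps (N : ℕ) : Set.MapsTo (fun ω => tri (OmegaTildeE ω)) (WN N) (TN N : Set (ℕ × ℕ × ℕ)) := by
  intro u hu
  obtain ⟨a, b, c, d, h1, h2, h3⟩ := WW_tilde hu.1
  have ht := hu.2
  rw [h1, trace_two] at ht
  dsimp only
  rw [h1]
  exact tri_mem h2 N ht

theorem WN_le (N : ℕ) : (WN N).ncard ≤ (TN N).card := by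
  have := Set.ncard_le_ncard_of_injOn _ (WN_maps N) (WN_inj N) (Finset.finite_toSet _)
  rwa [Set.ncard_coe_finset] at this

theorem TN_card_le (n : ℕ) : (TN n).card ≤ n ^ 3 := by
  classical
  unfold TN
  refine (Finset.card_filter_le _ _).trans ?_
  simp [Finset.card_product]
  ring_nf; exact le_rfl

theorem TN_le (N : ℕ) : (TN N).card ≤ (WN N).ncard + Nat.log 2 N * (Nat.sqrt (N + 2)) ^ 3 := by
  classical
  set n := Nat.sqrt (N + 2) with hn
  set B : Finset (ℕ × ℕ × ℕ) := (Finset.Icc 1 (Nat.log 2 N)).biUnion fun k => (TN n).image fun x => tri (triMat x ^ k) with hB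
  have hfin : (WN N).Finite := Set.Finite.of_injOn (WN_maps N) (WN_inj N) (Finset.finite_toSet _)
  have hsub : (TN N : Set (ℕ × ℕ × ℕ)) ⊆ Set.image (fun ω => tri (OmegaTildeE ω)) (WN N) ∪ (B : Set (ℕ × ℕ × ℕ)) := by
    rintro ⟨b, d, a⟩ hx
    obtain ⟨c, hM, hN⟩ := (mem_TN N b d a).1 hx
    obtain ⟨ω, hω, hfix⟩ := hM.fixpt
    have hi := (WW_poly hω).1
    obtain ⟨_, j, hj, hj2⟩ := fix_pow hM.toP hM.det ω hi hω.1 hfix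
    have htri : tri !![(a : ℤ), b; c, d] = (b, d, a) := by simp [tri]
    have htr : (!![(a : ℤ), b; c, d] : Matrix (Fin 2) (Fin 2) ℤ).trace ≤ N := by
      rw [trace_two]; exact_mod_cast hN
    by_cases hj1 : j = 1
    · left
      rw [hj1, pow_one] at hj2
      refine ⟨ω, ⟨hω, ?_⟩, ?_⟩
      · rw [← hj2]; exact htr
      · dsimp only; rw [← hj2, htri]
    · right
      obtain ⟨a', b', c', d', h1, h2, h3⟩ := WW_tilde hω
      have i1 := h2.d1; have i2 := h2.db; have i3 := h2.ba
      rw [h1] at hj2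
      rw [hj2] at htr
      have t1 := trace_sq h2.det (by omega) j (by omega)
      have t2 := (trace_grow h2.det (by omega) j).2.2.1
      rw [hB, Finset.coe_biUnion, Set.mem_iUnion₂]
      refine ⟨j, ?_, ?_⟩
      · rw [Finset.mem_coe, Finset.mem_Icc]
        refine ⟨hj, Nat.le_log_of_pow_le (by norm_num) ?_⟩
        exact_mod_cast t2.trans htr
      · rw [Finset.mem_coe, Finset.mem_image]
        refine ⟨tri !![a', b'; c', d'], tri_mem h2 n ?_, ?_⟩
        · have : ((a' + d').toNat : ℤ) = a' + d' := Int.toNat_of_nonneg (by omega)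
          rw [← this]
          have h5 : (a' + d').toNat ≤ n := by
            rw [hn, Nat.le_sqrt]
            zify
            rw [this]; nlinarith
          exact_mod_cast h5
        · rw [triMat_tri h2, ← hj2, htri]
  have hB2 : B.card ≤ Nat.log 2 N * n ^ 3 := by
    refine Finset.card_biUnion_le.trans ?_
    refine (Finset.sum_le_card_nsmul _ _ (n ^ 3) fun k _ => Finset.card_image_le.trans (TN_card_le n)).trans ?_
    simp
  have h1 := Set.ncard_le_ncard hsub ((hfin.image _).union (Finset.finite_toSet _))
  rw [Set.ncard_coe_finset] at h1
  refine h1.trans ((Set.ncard_union_le _ _).trans ?_)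
  rw [Set.ncard_coe_finset, Set.ncard_image_of_injOn (WN_inj N)]
  omega

end

section

theorem rho_iff {t R : ℝ} (ht : 3 ≤ t) :
    2 * Real.log ((t + Real.sqrt (t ^ 2 - 4)) / 2) ≤ R ↔ t ≤ Real.exp (R / 2) + Real.exp (-(R / 2)) ∧ 0 < R := by
  set s := Real.sqrt (t ^ 2 - 4) with hs
  have hs2 : s ^ 2 = t ^ 2 - 4 := Real.sq_sqrt (by nlinarith)
  have hs0 : 0 ≤ s := Real.sqrt_nonneg _
  set l := (t + s) / 2 with hl
  have hl1 : 1 < l := by rw [hl]; linarith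
  have hq : l ^ 2 - t * l + 1 = 0 := by rw [hl]; nlinarith
  have hlog : 0 < Real.log l := Real.log_pos hl1
  set E := Real.exp (R / 2) with hE
  have hE0 : 0 < E := Real.exp_pos _
  have hEn : Real.exp (-(R / 2)) = 1 / E := by rw [Real.exp_neg, one_div]
  rw [hEn]
  have hb : E + 1 / E = (E ^ 2 + 1) / E := by field_simp
  rw [hb, le_div_iff₀ hE0]
  have h1 : 2 * Real.log l ≤ R ↔ l ≤ E := by
    rw [hE, ← Real.log_le_iff_le_exp (by linarith)]
    constructor <;> intro h <;> linarith
  rw [h1]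
  constructor
  · intro h
    refine ⟨?_, ?_⟩
    · have : 0 ≤ (E - l) * (E * l - 1) := mul_nonneg (by linarith) (by nlinarith)
      have h3 : l * (t * E) ≤ l * (E ^ 2 + 1) := by nlinarith
      exact le_of_mul_le_mul_left h3 (by linarith)
    · have := h1.2 h; linarith
  · rintro ⟨h, hR⟩
    have hE1 : 1 < E := by rw [hE]; exact Real.one_lt_exp_iff.2 (by linarith)
    by_contra hlt
    push Not at hlt
    have : 0 < (l - E) * (E * l - 1) := mul_pos (by linarith) (by nlinarith)
    have h3 : l * (t * E) ≤ l * (E ^ 2 + 1) := mul_le_mul_of_nonneg_left h (by linarith)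
    nlinarith

theorem set_eq (R : ℝ) (hR : 0 < R) :
    {ω : ℝ | 1 < ω ∧ rhoE ω ≤ R ∧ ∃ ω' : ℝ, IsConjPair ω ω' ∧ -1 < ω' ∧ ω' < 0} =
      WN ⌊Real.exp (R / 2) + Real.exp (-(R / 2))⌋₊ := by
  have key : ∀ ω, WW ω → (rhoE ω ≤ R ↔
      (OmegaTildeE ω).trace ≤ ((⌊Real.exp (R / 2) + Real.exp (-(R / 2))⌋₊ : ℕ) : ℤ)) := by
    intro ω h
    obtain ⟨a, b, c, d, hO, hM, -⟩ := WW_tilde h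
    have h1 := hM.d1; have h2 := hM.db; have h3 := hM.ba
    have ht : 3 ≤ (OmegaTildeE ω).trace := by rw [hO, trace_two]; omega
    unfold rhoE specRad
    rw [rho_iff (by exact_mod_cast ht)]
    obtain ⟨n, hn⟩ := Int.eq_ofNat_of_zero_le (show 0 ≤ (OmegaTildeE ω).trace by omega)
    rw [hn, Int.ofNat_le, Nat.le_floor_iff (by positivity)]
    push_cast
    exact ⟨fun h => h.1, fun h => ⟨h, hR⟩⟩
  ext ω
  constructor
  · rintro ⟨h1, h2, h3⟩
    exact ⟨⟨h1, h3⟩, (key ω ⟨h1, h3⟩).1 h2⟩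
  · rintro ⟨h, h2⟩
    exact ⟨h.1, (key ω h).2 h2, h.2⟩

theorem err_bound (δ : ℝ) (hδ : 0 < δ) : ∃ C, 0 < C ∧ ∀ N : ℕ, 0 < N →
    ((Nat.log 2 N * (Nat.sqrt (N + 2)) ^ 3 : ℕ) : ℝ) ≤ C * (N : ℝ) ^ (3 / 2 + δ) := by
  refine ⟨12 * (2 + 1 / δ), by positivity, fun N hN => ?_⟩
  have hN1 : (1 : ℝ) ≤ N := by exact_mod_cast hN
  have hN0 : (0 : ℝ) < N := by linarith
  have h1 : (Nat.log 2 N : ℝ) ≤ 2 * ((2 + 1 / δ) * (N : ℝ) ^ δ) := by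
    have h := log_le_pow δ hδ N hN1
    have h2 : (2 : ℝ) ^ (Nat.log 2 N) ≤ N := by exact_mod_cast Nat.pow_log_le_self 2 hN.ne'
    have h3 := Real.log_le_log (by positivity) h2
    rw [Real.log_pow] at h3
    have h4 := Real.log_two_gt_d9
    have h5 : (0 : ℝ) ≤ Nat.log 2 N := by positivity
    nlinarith
  have h2 : ((Nat.sqrt (N + 2) : ℕ) : ℝ) ≤ Real.sqrt 3 * Real.sqrt N := by
    rw [← Real.sqrt_mul (by norm_num)]
    apply Real.le_sqrt_of_sq_le
    have : (Nat.sqrt (N + 2)) ^ 2 ≤ N + 2 := Nat.sqrt_le' _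
    have : ((Nat.sqrt (N + 2) : ℕ) : ℝ) ^ 2 ≤ N + 2 := by exact_mod_cast this
    linarith
  have h3 : ((Nat.sqrt (N + 2) : ℕ) : ℝ) ^ 3 ≤ 6 * (N : ℝ) ^ (3 / 2 : ℝ) := by
    have e : (N : ℝ) ^ (3 / 2 : ℝ) = Real.sqrt N ^ 3 := by
      rw [Real.sqrt_eq_rpow, ← Real.rpow_natCast, ← Real.rpow_mul hN0.le]; norm_num
    rw [e]
    calc _ ≤ (Real.sqrt 3 * Real.sqrt N) ^ 3 := by gcongr
      _ = Real.sqrt 3 ^ 2 * Real.sqrt 3 * Real.sqrt N ^ 3 := by ring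
      _ ≤ 6 * Real.sqrt N ^ 3 := by
        gcongr
        rw [Real.sq_sqrt (by norm_num)]
        have : Real.sqrt 3 ≤ 2 := Real.sqrt_le_iff.2 (by norm_num)
        linarith
  push_cast
  rw [Real.rpow_add hN0]
  calc _ ≤ 2 * ((2 + 1 / δ) * (N : ℝ) ^ δ) * (6 * (N : ℝ) ^ (3 / 2 : ℝ)) := by gcongr
    _ = _ := by ring

theorem main_count (ε : ℝ) (hε : 0 < ε) : ∃ K > (0 : ℝ), ∀ R > (0 : ℝ),
      |({ω : ℝ | 1 < ω ∧ rhoE ω ≤ R ∧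
          ∃ ω' : ℝ, IsConjPair ω ω' ∧ -1 < ω' ∧ ω' < 0}.ncard : ℝ) -
        Real.exp R * Real.log 2 / Real.pi ^ 2|
      ≤ K * Real.exp ((3 / 4 + ε) * R) := by
  obtain ⟨C1, hC1, h1⟩ := cnt_asymp (2 * ε) (by linarith)
  obtain ⟨C2, hC2, h2⟩ := err_bound (2 * ε) (by linarith)
  refine ⟨(C1 + C2) * 2 ^ (3 / 2 + 2 * ε) + 3, by positivity, fun R hR => ?_⟩
  rw [set_eq R hR]
  set E := Real.exp (R / 2) with hE
  have hE1 : 1 < E := by rw [hE]; exact Real.one_lt_exp_iff.2 (by linarith)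
  have hE0 : 0 < E := by linarith
  have hR2 : Real.exp R = E ^ 2 := by rw [hE, ← Real.exp_nat_mul]; congr 1; push_cast; ring
  have hEn : Real.exp (-(R / 2)) = 1 / E := by rw [Real.exp_neg, one_div]
  rw [hEn, hR2]
  have hi0 : 0 < 1 / E := by positivity
  have hi1 : 1 / E < 1 := by rw [div_lt_one hE0]; exact hE1
  have hEi : E * (1 / E) = 1 := by field_simp
  set N := ⌊E + 1 / E⌋₊ with hN
  have hNle : (N : ℝ) ≤ E + 1 / E := Nat.floor_le (by positivity)
  have hNgt : E + 1 / E < N + 1 := Nat.lt_floor_add_one _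
  have hNpos : 0 < N := by
    rw [hN, Nat.floor_pos]; linarith
  have hN1 : (1 : ℝ) ≤ N := by exact_mod_cast hNpos
  have a1 := h1 N hNpos
  have a2 := h2 N hNpos
  have b1 : ((WN N).ncard : ℝ) ≤ cntN N := by rw [← card_TN]; exact_mod_cast WN_le N
  have b2 : cntN N ≤ (WN N).ncard + ((Nat.log 2 N * (Nat.sqrt (N + 2)) ^ 3 : ℕ) : ℝ) := by
    rw [← card_TN]; exact_mod_cast TN_le N
  have hpow : (N : ℝ) ^ (3 / 2 + 2 * ε) ≤ 2 ^ (3 / 2 + 2 * ε) * Real.exp ((3 / 4 + ε) * R) := by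
    have e : Real.exp ((3 / 4 + ε) * R) = E ^ (3 / 2 + 2 * ε) := by
      rw [hE, ← Real.exp_mul]; congr 1; ring
    rw [e, ← Real.mul_rpow (by norm_num) hE0.le]
    apply Real.rpow_le_rpow (by positivity) (by linarith) (by positivity)
  have hEX : E ≤ Real.exp ((3 / 4 + ε) * R) := by
    rw [hE]; apply Real.exp_le_exp.2; nlinarith
  set X := Real.exp ((3 / 4 + ε) * R) with hX
  set c := Real.log 2 / Real.pi ^ 2 with hc
  have hc0 : 0 ≤ c := by
    rw [hc]; have := Real.log_pos (by norm_num : (1:ℝ) < 2); positivity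
  have hc1 : c ≤ 1 := by
    rw [hc, div_le_one (by positivity)]
    have := Real.log_two_lt_d9
    have := Real.pi_gt_three
    nlinarith
  have hsq : |(N : ℝ) ^ 2 - E ^ 2| ≤ 3 * E := by
    rw [abs_le]; constructor <;> nlinarith
  have hsq2 : |(N : ℝ) ^ 2 * c - E ^ 2 * c| ≤ 3 * E := by
    rw [← sub_mul, abs_mul, abs_of_nonneg hc0]
    nlinarith [abs_nonneg ((N : ℝ) ^ 2 - E ^ 2)]
  rw [mul_div_assoc] at a1 ⊢
  rw [abs_le] at a1 hsq2 ⊢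
  have q1 : C1 * (N : ℝ) ^ (3 / 2 + 2 * ε) ≤ C1 * (2 ^ (3 / 2 + 2 * ε) * X) := by gcongr
  have q2 : C2 * (N : ℝ) ^ (3 / 2 + 2 * ε) ≤ C2 * (2 ^ (3 / 2 + 2 * ε) * X) := by gcongr
  have q3 : ((C1 + C2) * 2 ^ (3 / 2 + 2 * ε) + 3) * X =
    C1 * (2 ^ (3 / 2 + 2 * ε) * X) + C2 * (2 ^ (3 / 2 + 2 * ε) * X) + 3 * X := by ring
  have p2 : 0 ≤ C2 * (2 ^ (3 / 2 + 2 * ε) * X) := by positivity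
  rw [q3]
  constructor <;> linarith [a1.1, a1.2, hsq2.1, hsq2.2]

end

theorem stmt2 :
    ∀ ε > (0 : ℝ), ∃ K > (0 : ℝ), ∀ R > (0 : ℝ),
      |({ω : ℝ | 1 < ω ∧ rhoE ω ≤ R ∧
          ∃ ω' : ℝ, IsConjPair ω ω' ∧ -1 < ω' ∧ ω' < 0}.ncard : ℝ) -
        Real.exp R * Real.log 2 / Real.pi ^ 2|
      ≤ K * Real.exp ((3 / 4 + ε) * R) := by
  intro ε hε
  exact main_count ε hε
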